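/- arXiv:1602.02835 — 8 statements merged into one kernel-verified Lean document; each statement's English description precedes it below -/
import Mathlib

section
/- For every prime p ≥ 3 and every n ∈ ℕ, the only holomorphic eta quotient of weight 1/2 and level pⁿ is η_{pⁿ} : z ↦ η(pⁿz). Equivalently: if X : D_{pⁿ} → ℤ satisfies Σ_{j=0}^{n} X_{p^j} = 1, lcm{d : X_d ≠ 0} = pⁿ, and Σ_{d|pⁿ} (pⁿ·gcd(d,t)²)/(d·gcd(t²,pⁿ))·X_d ≥ 0 for every t ∈ D_{pⁿ}, then X_{pⁿ} = 1 and X_{p^j} = 0 for all j < n. -/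
open Finset

/-- `24` times the order of the eta quotient `η^X` at the cusp `1/t` of `Γ₀(N)`:
`∑_{d ∣ N} (N · gcd(d,t)²)/(d · gcd(t²,N)) · X_d`. -/
def etaOrd (N : ℕ) (X : ℕ → ℤ) (t : ℕ) : ℚ :=
  ∑ d ∈ N.divisors,
    ((N : ℚ) * (Nat.gcd d t : ℚ) ^ 2 / ((d : ℚ) * (Nat.gcd (t ^ 2) N : ℚ))) * (X d : ℚ)

/-- The eta quotient `η^X` on `Γ₀(N)` is holomorphic: all cusp orders are nonnegative. -/
def IsHolEta (N : ℕ) (X : ℕ → ℤ) : Prop :=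
  ∀ t ∈ N.divisors, 0 ≤ etaOrd N X t

/-- The exponent vector `X` is supported on the divisors of `N`, i.e. `X : D_N → ℤ`. -/
def SuppIn (N : ℕ) (X : ℕ → ℤ) : Prop :=
  ∀ d : ℕ, ¬ d ∣ N → X d = 0

/-- The level of the eta quotient `η^X` on `Γ₀(N)`: `lcm {d ∣ N : X_d ≠ 0}`. -/
def etaLevel (N : ℕ) (X : ℕ → ℤ) : ℕ :=
  (N.divisors.filter fun d => X d ≠ 0).lcm id

/-- The kernel `q ^ |i - j|`, written with truncated subtraction. -/
def expKernel (q : ℚ) (i j : ℕ) : ℚ := q ^ (i - j) * q ^ (j - i)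

/-- The transform of `a` on `{0, …, n}` by `expKernel`, with the output index shifted by one so
that it also covers the two positions adjacent to the ends of the interval. -/
def kernelSum (q : ℚ) (n : ℕ) (a : ℕ → ℚ) (i : ℕ) : ℚ :=
  ∑ j ∈ range (n + 1), expKernel q i (j + 1) * a j

theorem sum_expKernel (q : ℚ) (m N : ℕ) (h : m < N) :
    (∑ i ∈ range N, expKernel q i m) * (1 - q) = 1 + q - q ^ (m + 1) - q ^ (N - m) := by
  induction N, h using Nat.le_induction with
  | base =>
    have key : ∑ i ∈ range (m + 1), expKernel q i m = ∑ i ∈ range (m + 1), q ^ i := by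
      rw [← Finset.sum_range_reflect (fun i => q ^ i)]
      refine Finset.sum_congr rfl fun i hi => ?_
      have hi' : i - m = 0 := by grind
      simp [expKernel, hi']
    rw [key, geom_sum_mul_neg, Nat.succ_eq_add_one, Nat.add_sub_cancel_left]
    ring
  | succ N h ih =>
    obtain ⟨e, rfl⟩ := Nat.exists_eq_add_of_lt h
    rw [Finset.sum_range_succ, add_mul, ih]
    have h1 : m + e + 1 - m = e + 1 := by omega
    have h2 : m + e + 1 + 1 - m = e + 2 := by omega
    have h3 : m - (m + e + 1) = 0 := by omega
    simp only [expKernel, h1, h2, h3]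
    ring

theorem expKernel_tridiagonal (q : ℚ) (k j : ℕ) :
    (1 + q ^ 2) * expKernel q (k + 1) (j + 1)
      - q * (expKernel q k (j + 1) + expKernel q (k + 2) (j + 1))
      = if j = k then 1 - q ^ 2 else 0 := by
  rcases lt_trichotomy j k with h | rfl | h
  · obtain ⟨e, rfl⟩ := Nat.exists_eq_add_of_lt h
    have h1 : j + e + 1 + 1 - (j + 1) = e + 1 := by omega
    have h2 : j + 1 - (j + e + 1 + 1) = 0 := by omega
    have h3 : j + e + 1 - (j + 1) = e := by omega
    have h4 : j + 1 - (j + e + 1) = 0 := by omega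
    have h5 : j + e + 1 + 2 - (j + 1) = e + 2 := by omega
    have h6 : j + 1 - (j + e + 1 + 2) = 0 := by omega
    rw [if_neg (by omega)]
    simp only [expKernel, h1, h2, h3, h4, h5, h6]
    ring
  · have h3 : j - (j + 1) = 0 := by omega
    have h4 : j + 1 - j = 1 := by omega
    have h5 : j + 2 - (j + 1) = 1 := by omega
    have h6 : j + 1 - (j + 2) = 0 := by omega
    simp only [expKernel, Nat.sub_self, h3, h4, h5, h6, if_true]
    ring
  · obtain ⟨e, rfl⟩ := Nat.exists_eq_add_of_lt h
    have h1 : k + 1 - (k + e + 1 + 1) = 0 := by omega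
    have h2 : k + e + 1 + 1 - (k + 1) = e + 1 := by omega
    have h3 : k - (k + e + 1 + 1) = 0 := by omega
    have h4 : k + e + 1 + 1 - k = e + 2 := by omega
    have h5 : k + 2 - (k + e + 1 + 1) = 0 := by omega
    have h6 : k + e + 1 + 1 - (k + 2) = e := by omega
    rw [if_neg (by omega)]
    simp only [expKernel, h1, h2, h3, h4, h5, h6]
    ring

theorem kernelSum_tridiagonal (q : ℚ) (n : ℕ) (a : ℕ → ℚ) (k : ℕ) (hk : k ≤ n) :
    (1 + q ^ 2) * kernelSum q n a (k + 1) - q * (kernelSum q n a k + kernelSum q n a (k + 2))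
      = (1 - q ^ 2) * a k := by
  have h : ∑ j ∈ range (n + 1), (if j = k then 1 - q ^ 2 else 0) * a j = (1 - q ^ 2) * a k := by
    simp [ite_mul, Nat.lt_succ_of_le hk]
  rw [← h, kernelSum, kernelSum, kernelSum, ← Finset.sum_add_distrib, Finset.mul_sum,
    Finset.mul_sum, ← Finset.sum_sub_distrib]
  refine Finset.sum_congr rfl fun j _ => ?_
  rw [← expKernel_tridiagonal]
  ring

theorem kernelSum_zero (q : ℚ) (n : ℕ) (a : ℕ → ℚ) :
    kernelSum q n a 0 = q * kernelSum q n a 1 := by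
  rw [kernelSum, kernelSum, Finset.mul_sum]
  refine Finset.sum_congr rfl fun j _ => ?_
  have h : 1 - (j + 1) = 0 := by omega
  simp only [expKernel, h, Nat.zero_sub, Nat.sub_zero, Nat.add_sub_cancel]
  ring

theorem kernelSum_add_two (q : ℚ) (n : ℕ) (a : ℕ → ℚ) :
    kernelSum q n a (n + 2) = q * kernelSum q n a (n + 1) := by
  rw [kernelSum, kernelSum, Finset.mul_sum]
  refine Finset.sum_congr rfl fun j hj => ?_
  obtain ⟨e, rfl⟩ := Nat.exists_eq_add_of_le (Nat.lt_succ_iff.mp (Finset.mem_range.mp hj))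
  have h1 : j + e + 2 - (j + 1) = e + 1 := by omega
  have h2 : j + e + 1 - (j + 1) = e := by omega
  have h3 : j + 1 - (j + e + 2) = 0 := by omega
  have h4 : j + 1 - (j + e + 1) = 0 := by omega
  simp only [expKernel, h1, h2, h3, h4]
  ring

theorem sum_kernelSum (q : ℚ) (n : ℕ) (a : ℕ → ℚ) :
    (∑ i ∈ range (n + 3), kernelSum q n a i) * (1 - q)
      = (1 + q) * ∑ j ∈ range (n + 1), a j
        - q * (kernelSum q n a 0 + kernelSum q n a (n + 2)) := by
  simp only [kernelSum]
  rw [Finset.sum_comm, Finset.sum_mul, ← Finset.sum_add_distrib, Finset.mul_sum, Finset.mul_sum,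
    ← Finset.sum_sub_distrib]
  refine Finset.sum_congr rfl fun j hj => ?_
  have hj' := Finset.mem_range.mp hj
  rw [← Finset.sum_mul, mul_right_comm, sum_expKernel q (j + 1) (n + 3) (by omega)]
  obtain ⟨e, rfl⟩ := Nat.exists_eq_add_of_le (Nat.lt_succ_iff.mp hj')
  have h1 : j + e + 2 - (j + 1) = e + 1 := by omega
  have h2 : j + 1 - (j + e + 2) = 0 := by omega
  have h3 : j + e + 3 - (j + 1) = e + 2 := by omega
  simp only [expKernel, h1, h2, h3, Nat.zero_sub, Nat.sub_zero]
  ring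

/-- If all kernel sums of a vector of total mass one are nonnegative, then every entry of the
vector exceeds `-1`. -/
theorem neg_one_lt_of_kernelSum_nonneg (q : ℚ) (hq : 0 < q) (hq3 : q ≤ 1 / 3) (n : ℕ) (a : ℕ → ℚ)
    (hsum : ∑ j ∈ range (n + 1), a j = 1) (hnonneg : ∀ k ≤ n, 0 ≤ kernelSum q n a (k + 1))
    (k : ℕ) (hk : k ≤ n) : -1 < a k := by
  have hfirst : 0 ≤ kernelSum q n a 0 := by
    rw [kernelSum_zero]; exact mul_nonneg hq.le (hnonneg 0 (Nat.zero_le n))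
  have hlast : 0 ≤ kernelSum q n a (n + 2) := by
    rw [kernelSum_add_two]; exact mul_nonneg hq.le (hnonneg n le_rfl)
  have hall : ∀ i ∈ range (n + 3), 0 ≤ kernelSum q n a i := by
    intro i hi
    have hi' := Finset.mem_range.mp hi
    rcases Nat.eq_zero_or_pos i with rfl | hpos
    · exact hfirst
    · rcases Nat.lt_or_ge i (n + 2) with hlt | hge
      · obtain ⟨m, rfl⟩ := Nat.exists_eq_add_of_le' hpos
        exact hnonneg m (by omega)
      · obtain rfl : i = n + 2 := by omega
        exact hlast
  have hpair : kernelSum q n a k + kernelSum q n a (k + 2)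
      ≤ ∑ i ∈ range (n + 3), kernelSum q n a i := by
    rw [← Finset.sum_pair (f := kernelSum q n a) (show k ≠ k + 2 by omega)]
    refine Finset.sum_le_sum_of_subset_of_nonneg ?_ fun i hi _ => hall i hi
    intro i hi
    simp only [Finset.mem_insert, Finset.mem_singleton, Finset.mem_range] at hi ⊢
    omega
  have htotal := sum_kernelSum q n a
  rw [hsum] at htotal
  have hlocal := kernelSum_tridiagonal q n a k hk
  have hk0 := hnonneg k hk
  set s := kernelSum q n a k + kernelSum q n a (k + 2)
  have hs : s * (1 - q) ≤ 1 + q := by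
    have h1 := mul_le_mul_of_nonneg_right hpair (show 0 ≤ 1 - q by linarith)
    have h2 := mul_nonneg hq.le (add_nonneg hfirst hlast)
    linarith
  have hlow : -(q * s) ≤ (1 - q ^ 2) * a k := by
    have := mul_nonneg (show 0 ≤ 1 + q ^ 2 by positivity) hk0
    linarith
  by_contra hcon
  have hak : a k ≤ -1 := not_lt.mp hcon
  have h1 : 1 - q ^ 2 ≤ q * s := by
    have := mul_le_mul_of_nonneg_left hak (show 0 ≤ 1 - q ^ 2 by nlinarith)
    linarith
  have h2 : (1 - q ^ 2) * (1 - q) ≤ q * (1 + q) := by nlinarith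
  nlinarith

theorem etaOrd_prime_pow (p : ℕ) (hp : p.Prime) (n : ℕ) (X : ℕ → ℤ) (k : ℕ) :
    etaOrd (p ^ n) X (p ^ k) =
      (p : ℚ) ^ (n + k) / (Nat.gcd ((p ^ k) ^ 2) (p ^ n) : ℚ)
        * kernelSum (p : ℚ)⁻¹ n (fun j => (X (p ^ j) : ℚ)) (k + 1) := by
  have hp0 : (p : ℚ) ≠ 0 := by exact_mod_cast hp.ne_zero
  have hg0 : (Nat.gcd ((p ^ k) ^ 2) (p ^ n) : ℚ) ≠ 0 := by
    exact_mod_cast (Nat.gcd_pos_of_pos_right _ (pow_pos hp.pos n)).ne'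
  rw [etaOrd, Nat.sum_divisors_prime_pow hp, kernelSum, Finset.mul_sum]
  refine Finset.sum_congr rfl fun j _ => ?_
  generalize (Nat.gcd ((p ^ k) ^ 2) (p ^ n) : ℚ) = g at hg0
  rw [← mul_assoc]
  congr 1
  rcases le_total j k with h | h
  · rw [Nat.gcd_eq_left (pow_dvd_pow p h)]
    obtain ⟨e, rfl⟩ := Nat.exists_eq_add_of_le h
    have h1 : j + e + 1 - (j + 1) = e := by omega
    have h2 : j + 1 - (j + e + 1) = 0 := by omega
    simp only [expKernel, h1, h2, inv_pow]
    push_cast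
    field_simp
    ring
  · rw [Nat.gcd_eq_right (pow_dvd_pow p h)]
    obtain ⟨e, rfl⟩ := Nat.exists_eq_add_of_le h
    have h1 : k + e + 1 - (k + 1) = e := by omega
    have h2 : k + 1 - (k + e + 1) = 0 := by omega
    simp only [expKernel, h1, h2, inv_pow]
    push_cast
    field_simp
    ring

theorem apply_ne_zero_of_etaLevel_prime_pow (p : ℕ) (hp : p.Prime) (n : ℕ) (hn : 0 < n)
    (X : ℕ → ℤ) (hlev : etaLevel (p ^ n) X = p ^ n) : X (p ^ n) ≠ 0 := by
  intro h0
  have hdvd : etaLevel (p ^ n) X ∣ p ^ (n - 1) := by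
    refine Finset.lcm_dvd fun d hd => ?_
    obtain ⟨hd, hX⟩ := Finset.mem_filter.mp hd
    obtain ⟨j, hj, rfl⟩ := (Nat.mem_divisors_prime_pow hp n).mp hd
    have hjn : j ≠ n := by rintro rfl; exact hX h0
    exact pow_dvd_pow p (by omega)
  rw [hlev, Nat.pow_dvd_pow_iff_le_right hp.one_lt] at hdvd
  omega

/-- For every prime `p ≥ 3` and every `n ∈ ℕ`, the only holomorphic eta quotient of
weight `1/2` and level `pⁿ` is `η_{pⁿ}`. -/
theorem weight_half_odd_prime_power_level (p : ℕ) (hp : p.Prime) (hp3 : 3 ≤ p)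
    (n : ℕ) (hn : 0 < n) (X : ℕ → ℤ)
    (hsupp : SuppIn (p ^ n) X)
    (hwt : ∑ d ∈ (p ^ n).divisors, X d = 1)
    (hlev : etaLevel (p ^ n) X = p ^ n)
    (hhol : IsHolEta (p ^ n) X) :
    X (p ^ n) = 1 ∧ ∀ j < n, X (p ^ j) = 0 := by
  have hnonneg : ∀ j ≤ n, 0 ≤ X (p ^ j) := by
    intro j hj
    have hp3' : (3 : ℚ) ≤ p := by exact_mod_cast hp3
    have hp0 : (0 : ℚ) < p := by linarith
    have hq3 : (p : ℚ)⁻¹ ≤ 1 / 3 := by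
      rw [one_div]; exact inv_anti₀ (by norm_num) hp3'
    have hlt : (-1 : ℚ) < X (p ^ j) := by
      refine neg_one_lt_of_kernelSum_nonneg (p : ℚ)⁻¹ (inv_pos.mpr hp0) hq3 n
        (fun j => (X (p ^ j) : ℚ)) ?_ ?_ j hj
      · rw [Nat.sum_divisors_prime_pow hp] at hwt
        exact_mod_cast hwt
      · intro k hk
        have h := hhol (p ^ k) ((Nat.mem_divisors_prime_pow hp n).mpr ⟨k, hk, rfl⟩)
        rw [etaOrd_prime_pow p hp] at h
        refine nonneg_of_mul_nonneg_right h (div_pos (pow_pos hp0 _) ?_)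
        exact_mod_cast Nat.gcd_pos_of_pos_right _ (pow_pos hp.pos n)
    have hlt' : -1 < X (p ^ j) := by exact_mod_cast hlt
    omega
  have hne := apply_ne_zero_of_etaLevel_prime_pow p hp n hn X hlev
  have hn0 := hnonneg n le_rfl
  rw [Nat.sum_divisors_prime_pow hp, Finset.sum_range_succ] at hwt
  have hterms : ∀ j ∈ range n, 0 ≤ X (p ^ j) := fun j hj =>
    hnonneg j (Finset.mem_range.mp hj).le
  have hrest := Finset.sum_nonneg hterms
  have hzero : ∑ j ∈ range n, X (p ^ j) = 0 := by omega
  refine ⟨by omega, fun j hj => ?_⟩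
  exact (Finset.sum_eq_zero_iff_of_nonneg hterms).mp hzero j (Finset.mem_range.mpr hj)
end

section
/- Let p ≥ 3 be a prime, n ∈ ℕ, N' ∈ ℕ with p ∤ N', and set M = pⁿ·N'. Let X : D_M → ℤ be such that η^X is a holomorphic eta quotient of weight 1/2 on Γ₀(M) (i.e., Σ_{d|M} X_d = 1 and all cusp orders are ≥ 0). Define Z : {0,1,…,n} → ℤ by Z_j := Σ_{e|N'} X_{p^j·e}. Then there exists j₀ ∈ {0,1,…,n} such that Z_{j₀} = 1 and Z_j = 0 for all j ≠ j₀; that is, the image of η^X under Φ_{M,pⁿ,𝟙_{N'}} equals η_{p^{j₀}}. -/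
open Finset

theorem Nat.Coprime.sum_divisors_mul_eq {R : Type*} [AddCommMonoid R] {a b : ℕ}
    (hab : a.Coprime b) (f : ℕ → R) :
    ∑ d ∈ (a * b).divisors, f d = ∑ x ∈ a.divisors, ∑ y ∈ b.divisors, f (x * y) := by
  rw [Nat.divisors_mul, Finset.mul_def, Finset.sum_image hab.mul_injOn_divisors,
    Finset.sum_product]

theorem Nat.Coprime.gcd_mul_mul_of_dvd {a b x y s t : ℕ} (hab : a.Coprime b)
    (hx : x ∣ a) (hs : s ∣ a) (hy : y ∣ b) (ht : t ∣ b) :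
    Nat.gcd (x * y) (s * t) = Nat.gcd x s * Nat.gcd y t := by
  rw [((hab.coprime_dvd_left hs).coprime_dvd_right ht).gcd_mul,
    ((hab.coprime_dvd_left hs).coprime_dvd_right hy).symm.gcd_mul_right_cancel,
    ((hab.coprime_dvd_left hx).coprime_dvd_right ht).gcd_mul_left_cancel]

theorem Nat.gcd_pow_pow_eq_pow_min (q a b : ℕ) : Nat.gcd (q ^ a) (q ^ b) = q ^ min a b := by
  rcases le_total a b with h | h
  · rw [min_eq_left h, Nat.gcd_eq_left (pow_dvd_pow q h)]
  · rw [min_eq_right h, Nat.gcd_eq_right (pow_dvd_pow q h)]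

/-- Nonnegative weights on exponents, balancing the kernel `q ^ (2 * min a b)` to `q ^ a`. -/
theorem exists_weights_range (q : ℚ) (hq : 1 < q) (m : ℕ) :
    ∃ c : ℕ → ℚ, (∀ b, 0 ≤ c b) ∧ 1 / (q ^ m * (q + 1)) ≤ c m ∧
      ∀ a ≤ m, ∑ b ∈ range (m + 1), c b * (q ^ min a b) ^ 2 = q ^ a := by
  have hq0 : 0 < q := by linarith
  induction m with
  | zero =>
    refine ⟨fun _ => 1, fun _ => zero_le_one, ?_, ?_⟩
    · rw [div_le_one (by positivity)]
      simp [hq0.le]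
    · intro a ha
      obtain rfl : a = 0 := by omega
      simp
  | succ m ih =>
    obtain ⟨c, hc0, hcm, hc⟩ := ih
    set x : ℚ := 1 / (q ^ m * (q + 1)) with hx
    have hx0 : 0 ≤ x := by positivity
    have hsum (a : ℕ) : ∑ b ∈ range (m + 1 + 1),
        (if b = m + 1 then x else if b = m then c m - x else c b) * (q ^ min a b) ^ 2 =
        ∑ b ∈ range (m + 1), c b * (q ^ min a b) ^ 2 +
          x * ((q ^ min a (m + 1)) ^ 2 - (q ^ min a m) ^ 2) := by
      rw [sum_range_succ, sum_range_succ, sum_range_succ _ m]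
      have : ∑ b ∈ range m,
          (if b = m + 1 then x else if b = m then c m - x else c b) * (q ^ min a b) ^ 2 =
          ∑ b ∈ range m, c b * (q ^ min a b) ^ 2 := by
        refine sum_congr rfl fun b hb => ?_
        rw [mem_range] at hb
        rw [if_neg (by omega), if_neg (by omega)]
      rw [this]
      simp
      ring
    refine ⟨fun b => if b = m + 1 then x else if b = m then c m - x else c b, ?_, ?_, ?_⟩
    · intro b
      dsimp only
      split_ifs
      · exact hx0
      · linarith
      · exact hc0 b
    · simp only [if_true, hx]
      gcongr
      · exact hq.le
      · omega
    · intro a ha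
      rw [hsum]
      rcases Nat.lt_or_ge m a with h | h
      · obtain rfl : a = m + 1 := by omega
        have h1 : ∑ b ∈ range (m + 1), c b * (q ^ min (m + 1) b) ^ 2 = q ^ m := by
          rw [← hc m le_rfl]
          refine sum_congr rfl fun b hb => ?_
          rw [mem_range] at hb
          rw [min_eq_right (by omega), min_eq_right (by omega)]
        rw [h1, min_self, min_eq_right (by omega), hx]
        field_simp
        ring
      · rw [hc a h, min_eq_left h, min_eq_left (by omega)]
        ring

/-- Nonnegative weights on the divisors of `N`, balancing the kernel `gcd(e, s)²` to `e`. -/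
theorem exists_weights_divisors (N : ℕ) :
    0 < N → ∃ c : ℕ → ℚ, (∀ s, 0 ≤ c s) ∧
      ∀ e ∈ N.divisors, ∑ s ∈ N.divisors, c s * (Nat.gcd e s : ℚ) ^ 2 = e := by
  induction N using Nat.recOnPrimeCoprime with
  | zero => simp
  | prime_pow q m hq =>
    intro _
    obtain ⟨c, hc0, -, hc⟩ := exists_weights_range q (by exact_mod_cast hq.one_lt) m
    refine ⟨fun s => c (s.factorization q), fun s => hc0 _, ?_⟩
    intro e he
    obtain ⟨a, ha, rfl⟩ := (Nat.mem_divisors_prime_pow hq m).1 he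
    rw [Nat.sum_divisors_prime_pow hq]
    simp only [Nat.gcd_pow_pow_eq_pow_min, hq.factorization_pow, Finsupp.single_eq_same]
    exact_mod_cast hc a ha
  | coprime a b ha hb hab iha ihb =>
    intro _
    obtain ⟨c, hc0, hc⟩ := iha (by omega)
    obtain ⟨d, hd0, hd⟩ := ihb (by omega)
    refine ⟨fun s => c (s.gcd a) * d (s.gcd b), fun s => mul_nonneg (hc0 _) (hd0 _), ?_⟩
    intro e he
    rw [Nat.divisors_mul, Finset.mem_mul] at he
    obtain ⟨x, hx, y, hy, rfl⟩ := he
    rw [hab.sum_divisors_mul_eq, Nat.cast_mul, ← hc x hx, ← hd y hy, sum_mul_sum]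
    refine sum_congr rfl fun s hs => sum_congr rfl fun t ht => ?_
    dsimp only
    have hs' := Nat.dvd_of_mem_divisors hs
    have ht' := Nat.dvd_of_mem_divisors ht
    rw [hab.gcd_mul_mul_of_dvd (Nat.dvd_of_mem_divisors hx) hs' (Nat.dvd_of_mem_divisors hy) ht',
      (hab.coprime_dvd_right ht').symm.gcd_mul_right_cancel,
      (hab.coprime_dvd_left hs').gcd_mul_left_cancel,
      Nat.gcd_eq_left hs', Nat.gcd_eq_left ht']
    push_cast
    ring

theorem IsHolEta.sum_gcd_nonneg {N : ℕ} {X : ℕ → ℤ} (h : IsHolEta N X) {t : ℕ}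
    (ht : t ∈ N.divisors) :
    0 ≤ ∑ d ∈ N.divisors, ((Nat.gcd d t : ℚ) ^ 2 / d) * X d := by
  have hN : 0 < N := Nat.pos_of_ne_zero (Nat.mem_divisors.1 ht).2
  have hg : 0 < Nat.gcd (t ^ 2) N := Nat.gcd_pos_of_pos_right _ hN
  have key : etaOrd N X t =
      ((N : ℚ) / (Nat.gcd (t ^ 2) N : ℚ)) *
        ∑ d ∈ N.divisors, ((Nat.gcd d t : ℚ) ^ 2 / d) * X d := by
    rw [etaOrd, mul_sum]
    refine sum_congr rfl fun d hd => ?_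
    have : (d : ℚ) ≠ 0 := by exact_mod_cast (Nat.pos_of_mem_divisors hd).ne'
    field_simp
  have h0 := h t ht
  rw [key] at h0
  exact nonneg_of_mul_nonneg_right h0 (by positivity)

/-- The image of a holomorphic eta quotient under summation over the prime-to-`p` part is
holomorphic on `Γ₀(pⁿ)`. -/
theorem IsHolEta.sum_prime_part_nonneg {p n N' : ℕ} {X : ℕ → ℤ} (hp : p.Prime)
    (hN' : 0 < N') (hpN' : ¬ p ∣ N') (h : IsHolEta (p ^ n * N') X) {i : ℕ} (hi : i ≤ n) :
    0 ≤ ∑ j ∈ range (n + 1),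
      (((p : ℚ) ^ min j i) ^ 2 / (p : ℚ) ^ j) * ((∑ e ∈ N'.divisors, X (p ^ j * e) : ℤ) : ℚ) := by
  obtain ⟨c, hc0, hc⟩ := exists_weights_divisors N' hN'
  have hcop : (p ^ n).Coprime N' := Nat.Coprime.pow_left n ((hp.coprime_iff_not_dvd).2 hpN')
  have hnn : 0 ≤ ∑ s ∈ N'.divisors, c s * ∑ d ∈ (p ^ n * N').divisors,
      ((Nat.gcd d (p ^ i * s) : ℚ) ^ 2 / d) * X d := by
    refine sum_nonneg fun s hs => mul_nonneg (hc0 s) (h.sum_gcd_nonneg ?_)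
    rw [Nat.mem_divisors]
    exact ⟨mul_dvd_mul (pow_dvd_pow p hi) (Nat.dvd_of_mem_divisors hs),
      mul_ne_zero (pow_ne_zero _ hp.ne_zero) hN'.ne'⟩
  refine hnn.trans_eq ?_
  calc _ = ∑ s ∈ N'.divisors, ∑ j ∈ range (n + 1), ∑ e ∈ N'.divisors,
        (((p : ℚ) ^ min j i) ^ 2 / (p : ℚ) ^ j) * (X (p ^ j * e) / e) *
          (c s * (Nat.gcd e s : ℚ) ^ 2) := by
        refine sum_congr rfl fun s hs => ?_
        rw [hcop.sum_divisors_mul_eq, Nat.sum_divisors_prime_pow hp, mul_sum]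
        refine sum_congr rfl fun j hj => ?_
        rw [mul_sum]
        refine sum_congr rfl fun e he => ?_
        rw [mem_range] at hj
        rw [hcop.gcd_mul_mul_of_dvd (pow_dvd_pow p (by omega)) (pow_dvd_pow p hi)
          (Nat.dvd_of_mem_divisors he) (Nat.dvd_of_mem_divisors hs),
          Nat.gcd_pow_pow_eq_pow_min]
        push_cast
        have : (e : ℚ) ≠ 0 := by exact_mod_cast (Nat.pos_of_mem_divisors he).ne'
        have : (p : ℚ) ≠ 0 := by exact_mod_cast hp.ne_zero
        field_simp
    _ = _ := by
        rw [sum_comm]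
        refine sum_congr rfl fun j _ => ?_
        rw [sum_comm, Int.cast_sum, mul_sum]
        refine sum_congr rfl fun e he => ?_
        rw [← mul_sum, hc e he]
        have : (e : ℚ) ≠ 0 := by exact_mod_cast (Nat.pos_of_mem_divisors he).ne'
        field_simp

/-- The kernel `p ^ (-|m|)` inverts a tridiagonal Toeplitz matrix. -/
theorem inv_pow_natAbs_second_difference (p : ℚ) (hp : p ≠ 0) (m : ℤ) :
    (p ^ 2 + 1) * p⁻¹ ^ m.natAbs - p * p⁻¹ ^ (m - 1).natAbs - p * p⁻¹ ^ (m + 1).natAbs =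
      if m = 0 then p ^ 2 - 1 else 0 := by
  rcases lt_trichotomy m 0 with h | rfl | h
  · obtain ⟨k, rfl⟩ : ∃ k : ℕ, m = -(k + 1 : ℕ) := ⟨(-m - 1).toNat, by omega⟩
    rw [if_neg h.ne, show (-((k + 1 : ℕ) : ℤ)).natAbs = k + 1 by omega,
      show (-((k + 1 : ℕ) : ℤ) - 1).natAbs = k + 2 by omega,
      show (-((k + 1 : ℕ) : ℤ) + 1).natAbs = k by omega]
    simp only [inv_pow]
    field_simp
    ring
  · simp
    field_simp
    ring
  · obtain ⟨k, rfl⟩ : ∃ k : ℕ, m = (k + 1 : ℕ) := ⟨(m - 1).toNat, by omega⟩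
    rw [if_neg h.ne', show (((k + 1 : ℕ) : ℤ)).natAbs = k + 1 by omega,
      show (((k + 1 : ℕ) : ℤ) - 1).natAbs = k by omega,
      show (((k + 1 : ℕ) : ℤ) + 1).natAbs = k + 2 by omega]
    simp only [inv_pow]
    field_simp
    ring

/-- An integer vector of total mass one whose convolution with `p ^ (-|m|)`, `p ≥ 3`, is
nonnegative has nonnegative entries. -/
theorem nonneg_of_convolution_nonneg (p : ℚ) (hp : 3 ≤ p) (n : ℕ) (Z : ℕ → ℤ)
    (hsum : ∑ j ∈ range (n + 1), Z j = 1)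
    (hu : ∀ i ≤ n, 0 ≤ ∑ j ∈ range (n + 1), p⁻¹ ^ ((i : ℤ) - j).natAbs * (Z j : ℚ)) :
    ∀ j ≤ n, 0 ≤ Z j := by
  have hp0 : 0 < p := by linarith
  set u : ℤ → ℚ := fun i => ∑ j ∈ range (n + 1), p⁻¹ ^ (i - j).natAbs * (Z j : ℚ) with hudef
  have hsumQ : ∑ j ∈ range (n + 1), (Z j : ℚ) = 1 := by exact_mod_cast hsum
  have hrec (i : ℕ) (hi : i ≤ n) :
      (p ^ 2 + 1) * u i - p * u (i - 1) - p * u (i + 1) = (p ^ 2 - 1) * Z i := by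
    simp only [hudef, mul_sum, ← sum_sub_distrib]
    rw [sum_eq_single_of_mem i (by simp; omega)]
    · have := inv_pow_natAbs_second_difference p hp0.ne' 0
      simp at this ⊢
      linear_combination (Z i : ℚ) * this
    · intro j _ hj
      have := inv_pow_natAbs_second_difference p hp0.ne' ((i : ℤ) - j)
      rw [if_neg (by omega)] at this
      rw [show (i : ℤ) - 1 - j = i - j - 1 by ring, show (i : ℤ) + 1 - j = i - j + 1 by ring]
      linear_combination (Z j : ℚ) * this
  have hleft : p * u (-1) = u 0 := by
    simp only [hudef, mul_sum]
    refine sum_congr rfl fun j _ => ?_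
    rw [show (-1 - (j : ℤ)).natAbs = j + 1 by omega, show (0 - (j : ℤ)).natAbs = j by omega]
    simp only [inv_pow]
    field_simp
    ring
  have hright : p * u (n + 1) = u n := by
    simp only [hudef, mul_sum]
    refine sum_congr rfl fun j hj => ?_
    rw [mem_range] at hj
    rw [show ((n : ℤ) + 1 - j).natAbs = ((n : ℤ) - j).natAbs + 1 by omega]
    simp only [inv_pow]
    field_simp
    ring
  have hu' (i : ℕ) (hi : i ≤ n) : 0 ≤ u i := hu i hi
  have hunn (i : ℤ) (h1 : -1 ≤ i) (h2 : i ≤ n + 1) : 0 ≤ u i := by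
    rcases eq_or_lt_of_le h1 with rfl | h1
    · have := hu' 0 (by omega)
      exact nonneg_of_mul_nonneg_right (hleft ▸ this) hp0
    rcases eq_or_lt_of_le h2 with rfl | h2
    · exact nonneg_of_mul_nonneg_right (hright ▸ hu' n le_rfl) hp0
    obtain ⟨k, rfl⟩ := Int.eq_ofNat_of_zero_le (show 0 ≤ i by omega)
    exact hu' k (by omega)
  -- total mass of the convolution
  have hmass : (p - 1) ^ 2 * ∑ i ∈ range (n + 1), u i ≤ p ^ 2 - 1 := by
    have hs : ∑ i ∈ range (n + 1), ((p ^ 2 + 1) * u i - p * u (i - 1) - p * u (i + 1)) =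
        p ^ 2 - 1 := by
      rw [sum_congr rfl fun i hi => hrec i (by rw [mem_range] at hi; omega), ← mul_sum, hsumQ,
        mul_one]
    rw [sum_sub_distrib, sum_sub_distrib, ← mul_sum, ← mul_sum, ← mul_sum] at hs
    have h1 : ∑ i ∈ range (n + 1), u ((i : ℤ) - 1) + u n =
        u (-1) + ∑ i ∈ range (n + 1), u i := by
      rw [sum_range_succ', sum_range_succ _ n]
      push_cast
      simp only [add_sub_cancel_right]
      ring
    have h2 : ∑ i ∈ range (n + 1), u ((i : ℤ) + 1) + u 0 =
        ∑ i ∈ range (n + 1), u i + u (n + 1) := by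
      rw [sum_range_succ, sum_range_succ' _ n]
      push_cast
      ring
    have h0 := hu' 0 (by omega)
    have hn := hu' n le_rfl
    push_cast at h0
    nlinarith [mul_nonneg (show 0 ≤ p - 1 by linarith) (add_nonneg h0 hn)]
  -- total positive mass is at most two
  have hpos : ∑ j ∈ range (n + 1), max (Z j) 0 ≤ 2 := by
    have h1 : (p ^ 2 - 1) * ∑ j ∈ range (n + 1), ((max (Z j) 0 : ℤ) : ℚ) ≤
        (p ^ 2 + 1) * ∑ i ∈ range (n + 1), u i := by
      rw [mul_sum, mul_sum]
      refine sum_le_sum fun j hj => ?_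
      rw [mem_range] at hj
      rcases le_total (Z j) 0 with h | h
      · rw [max_eq_right h]
        have := hu' j (by omega)
        simp only [Int.cast_zero, mul_zero]
        positivity
      · rw [max_eq_left h]
        have := hrec j (by omega)
        have ha := mul_nonneg hp0.le (hunn (j - 1) (by omega) (by omega))
        have hb := mul_nonneg hp0.le (hunn (j + 1) (by omega) (by omega))
        linarith
    by_contra! hcon
    have h3 : (3 : ℚ) ≤ ∑ j ∈ range (n + 1), ((max (Z j) 0 : ℤ) : ℚ) := by
      exact_mod_cast hcon
    have hq : 0 < p ^ 2 - 1 := by nlinarith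
    have h4 : (p ^ 2 - 1) * 3 ≤ (p ^ 2 + 1) * ∑ i ∈ range (n + 1), u i :=
      (mul_le_mul_of_nonneg_left h3 hq.le).trans h1
    have h5 : (p - 1) ^ 2 * ((p ^ 2 - 1) * 3) ≤ (p ^ 2 + 1) * (p ^ 2 - 1) :=
      calc _ ≤ (p - 1) ^ 2 * ((p ^ 2 + 1) * ∑ i ∈ range (n + 1), u i) := by gcongr
        _ = (p ^ 2 + 1) * ((p - 1) ^ 2 * ∑ i ∈ range (n + 1), u i) := by ring
        _ ≤ _ := by gcongr
    have h6 : (p - 1) ^ 2 * 3 ≤ p ^ 2 + 1 := by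
      refine le_of_mul_le_mul_right ?_ hq
      linarith
    nlinarith
  intro c hc
  by_contra! hneg
  have hcmem : c ∈ range (n + 1) := by rw [mem_range]; omega
  have hbound : u c ≤ Z c + p⁻¹ * ∑ j ∈ range (n + 1), ((max (Z j) 0 : ℤ) : ℚ) := by
    have hle : ∑ j ∈ (range (n + 1)).erase c, p⁻¹ ^ ((c : ℤ) - j).natAbs * (Z j : ℚ) ≤
        ∑ j ∈ (range (n + 1)).erase c, p⁻¹ * ((max (Z j) 0 : ℤ) : ℚ) := by
      refine sum_le_sum fun j hj => ?_
      have hjc : j ≠ c := ne_of_mem_erase hj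
      have hk : p⁻¹ ^ ((c : ℤ) - j).natAbs ≤ p⁻¹ :=
        pow_le_of_le_one (by positivity) (inv_le_one_of_one_le₀ (by linarith)) (by omega)
      have hz : (Z j : ℚ) ≤ ((max (Z j) 0 : ℤ) : ℚ) := by exact_mod_cast le_max_left _ _
      have hz0 : (0 : ℚ) ≤ ((max (Z j) 0 : ℤ) : ℚ) := by exact_mod_cast le_max_right _ _
      exact (mul_le_mul_of_nonneg_left hz (by positivity)).trans
        (mul_le_mul_of_nonneg_right hk hz0)
    rw [mul_sum, ← add_sum_erase _ _ hcmem, max_eq_right hneg.le]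
    simp only [hudef]
    rw [← add_sum_erase _ _ hcmem]
    simpa using hle
  have hposQ : ∑ j ∈ range (n + 1), ((max (Z j) 0 : ℤ) : ℚ) ≤ 2 := by exact_mod_cast hpos
  have hZc : (Z c : ℚ) ≤ -1 := by exact_mod_cast (show Z c ≤ -1 by omega)
  have hinv : p⁻¹ ≤ 3⁻¹ := by gcongr
  have hpi : 0 ≤ p⁻¹ := by positivity
  nlinarith [hu' c hc, mul_le_mul_of_nonneg_left hposQ hpi]

/-- Nonnegative integers with sum one form a unit vector. -/
theorem Finset.exists_eq_one_of_sum_eq_one {ι : Type*} (s : Finset ι) (f : ι → ℤ)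
    (h0 : ∀ i ∈ s, 0 ≤ f i) (h1 : ∑ i ∈ s, f i = 1) :
    ∃ i ∈ s, f i = 1 ∧ ∀ j ∈ s, j ≠ i → f j = 0 := by
  classical
  obtain ⟨i, hi, hfi⟩ : ∃ i ∈ s, f i ≠ 0 := by
    by_contra! h
    rw [sum_eq_zero h] at h1
    exact zero_ne_one h1
  have hpos : 0 < f i := lt_of_le_of_ne (h0 i hi) hfi.symm
  have hrest : ∀ j ∈ s.erase i, 0 ≤ f j := fun j hj => h0 j (mem_of_mem_erase hj)
  have hsplit := add_sum_erase s f hi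
  have hr := sum_nonneg hrest
  refine ⟨i, hi, by omega, fun j hj hji => ?_⟩
  exact (sum_eq_zero_iff_of_nonneg hrest).1 (by omega) j (mem_erase.2 ⟨hji, hj⟩)

/-- Let `p ≥ 3` be a prime, `M = pⁿ·N'` with `p ∤ N'`, and let `η^X` be a holomorphic
eta quotient of weight `1/2` on `Γ₀(M)`.  Then the exponent vector
`Z_j = ∑_{e ∣ N'} X_{pʲ·e}` of `Φ_{M,pⁿ,𝟙_{N'}}(η^X)` equals that of `η_{p^{j₀}}`
for some `0 ≤ j₀ ≤ n`. -/
theorem phi_image_of_weight_half (p : ℕ) (hp : p.Prime) (hp3 : 3 ≤ p)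
    (n N' : ℕ) (hN' : 0 < N') (hpN' : ¬ p ∣ N') (X : ℕ → ℤ)
    (hsupp : SuppIn (p ^ n * N') X)
    (hwt : ∑ d ∈ (p ^ n * N').divisors, X d = 1)
    (hhol : IsHolEta (p ^ n * N') X) :
    ∃ j₀ ≤ n, (∑ e ∈ N'.divisors, X (p ^ j₀ * e)) = 1 ∧
      ∀ j ≤ n, j ≠ j₀ → (∑ e ∈ N'.divisors, X (p ^ j * e)) = 0 := by
  have hcop : (p ^ n).Coprime N' := Nat.Coprime.pow_left n ((hp.coprime_iff_not_dvd).2 hpN')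
  have hp0 : (p : ℚ) ≠ 0 := by exact_mod_cast hp.ne_zero
  set Z : ℕ → ℤ := fun j => ∑ e ∈ N'.divisors, X (p ^ j * e)
  have hsum : ∑ j ∈ range (n + 1), Z j = 1 := by
    rw [← hwt, hcop.sum_divisors_mul_eq, Nat.sum_divisors_prime_pow hp]
  have hnonneg : ∀ j ≤ n, 0 ≤ Z j := by
    refine nonneg_of_convolution_nonneg p (by exact_mod_cast hp3) n Z hsum fun i hi => ?_
    have h := mul_nonneg (show (0 : ℚ) ≤ (p : ℚ)⁻¹ ^ i by positivity)
      (hhol.sum_prime_part_nonneg hp hN' hpN' hi)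
    refine h.trans_eq ?_
    rw [mul_sum]
    refine sum_congr rfl fun j _ => ?_
    rw [← mul_assoc]
    congr 1
    rcases le_total i j with hij | hij
    · obtain ⟨k, rfl⟩ := Nat.exists_eq_add_of_le hij
      rw [min_eq_right hij, show ((i : ℤ) - (i + k : ℕ)).natAbs = k by omega]
      simp only [inv_pow, pow_add]
      field_simp
    · obtain ⟨k, rfl⟩ := Nat.exists_eq_add_of_le hij
      rw [min_eq_left hij, show (((j + k : ℕ) : ℤ) - j).natAbs = k by omega]
      simp only [inv_pow, pow_add]
      field_simp
  obtain ⟨j₀, hj₀, h1, h0⟩ := exists_eq_one_of_sum_eq_one (range (n + 1)) Z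
    (fun j hj => hnonneg j (by rw [mem_range] at hj; omega)) hsum
  rw [mem_range] at hj₀
  exact ⟨j₀, by omega, h1, fun j hj hne => h0 j (by rw [mem_range]; omega) hne⟩
end

section
/- Let M ∈ ℕ, let p be a prime divisor of M, and write M = pⁿ·N' with p ∤ N'. Fix j ∈ {0,1,…,n} and m ∈ {1,…,p−1}, and define â : D_{pⁿ} → ℤ by â(p^i) = m if i = j and â(p^i) = 1 otherwise. For X : D_M → ℤ define Y : D_{N'} → ℤ by Y_e := Σ_{i=0}^{n} â(p^i)·X_{p^i·e}. If η^X is holomorphic on Γ₀(M), then η^Y is holomorphic on Γ₀(N'); moreover, if η^X is holomorphic and nonconstant (i.e., X ≠ 0), then Y ≠ 0. -/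
open Finset

/-- There is a positive function (Jordan's totient `J₂`) whose divisor sums are the squares. -/
lemma exists_pos_sum_divisors_eq_sq :
    ∃ J : ℕ → ℚ, (∀ e, 0 < e → 0 < J e) ∧ ∀ n : ℕ, ∑ e ∈ n.divisors, J e = (n : ℚ) ^ 2 := by
  let F : ArithmeticFunction ℕ := ⟨fun n => n * n.totient, by simp⟩
  let G : ArithmeticFunction ℕ := ⟨fun n => n.totient, by simp⟩
  have hG : G * ArithmeticFunction.zeta = ArithmeticFunction.id := by
    ext n
    have h := ArithmeticFunction.coe_mul_zeta_apply (f := G) (x := n)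
    simp only [ArithmeticFunction.natCoe_nat] at h
    rw [h]
    exact Nat.sum_totient n
  have hF : ∀ n, (F * ArithmeticFunction.id) n = n ^ 2 := by
    intro n
    rw [ArithmeticFunction.mul_apply]
    calc ∑ x ∈ n.divisorsAntidiagonal, F x.1 * ArithmeticFunction.id x.2
        = ∑ x ∈ n.divisorsAntidiagonal, n * x.1.totient := by
          refine Finset.sum_congr rfl fun x hx => ?_
          rw [← (Nat.mem_divisorsAntidiagonal.mp hx).1]
          change x.1 * x.1.totient * x.2 = _
          ring
      _ = n ^ 2 := by
          rw [← Finset.mul_sum, Nat.sum_divisorsAntidiagonal fun i _ => Nat.totient i,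
            Nat.sum_totient, sq]
  refine ⟨fun e => ((F * G) e : ℕ), fun e he => ?_, fun n => ?_⟩
  · have : 0 < (F * G) e := by
      rw [ArithmeticFunction.mul_apply]
      refine Finset.sum_pos (fun x hx => ?_) ⟨(1, e), by simp [he.ne']⟩
      obtain ⟨hxe, -⟩ := Nat.mem_divisorsAntidiagonal.mp hx
      rw [← hxe] at he
      have h1 := Nat.pos_of_mul_pos_right he
      have h2 := Nat.pos_of_mul_pos_left he
      exact Nat.mul_pos (Nat.mul_pos (by omega) (Nat.totient_pos.mpr (by omega)))
        (Nat.totient_pos.mpr (by omega))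
    beta_reduce
    exact_mod_cast this
  · have h := ArithmeticFunction.coe_mul_zeta_apply (f := F * G) (x := n)
    simp only [ArithmeticFunction.natCoe_nat] at h
    rw [mul_assoc, hG, hF] at h
    beta_reduce
    exact_mod_cast h.symm

/-- The matrix `gcd(d,t)²` indexed by the divisors of `N` is nonsingular. -/
lemma eq_zero_of_sum_gcd_sq_mul_eq_zero (N : ℕ) (z : ℕ → ℚ)
    (h : ∀ t ∈ N.divisors, ∑ d ∈ N.divisors, (Nat.gcd d t : ℚ) ^ 2 * z d = 0) :
    ∀ d ∈ N.divisors, z d = 0 := by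
  obtain ⟨J, hJpos, hJ⟩ := exists_pos_sum_divisors_eq_sq
  let W : ℕ → ℚ := fun e => ∑ d ∈ N.divisors with e ∣ d, z d
  have hsum : ∀ t ∈ N.divisors, ∑ e ∈ t.divisors, J e * W e = 0 := by
    intro t ht
    rw [← h t ht]
    have ht0 : t ≠ 0 := (Nat.pos_of_mem_divisors ht).ne'
    have hgcd : ∀ d, (Nat.gcd d t : ℚ) ^ 2 = ∑ e ∈ t.divisors, if e ∣ d then J e else 0 := by
      intro d
      rw [← hJ, ← Finset.sum_filter]
      refine Finset.sum_congr ?_ fun _ _ => rfl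
      ext e
      simp [Nat.dvd_gcd_iff, ht0, and_comm]
    simp only [hgcd, W, Finset.sum_mul, Finset.mul_sum, Finset.sum_filter]
    rw [Finset.sum_comm]
    refine Finset.sum_congr rfl fun d _ => Finset.sum_congr rfl fun e _ => ?_
    split_ifs <;> simp
  have hW : ∀ t, t ∈ N.divisors → W t = 0 := by
    intro t
    induction t using Nat.strong_induction_on with
    | _ t ih =>
      intro ht
      have htpos := Nat.pos_of_mem_divisors ht
      have h0 := hsum t ht
      rw [Finset.sum_eq_single t] at h0
      · exact (mul_eq_zero.mp h0).resolve_left (hJpos t htpos).ne'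
      · intro e he hne
        have hdvd := Nat.dvd_of_mem_divisors he
        rw [ih e (lt_of_le_of_ne (Nat.le_of_dvd htpos hdvd) hne)
          (Nat.mem_divisors.mpr ⟨hdvd.trans (Nat.dvd_of_mem_divisors ht),
            (Nat.mem_divisors.mp ht).2⟩), mul_zero]
      · simp [htpos.ne']
  suffices ∀ k d, N - d = k → d ∈ N.divisors → z d = 0 from fun d => this _ d rfl
  intro k
  induction k using Nat.strong_induction_on with
  | _ k ih =>
    intro d hk hd
    have h0 := hW d hd
    simp only [W] at h0
    rwa [Finset.sum_eq_single d] at h0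
    · intro e he hne
      obtain ⟨heN, hde⟩ := Finset.mem_filter.mp he
      have h1 := Nat.le_of_dvd (Nat.pos_of_mem_divisors heN) hde
      have h2 := Nat.divisor_le heN
      exact ih (N - e) (by omega) e rfl heN
    · simp [hd]

lemma eq_zero_of_etaOrd_eq_zero (N : ℕ) (X : ℕ → ℤ)
    (h : ∀ t ∈ N.divisors, etaOrd N X t = 0) : ∀ d ∈ N.divisors, X d = 0 := by
  intro d hd
  have hN : (N : ℚ) ≠ 0 := by exact_mod_cast (Nat.mem_divisors.mp hd).2
  have hz := eq_zero_of_sum_gcd_sq_mul_eq_zero N (fun d => X d / d) (fun t ht => by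
    have hg : (Nat.gcd (t ^ 2) N : ℚ) ≠ 0 := by
      exact_mod_cast Nat.gcd_ne_zero_right (Nat.mem_divisors.mp hd).2
    have h0 : (N : ℚ) / (Nat.gcd (t ^ 2) N : ℚ) *
        ∑ d ∈ N.divisors, (Nat.gcd d t : ℚ) ^ 2 * (X d / d) = 0 := by
      rw [← h t ht, etaOrd, Finset.mul_sum]
      refine Finset.sum_congr rfl fun d _ => ?_
      rw [mul_comm (d : ℚ), mul_div_mul_comm]
      ring
    exact (mul_eq_zero.mp h0).resolve_left (div_ne_zero hN hg)) d hd
  have hd0 : (d : ℚ) ≠ 0 := by exact_mod_cast (Nat.pos_of_mem_divisors hd).ne'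
  exact_mod_cast (div_eq_zero_iff.mp hz).resolve_right hd0

/-- The tridiagonal inverse of the matrix `q^|i-s|`, applied to the vector `b₁, …, b_{n+1}`
extended by `b₀ = q b₁` and `b_{n+2} = q b_{n+1}`. -/
lemma sum_tridiagonal_mul_pow_dist (q : ℚ) (b : ℕ → ℚ) (n : ℕ) (h0 : b 0 = q * b 1)
    (hn : b (n + 2) = q * b (n + 1)) (i : ℕ) (hi : i ≤ n) :
    ∑ s ∈ Finset.range (n + 1),
      ((1 + q ^ 2) * b (s + 1) - q * (b s + b (s + 2))) * q ^ (i - s + (s - i)) =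
      (1 - q ^ 2) * b (i + 1) := by
  have hlow : ∀ i, ∑ s ∈ Finset.range i,
      ((1 + q ^ 2) * b (s + 1) - q * (b s + b (s + 2))) * q ^ (i - s) =
      q * (b i - q * b (i + 1)) := by
    intro i
    induction i with
    | zero => simp [h0]
    | succ k ih =>
      rw [Finset.sum_range_succ]
      have : ∀ s ∈ Finset.range k,
          ((1 + q ^ 2) * b (s + 1) - q * (b s + b (s + 2))) * q ^ (k + 1 - s) =
          ((1 + q ^ 2) * b (s + 1) - q * (b s + b (s + 2))) * q ^ (k - s) * q := by
        intro s hs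
        rw [Nat.sub_add_comm (Finset.mem_range.mp hs).le, pow_succ q (k - s), mul_assoc]
      rw [Finset.sum_congr rfl this, ← Finset.sum_mul, ih, Nat.add_sub_cancel_left]
      ring
  have hhigh : ∀ k, ∑ s ∈ Finset.range k,
      ((1 + q ^ 2) * b (i + s + 1) - q * (b (i + s) + b (i + s + 2))) * q ^ s =
      (b (i + 1) - q * b i) - q ^ k * (b (i + k + 1) - q * b (i + k)) := by
    intro k
    induction k with
    | zero => simp
    | succ k ih =>
      rw [Finset.sum_range_succ, ih]
      simp only [← add_assoc]
      ring
  obtain ⟨k, rfl⟩ := Nat.exists_eq_add_of_le hi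
  rw [add_assoc i k 1, Finset.sum_range_add]
  have hlow' : ∑ s ∈ Finset.range i,
      ((1 + q ^ 2) * b (s + 1) - q * (b s + b (s + 2))) * q ^ (i - s + (s - i)) =
      q * (b i - q * b (i + 1)) := by
    rw [← hlow i]
    refine Finset.sum_congr rfl fun s hs => ?_
    rw [Nat.sub_eq_zero_of_le (Finset.mem_range.mp hs).le, add_zero]
  have hhigh' := hhigh (k + 1)
  rw [← add_assoc, hn] at hhigh'
  simp only [show ∀ s, i - (i + s) + (i + s - i) = s by intro s; omega]
  rw [hlow', hhigh']
  ring

/-- A vector with entries `1` except for one entry `m < p` is a positive combination of the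
rows of the matrix `p^(-|i-s|)`. -/
lemma exists_pos_combination_pow_dist (p m n j : ℕ) (hm1 : 1 ≤ m) (hmp : m + 1 ≤ p) :
    ∃ c : ℕ → ℚ, (∀ s ≤ n, 0 < c s) ∧ ∀ i ≤ n,
      ∑ s ∈ Finset.range (n + 1), c s * ((p : ℚ)⁻¹) ^ (i - s + (s - i)) =
        if i = j then (m : ℚ) else 1 := by
  have hmQ : (1 : ℚ) ≤ m := by exact_mod_cast hm1
  have hpQ : (m : ℚ) + 1 ≤ p := by exact_mod_cast hmp
  have hp0 : (0 : ℚ) < p := by linarith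
  obtain ⟨q, hq⟩ : ∃ q : ℚ, q = (p : ℚ)⁻¹ := ⟨_, rfl⟩
  have hq0 : 0 < q := by rw [hq]; positivity
  have hqp : q * p = 1 := by rw [hq]; exact inv_mul_cancel₀ hp0.ne'
  have hq1 : q < 1 := by nlinarith
  have hqm : q * m ≤ 1 := by nlinarith
  let a : ℕ → ℚ := fun i => if i = j then (m : ℚ) else 1
  have ha1 : ∀ i, 1 ≤ a i := by intro i; simp only [a]; split_ifs <;> linarith
  have ham : ∀ i, a i ≤ m := by intro i; simp only [a]; split_ifs <;> linarith
  have hqa : ∀ i, q * a i ≤ 1 := fun i => by nlinarith [ham i]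
  let b : ℕ → ℚ := fun k =>
    if k = 0 then q * a 0 else if k = n + 2 then q * a n else a (k - 1)
  have hbm : ∀ k, b k ≤ m := by
    intro k
    simp only [b]
    split_ifs
    · linarith [hqa 0]
    · linarith [hqa n]
    · exact ham _
  have hb1 : ∀ k, k ≠ j + 1 → b k ≤ 1 := by
    intro k hk
    simp only [b]
    split_ifs with h1 h2
    · exact hqa 0
    · exact hqa n
    · simp only [a]
      rw [if_neg (by omega)]
  have hb : ∀ s ≤ n, b (s + 1) = a s := by
    intro s hs
    simp only [b]
    rw [if_neg (by omega), if_neg (by omega), Nat.add_sub_cancel]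
  have hfac : 0 < 1 - q ^ 2 := by nlinarith
  refine ⟨fun s => ((1 + q ^ 2) * b (s + 1) - q * (b s + b (s + 2))) / (1 - q ^ 2),
    fun s hs => div_pos ?_ hfac, fun i hi => ?_⟩
  · rw [hb s hs]
    by_cases hsj : s = j
    · have h1 := hb1 s (by omega)
      have h2 := hb1 (s + 2) (by omega)
      nlinarith [ha1 s, sq_pos_of_pos (sub_pos.mpr hq1), sq_nonneg q]
    · have h12 : b s + b (s + 2) ≤ p := by
        by_cases h : s = j + 1
        · linarith [hbm s, hb1 (s + 2) (by omega)]
        · linarith [hb1 s h, hbm (s + 2)]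
      nlinarith [ha1 s, sq_pos_of_pos hq0, mul_le_mul_of_nonneg_left h12 hq0.le]
  · have h := sum_tridiagonal_mul_pow_dist q b n (by simp [b]) (by simp [b]) i hi
    rw [← hq]
    simp only [div_mul_eq_mul_div]
    rw [← Finset.sum_div, h, hb i hi, mul_div_cancel_left₀ _ hfac.ne']

lemma gcd_prime_pow_mul {p : ℕ} (i s : ℕ) {e t : ℕ} (he : p.Coprime e) (ht : p.Coprime t) :
    Nat.gcd (p ^ i * e) (p ^ s * t) = p ^ min i s * Nat.gcd e t := by
  rcases le_total i s with h | h
  · obtain ⟨k, rfl⟩ := Nat.exists_eq_add_of_le h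
    rw [min_eq_left h, pow_add, mul_assoc, Nat.gcd_mul_left,
      (he.pow_left k).gcd_mul_left_cancel_right]
  · obtain ⟨k, rfl⟩ := Nat.exists_eq_add_of_le h
    rw [min_eq_right h, pow_add, mul_assoc, Nat.gcd_mul_left,
      (ht.pow_left k).gcd_mul_left_cancel]

lemma pow_min_sq_div_pow {p : ℚ} (hp : p ≠ 0) (i s : ℕ) :
    (p ^ min i s) ^ 2 / p ^ i = p ^ s * p⁻¹ ^ (i - s + (s - i)) := by
  rcases le_total i s with h | h
  · obtain ⟨k, rfl⟩ := Nat.exists_eq_add_of_le h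
    rw [min_eq_left h, Nat.sub_eq_zero_of_le h, zero_add, Nat.add_sub_cancel_left, inv_pow]
    field_simp
    ring
  · obtain ⟨k, rfl⟩ := Nat.exists_eq_add_of_le h
    rw [min_eq_right h, Nat.sub_eq_zero_of_le h, add_zero, Nat.add_sub_cancel_left, inv_pow]
    field_simp
    ring

/-- The order matrix of level `pⁿ·N` is the Kronecker product of those of levels `pⁿ`
and `N`; the former is, up to positive row factors, the matrix `p^(-|i-s|)`. -/
lemma etaOrd_prime_pow_mul {p : ℕ} (hp : p.Prime) {n N : ℕ} (hN : p.Coprime N)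
    (X : ℕ → ℤ) (s : ℕ) {t : ℕ} (ht : t ∣ N) :
    etaOrd (p ^ n * N) X (p ^ s * t) =
      (p : ℚ) ^ n * (p : ℚ) ^ s / (p : ℚ) ^ min (2 * s) n *
        ∑ i ∈ Finset.range (n + 1), ((p : ℚ)⁻¹) ^ (i - s + (s - i)) *
          etaOrd N (fun e => X (p ^ i * e)) t := by
  have hp0 : (p : ℚ) ≠ 0 := by exact_mod_cast hp.ne_zero
  have hpt : p.Coprime t := hN.coprime_dvd_right ht
  have hden : Nat.gcd ((p ^ s * t) ^ 2) (p ^ n * N) =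
      p ^ min (2 * s) n * Nat.gcd (t ^ 2) N := by
    rw [mul_pow, ← pow_mul, mul_comm s 2, gcd_prime_pow_mul _ _ (hpt.pow_right 2) hN]
  rw [etaOrd, hden, Nat.divisors_mul, Finset.mul_def,
    Finset.sum_image (hN.pow_left n).mul_injOn_divisors, Finset.sum_product,
    Nat.sum_divisors_prime_pow hp, Finset.mul_sum]
  refine Finset.sum_congr rfl fun i _ => ?_
  rw [etaOrd, Finset.mul_sum, Finset.mul_sum]
  refine Finset.sum_congr rfl fun e he => ?_
  have hpe : p.Coprime e := hN.coprime_dvd_right (Nat.dvd_of_mem_divisors he)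
  rw [gcd_prime_pow_mul _ _ hpe hpt]
  push_cast
  calc _ = (p : ℚ) ^ n * (((p : ℚ) ^ min i s) ^ 2 / (p : ℚ) ^ i) / (p : ℚ) ^ min (2 * s) n *
        ((N : ℚ) * (Nat.gcd e t : ℚ) ^ 2 / ((e : ℚ) * (Nat.gcd (t ^ 2) N : ℚ)) *
          (X (p ^ i * e) : ℚ)) := by
        simp only [div_eq_mul_inv, mul_inv]
        ring
    _ = _ := by
        rw [pow_min_sq_div_pow hp0]
        ring

lemma etaOrd_sum_mul (N : ℕ) {ι : Type*} (S : Finset ι) (a : ι → ℤ) (Z : ι → ℕ → ℤ) (t : ℕ) :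
    etaOrd N (fun e => ∑ i ∈ S, a i * Z i e) t = ∑ i ∈ S, (a i : ℚ) * etaOrd N (Z i) t := by
  simp only [etaOrd, Finset.mul_sum, Int.cast_sum, Int.cast_mul]
  rw [Finset.sum_comm]
  refine Finset.sum_congr rfl fun i _ => Finset.sum_congr rfl fun d _ => ?_
  ring

/-- The orders of `η^Y` at the cusps of `Γ₀(N)` are positive combinations of those of `η^X`
at the cusps of `Γ₀(pⁿ·N)`. -/
lemma exists_pos_etaOrd_eq_sum {p : ℕ} (hp : p.Prime) {n N : ℕ} (hN : p.Coprime N)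
    (j m : ℕ) (hm1 : 1 ≤ m) (hmp : m + 1 ≤ p) (X : ℕ → ℤ) :
    ∃ c : ℕ → ℚ, (∀ s ≤ n, 0 < c s) ∧ ∀ t, t ∣ N →
      etaOrd N (fun e => ∑ i ∈ Finset.range (n + 1),
        (if i = j then (m : ℤ) else 1) * X (p ^ i * e)) t =
      ∑ s ∈ Finset.range (n + 1), c s * etaOrd (p ^ n * N) X (p ^ s * t) := by
  obtain ⟨c, hc, hcomb⟩ := exists_pos_combination_pow_dist p m n j hm1 hmp
  have hp0 : (0 : ℚ) < p := by exact_mod_cast hp.pos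
  have hr : ∀ s, 0 < (p : ℚ) ^ n * (p : ℚ) ^ s / (p : ℚ) ^ min (2 * s) n :=
    fun s => by positivity
  refine ⟨fun s => c s / ((p : ℚ) ^ n * (p : ℚ) ^ s / (p : ℚ) ^ min (2 * s) n),
    fun s hs => div_pos (hc s hs) (hr s), fun t ht => ?_⟩
  rw [etaOrd_sum_mul]
  have hterm : ∀ s ∈ Finset.range (n + 1),
      c s / ((p : ℚ) ^ n * (p : ℚ) ^ s / (p : ℚ) ^ min (2 * s) n) *
        etaOrd (p ^ n * N) X (p ^ s * t) =
      ∑ i ∈ Finset.range (n + 1), c s * (p : ℚ)⁻¹ ^ (i - s + (s - i)) *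
        etaOrd N (fun e => X (p ^ i * e)) t := by
    intro s _
    rw [etaOrd_prime_pow_mul hp hN X s ht, ← mul_assoc, div_mul_cancel₀ _ (hr s).ne',
      Finset.mul_sum]
    exact Finset.sum_congr rfl fun i _ => (mul_assoc _ _ _).symm
  rw [Finset.sum_congr rfl hterm, Finset.sum_comm]
  refine Finset.sum_congr rfl fun i hi => ?_
  rw [← Finset.sum_mul, hcomb i (Nat.lt_succ_iff.mp (Finset.mem_range.mp hi))]
  push_cast
  rfl

/-- Let `M = pⁿ·N'` with `p` a prime divisor of `M` and `p ∤ N'`.  For `0 ≤ j ≤ n`,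
`1 ≤ m ≤ p−1` and `â(pⁱ) = m` if `i = j`, `1` otherwise, the map
`Φ_{M,N',â} : η^X ↦ η^Y` with `Y_e = ∑_{i≤n} â(pⁱ)·X_{pⁱ·e}` preserves holomorphy,
and maps no nonconstant holomorphic eta quotient to `1`. -/
theorem phi_hat_a_preserves_holomorphy (p : ℕ) (hp : p.Prime)
    (n N' : ℕ) (hn : 0 < n) (hN' : 0 < N') (hpN' : ¬ p ∣ N')
    (j : ℕ) (hj : j ≤ n) (m : ℕ) (hm1 : 1 ≤ m) (hmp : m ≤ p - 1)
    (X : ℕ → ℤ) (hsupp : SuppIn (p ^ n * N') X)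
    (hhol : IsHolEta (p ^ n * N') X) :
    IsHolEta N'
      (fun e => ∑ i ∈ Finset.range (n + 1), (if i = j then (m : ℤ) else 1) * X (p ^ i * e)) ∧
    ((∃ d ∈ (p ^ n * N').divisors, X d ≠ 0) →
      ∃ e ∈ N'.divisors,
        (∑ i ∈ Finset.range (n + 1), (if i = j then (m : ℤ) else 1) * X (p ^ i * e)) ≠ 0) := by
  have hcop : p.Coprime N' := (Nat.Prime.coprime_iff_not_dvd hp).mpr hpN'
  have hM0 : p ^ n * N' ≠ 0 := (Nat.mul_pos (pow_pos hp.pos n) hN').ne'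
  obtain ⟨c, hc, hY⟩ := exists_pos_etaOrd_eq_sum (n := n) hp hcop j m hm1
    (by have := hp.pos; omega) X
  have hnonneg : ∀ t, t ∣ N' → ∀ s ∈ Finset.range (n + 1),
      0 ≤ c s * etaOrd (p ^ n * N') X (p ^ s * t) := by
    intro t ht s hs
    have hsn := Nat.lt_succ_iff.mp (Finset.mem_range.mp hs)
    exact mul_nonneg (hc s hsn).le (hhol _ (Nat.mem_divisors.mpr
      ⟨mul_dvd_mul (pow_dvd_pow p hsn) ht, hM0⟩))
  refine ⟨fun t ht => ?_, fun ⟨d, hd, hXd⟩ => ?_⟩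
  · have htN := Nat.dvd_of_mem_divisors ht
    rw [hY t htN]
    exact Finset.sum_nonneg (hnonneg t htN)
  · by_contra! hzero
    refine hXd (eq_zero_of_etaOrd_eq_zero _ X (fun u hu => ?_) d hd)
    obtain ⟨a, t, ha, ht, rfl⟩ := exists_dvd_and_dvd_of_dvd_mul (Nat.dvd_of_mem_divisors hu)
    obtain ⟨s, hsn, rfl⟩ := (Nat.dvd_prime_pow hp).mp ha
    have hsum := hY t ht
    rw [etaOrd, Finset.sum_eq_zero fun e he => by rw [hzero e he, Int.cast_zero, mul_zero]]
      at hsum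
    have h0 := (Finset.sum_eq_zero_iff_of_nonneg (hnonneg t ht)).mp hsum.symm s
      (Finset.mem_range.mpr (Nat.lt_succ_iff.mpr hsn))
    exact (mul_eq_zero.mp h0).resolve_left (hc s hsn).ne'
end

section
/- Let M, N ∈ ℕ with N | M and gcd(N, M/N) = 1, and let {a_n}_{n∈ℕ} be a multiplicative sequence of integers (a_1 = 1 and a_{mn} = a_m·a_n for coprime m, n) such that a_n = 0 whenever n ∤ (M/N), and such that for every prime p and every integer j ≥ 0 with p^j | (M/N) (setting a_{p^{-1}} := 0): a_{p^{j-1}} + a_{p^{j+1}} ≤ p·a_{p^j} if p^j exactly divides M/N, and p·(a_{p^{j-1}} + a_{p^{j+1}}) ≤ (p²+1)·a_{p^j} otherwise. For X : D_M → ℤ define Y : D_N → ℤ by Y_e := Σ_{d | M/N} a_d·X_{d·e}. If η^X is holomorphic on Γ₀(M), then η^Y is holomorphic on Γ₀(N). -/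
open Finset

/-- A sum over the divisors of a product of coprime numbers is a double sum. -/
theorem sum_divisors_mul_of_coprime {R : Type*} [AddCommMonoid R] {m n : ℕ}
    (hmn : m.Coprime n) (f : ℕ → R) :
    ∑ d ∈ (m * n).divisors, f d = ∑ d ∈ m.divisors, ∑ e ∈ n.divisors, f (d * e) := by
  rw [Nat.divisors_mul, ← Finset.sum_product', Finset.mul_def,
    Finset.sum_image (by simpa using hmn.mul_injOn_divisors)]

theorem gcd_mul_mul_of_coprime {m n d s e t : ℕ} (hmn : m.Coprime n) (hd : d ∣ m) (hs : s ∣ m)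
    (he : e ∣ n) (ht : t ∣ n) : (d * e).gcd (s * t) = d.gcd s * e.gcd t := by
  rw [((hmn.coprime_dvd_left hs).coprime_dvd_right ht).gcd_mul,
    ((hmn.symm.coprime_dvd_left he).coprime_dvd_right hs).gcd_mul_right_cancel,
    ((hmn.coprime_dvd_left hd).coprime_dvd_right ht).gcd_mul_left_cancel]

/-- `d ↦ d * a d` is, on the divisors of `K`, a nonnegative combination of the functions
`d ↦ gcd(d, s)²` with `s ∣ K`. -/
def IsGcdSqCone (a : ℕ → ℤ) (K : ℕ) : Prop :=
  ∃ c : ℕ → ℚ, (∀ s ∈ K.divisors, 0 ≤ c s) ∧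
    ∀ d ∈ K.divisors, (d : ℚ) * a d = ∑ s ∈ K.divisors, c s * (d.gcd s : ℚ) ^ 2

theorem IsGcdSqCone.mul {a : ℕ → ℤ}
    (hmul : ∀ u v : ℕ, Nat.Coprime u v → a (u * v) = a u * a v) {m n : ℕ}
    (hmn : m.Coprime n) (hm : IsGcdSqCone a m) (hn : IsGcdSqCone a n) :
    IsGcdSqCone a (m * n) := by
  obtain ⟨b, hb0, hb⟩ := hm
  obtain ⟨c, hc0, hc⟩ := hn
  have hsplit : ∀ d ∈ m.divisors, ∀ e ∈ n.divisors,
      (d * e).gcd m = d ∧ (d * e).gcd n = e := by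
    intro d hd e he
    have hd := Nat.dvd_of_mem_divisors hd
    have he := Nat.dvd_of_mem_divisors he
    rw [(hmn.symm.coprime_dvd_left he).gcd_mul_right_cancel,
      (hmn.coprime_dvd_left hd).gcd_mul_left_cancel]
    exact ⟨Nat.gcd_eq_left hd, Nat.gcd_eq_left he⟩
  refine ⟨fun s => b (s.gcd m) * c (s.gcd n), ?_, ?_⟩
  · intro s hs
    have h0 := Nat.mul_ne_zero_iff.mp (Nat.mem_divisors.mp hs).2
    exact mul_nonneg (hb0 _ (Nat.mem_divisors.mpr ⟨Nat.gcd_dvd_right _ _, h0.1⟩))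
      (hc0 _ (Nat.mem_divisors.mpr ⟨Nat.gcd_dvd_right _ _, h0.2⟩))
  · intro x hx
    rw [Nat.divisors_mul, Finset.mem_mul] at hx
    obtain ⟨d, hd, e, he, rfl⟩ := hx
    have hd' := Nat.dvd_of_mem_divisors hd
    have he' := Nat.dvd_of_mem_divisors he
    rw [hmul _ _ ((hmn.coprime_dvd_left hd').coprime_dvd_right he')]
    push_cast
    rw [mul_mul_mul_comm, hb d hd, hc e he, sum_divisors_mul_of_coprime hmn,
      Finset.sum_mul_sum]
    refine Finset.sum_congr rfl fun s hs => Finset.sum_congr rfl fun t ht => ?_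
    rw [(hsplit s hs t ht).1, (hsplit s hs t ht).2,
      gcd_mul_mul_of_coprime hmn hd' (Nat.dvd_of_mem_divisors hs) he' (Nat.dvd_of_mem_divisors ht)]
    push_cast
    ring

theorem isGcdSqCone_of_prime_pow {a : ℕ → ℤ}
    (hmul : ∀ u v : ℕ, Nat.Coprime u v → a (u * v) = a u * a v) (K : ℕ) (hK : K ≠ 0)
    (h : ∀ p k : ℕ, p.Prime → p ^ k ∣ K → ¬ p ^ (k + 1) ∣ K → IsGcdSqCone a (p ^ k)) :
    IsGcdSqCone a K := by
  induction K using Nat.recOnPrimeCoprime with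
  | zero => exact absurd rfl hK
  | prime_pow p n hp =>
    refine h p n hp dvd_rfl fun hdvd => ?_
    have := (Nat.pow_dvd_pow_iff_le_right hp.one_lt).mp hdvd
    omega
  | coprime m n hm hn hmn ihm ihn =>
    have key : ∀ {m n p k : ℕ}, m.Coprime n → p.Prime → p ^ k ∣ m → ¬ p ^ (k + 1) ∣ m →
        k ≠ 0 → ¬ p ^ (k + 1) ∣ m * n := by
      intro m n p k hmn hp hk hk1 hk0 hdvd
      have hpm : p ∣ m := (dvd_pow_self p hk0).trans hk
      exact hk1 (Nat.Coprime.dvd_of_dvd_mul_right ((hmn.coprime_dvd_left hpm).pow_left _) hdvd)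
    have hone : IsGcdSqCone a 1 := by
      obtain ⟨p, hlt, hp⟩ := Nat.exists_infinite_primes (m * n + 1)
      have := h p 0 hp (by simp) fun hdvd => by
        have := Nat.le_of_dvd (Nat.pos_of_ne_zero hK) hdvd
        rw [zero_add, pow_one] at this
        omega
      simpa using this
    refine IsGcdSqCone.mul hmul hmn (ihm (by omega) ?_) (ihn (by omega) ?_)
    · intro p k hp hk hk1
      rcases eq_or_ne k 0 with rfl | hk0
      · simpa using hone
      · exact h p k hp (hk.mul_right n) (key hmn hp hk hk1 hk0)
    · intro p k hp hk hk1
      rcases eq_or_ne k 0 with rfl | hk0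
      · simpa using hone
      · exact h p k hp (hk.mul_left m) (mul_comm n m ▸ key hmn.symm hp hk hk1 hk0)

theorem sum_range_ite_sub (C : ℕ → ℚ) {j n : ℕ} (hj : j ≤ n) :
    ∑ i ∈ range n, (if j ≤ i then C i - C (i + 1) else 0) = C j - C n := by
  induction n, hj using Nat.le_induction with
  | base =>
    rw [sub_self]
    exact Finset.sum_eq_zero fun i hi => if_neg (by simpa using hi)
  | succ n hn ih => rw [Finset.sum_range_succ, ih, if_pos hn]; ring

/-- A finite sequence satisfying the discrete concavity conditions relative to `q ^ j` is a
nonnegative combination of the sequences `j ↦ q ^ min i j`. -/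
theorem exists_nonneg_comb_pow_min (q : ℚ) (hq : 1 < q) (k : ℕ) (b : ℕ → ℚ)
    (hzero : k = 0 → 0 ≤ b 0) (hfirst : k ≠ 0 → b 1 ≤ q * b 0)
    (hmid : ∀ j, j + 1 < k → b (j + 2) - b (j + 1) ≤ q * (b (j + 1) - b j))
    (hlast : ∀ j, j + 1 = k → b j ≤ b (j + 1)) :
    ∃ c : ℕ → ℚ, (∀ i ≤ k, 0 ≤ c i) ∧
      ∀ j ≤ k, b j = ∑ i ∈ range (k + 1), c i * q ^ min j i := by
  let C : ℕ → ℚ := fun j => if k < j then 0 else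
    Nat.casesOn j (b 0) fun i => (b (i + 1) - b i) / (q ^ i * (q - 1))
  have hpos : ∀ i : ℕ, 0 < q ^ i * (q - 1) := fun i =>
    mul_pos (pow_pos (by linarith) i) (by linarith)
  have hC0 : C 0 = b 0 := by simp [C]
  have hCs : ∀ i, i + 1 ≤ k → C (i + 1) = (b (i + 1) - b i) / (q ^ i * (q - 1)) := fun i hi => by
    simp only [C]; rw [if_neg (by omega)]
  have hCk : C (k + 1) = 0 := by simp [C]
  refine ⟨fun i => C i - C (i + 1), ?_, ?_⟩
  · intro i hi
    rw [sub_nonneg]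
    rcases hi.eq_or_lt with rfl | hi
    · rw [hCk]
      cases i with
      | zero => rw [hC0]; exact hzero rfl
      | succ i => rw [hCs i le_rfl]; exact div_nonneg (sub_nonneg.mpr (hlast i rfl)) (hpos i).le
    · rw [hCs i hi, div_le_iff₀ (hpos i)]
      cases i with
      | zero => rw [hC0]; linarith [hfirst (by omega)]
      | succ i =>
        rw [hCs i hi.le, pow_succ, mul_right_comm, ← mul_assoc, div_mul_cancel₀ _ (hpos i).ne']
        linarith [hmid i hi]
  · intro j hj
    induction j with
    | zero =>
      simp only [Nat.zero_min, pow_zero, mul_one]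
      rw [Finset.sum_range_sub', hC0, hCk, sub_zero]
    | succ j ih =>
      have hdiff : ∑ i ∈ range (k + 1), (C i - C (i + 1)) * q ^ min (j + 1) i
          - ∑ i ∈ range (k + 1), (C i - C (i + 1)) * q ^ min j i
          = (q ^ j * (q - 1)) * C (j + 1) := by
        rw [← Finset.sum_sub_distrib, ← sub_zero (C (j + 1)), ← hCk,
          ← sum_range_ite_sub C (show j + 1 ≤ k + 1 by omega), Finset.mul_sum]
        refine Finset.sum_congr rfl fun i _ => ?_
        split_ifs with hji
        · rw [min_eq_left hji, min_eq_left (by omega), pow_succ]; ring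
        · rw [min_eq_right (by omega), min_eq_right (by omega)]; ring
      rw [hCs j hj, mul_div_cancel₀ _ (hpos j).ne', ← ih (by omega)] at hdiff
      linarith

theorem isGcdSqCone_prime_pow {a : ℕ → ℤ} {p k : ℕ} (hp : p.Prime)
    (hzero : 0 ≤ a 1) (hfirst : k ≠ 0 → a p ≤ p * a 1)
    (hmid : ∀ j, j + 1 < k →
      (p : ℤ) * (a (p ^ j) + a (p ^ (j + 2))) ≤ ((p : ℤ) ^ 2 + 1) * a (p ^ (j + 1)))
    (hlast : ∀ j, j + 1 = k → a (p ^ j) ≤ p * a (p ^ (j + 1))) :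
    IsGcdSqCone a (p ^ k) := by
  have hp1 : (1 : ℚ) < p := by exact_mod_cast hp.one_lt
  have hp0 : (0 : ℚ) < p := by linarith
  obtain ⟨c, hc0, hc⟩ := exists_nonneg_comb_pow_min ((p : ℚ) ^ 2) (by nlinarith) k
    (fun j => (p : ℚ) ^ j * a (p ^ j)) (fun _ => by simpa using hzero)
    (fun hk => by
      have h : (a p : ℚ) ≤ p * a 1 := by exact_mod_cast hfirst hk
      simp only [pow_one, pow_zero, one_mul]
      nlinarith)
    (fun j hj => by
      have h : (p : ℚ) * (a (p ^ j) + a (p ^ (j + 2))) ≤ ((p : ℚ) ^ 2 + 1) * a (p ^ (j + 1)) := by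
        exact_mod_cast hmid j hj
      have := mul_le_mul_of_nonneg_left h (pow_pos hp0 (j + 1)).le
      simp only [pow_succ] at this ⊢
      linarith)
    (fun j hj => by
      have h : (a (p ^ j) : ℚ) ≤ p * a (p ^ (j + 1)) := by exact_mod_cast hlast j hj
      have := mul_le_mul_of_nonneg_left h (pow_pos hp0 j).le
      simp only [pow_succ] at this ⊢
      linarith)
  refine ⟨fun s => c (s.factorization p), ?_, ?_⟩
  · intro s hs
    obtain ⟨i, hi, rfl⟩ := (Nat.mem_divisors_prime_pow hp k).mp hs
    simpa [hp.factorization_pow] using hc0 i hi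
  · intro d hd
    obtain ⟨j, hj, rfl⟩ := (Nat.mem_divisors_prime_pow hp k).mp hd
    rw [Nat.sum_divisors_prime_pow hp, Nat.cast_pow, hc j hj]
    refine Finset.sum_congr rfl fun i _ => ?_
    have hgcd : (p ^ j).gcd (p ^ i) = p ^ min j i := by
      rcases le_total j i with h | h
      · rw [min_eq_left h, Nat.gcd_eq_left (pow_dvd_pow p h)]
      · rw [min_eq_right h, Nat.gcd_eq_right (pow_dvd_pow p h)]
    rw [hgcd, Nat.cast_pow, ← pow_mul, ← pow_mul, mul_comm 2]
    simp [hp.factorization_pow]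

/-- Lemma (holomorphy preserving map): let `N ‖ M` and let `{a_n}` be a multiplicative
integer sequence, vanishing off the divisors of `M/N`, satisfying
`a_{p^{j-1}} + a_{p^{j+1}} ≤ p·a_{p^j}` if `p^j ‖ (M/N)` and
`p·(a_{p^{j-1}} + a_{p^{j+1}}) ≤ (p²+1)·a_{p^j}` otherwise (with `a_{p^{-1}} := 0`),
for all primes `p` and all `j ≥ 0` with `p^j ∣ M/N`.  Then
`Φ_{M,N,â} : η^X ↦ η^Y`, `Y_e = ∑_{d ∣ M/N} a_d·X_{d·e}`, preserves holomorphy. -/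
theorem phi_preserves_holomorphy (M N : ℕ) (hM : 0 < M) (hNM : N ∣ M)
    (hcop : Nat.Coprime N (M / N))
    (a : ℕ → ℤ) (ha1 : a 1 = 1)
    (hmul : ∀ u v : ℕ, Nat.Coprime u v → a (u * v) = a u * a v)
    (hvanish : ∀ u : ℕ, ¬ u ∣ M / N → a u = 0)
    (hineq : ∀ p : ℕ, p.Prime → ∀ j : ℕ, p ^ j ∣ M / N →
      if ¬ p ^ (j + 1) ∣ M / N then
        (if j = 0 then 0 else a (p ^ (j - 1))) + a (p ^ (j + 1)) ≤ (p : ℤ) * a (p ^ j)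
      else
        (p : ℤ) * ((if j = 0 then 0 else a (p ^ (j - 1))) + a (p ^ (j + 1))) ≤
          ((p : ℤ) ^ 2 + 1) * a (p ^ j))
    (X : ℕ → ℤ) (hsupp : SuppIn M X) (hhol : IsHolEta M X) :
    IsHolEta N (fun e => ∑ d ∈ (M / N).divisors, a d * X (d * e)) := by
  obtain ⟨K, rfl⟩ := hNM
  have hN : 0 < N := Nat.pos_of_mul_pos_right hM
  have hK : 0 < K := Nat.pos_of_mul_pos_left hM
  rw [Nat.mul_div_cancel_left K hN] at *
  have hcone : IsGcdSqCone a K := by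
    refine isGcdSqCone_of_prime_pow hmul K hK.ne' fun p k hp hk hk1 => ?_
    have hp2 : (2 : ℤ) ≤ p := by exact_mod_cast hp.two_le
    refine isGcdSqCone_prime_pow hp (by omega) (fun hk0 => ?_) (fun j hj => ?_) (fun j hj => ?_)
    · have h := hineq p hp 0 (by simp)
      rw [if_neg (not_not.mpr ((pow_dvd_pow p (by omega)).trans hk))] at h
      simp only [if_true, zero_add, pow_one, pow_zero, ha1, mul_one] at h ⊢
      by_contra! hlt
      nlinarith
    · have h := hineq p hp (j + 1) ((pow_dvd_pow p hj.le).trans hk)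
      rw [if_neg (not_not.mpr ((pow_dvd_pow p (by omega)).trans hk))] at h
      simpa using h
    · subst hj
      have h := hineq p hp (j + 1) hk
      rw [if_pos hk1, hvanish _ hk1] at h
      simpa using h
  obtain ⟨c, hc0, hc⟩ := hcone
  intro t ht
  have htN := Nat.dvd_of_mem_divisors ht
  have hNQ : (N : ℚ) ≠ 0 := by positivity
  have hKQ : (K : ℚ) ≠ 0 := by positivity
  have htQ : (Nat.gcd (t ^ 2) N : ℚ) ≠ 0 := by
    exact_mod_cast (Nat.gcd_pos_of_pos_right _ hN).ne'
  have hcomb : etaOrd N (fun e => ∑ d ∈ K.divisors, a d * X (d * e)) t =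
      ∑ s ∈ K.divisors, c s * (Nat.gcd ((t * s) ^ 2) (N * K) : ℚ) /
        ((Nat.gcd (t ^ 2) N : ℚ) * K) * etaOrd (N * K) X (t * s) := by
    simp only [etaOrd]
    simp_rw [sum_divisors_mul_of_coprime hcop, Finset.mul_sum]
    rw [Finset.sum_comm]
    refine Finset.sum_congr rfl fun e he => ?_
    rw [Finset.sum_comm]
    push_cast
    rw [Finset.mul_sum]
    refine Finset.sum_congr rfl fun d hd => ?_
    have heQ : (e : ℚ) ≠ 0 := by exact_mod_cast (Nat.pos_of_mem_divisors he).ne'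
    have hdQ : (d : ℚ) ≠ 0 := by exact_mod_cast (Nat.pos_of_mem_divisors hd).ne'
    have had : (a d : ℚ) = (∑ s ∈ K.divisors, c s * (d.gcd s : ℚ) ^ 2) / d := by
      rw [← hc d hd, mul_div_cancel_left₀ _ hdQ]
    rw [had, Finset.sum_div, Finset.sum_mul, Finset.mul_sum]
    refine Finset.sum_congr rfl fun s hs => ?_
    have hgQ : (Nat.gcd ((t * s) ^ 2) (N * K) : ℚ) ≠ 0 := by
      exact_mod_cast (Nat.gcd_pos_of_pos_right _ hM).ne'
    rw [gcd_mul_mul_of_coprime hcop (Nat.dvd_of_mem_divisors he) htN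
      (Nat.dvd_of_mem_divisors hd) (Nat.dvd_of_mem_divisors hs), mul_comm d e]
    push_cast
    field_simp
  rw [hcomb]
  refine Finset.sum_nonneg fun s hs => mul_nonneg ?_ (hhol _ ?_)
  · have := hc0 s hs
    positivity
  · exact Nat.mem_divisors.mpr ⟨mul_dvd_mul htN (Nat.dvd_of_mem_divisors hs), hM.ne'⟩
end

section
/- Suppose that for every 3-smooth positive integer N (i.e., every N whose prime divisors are all ≤ 3), every primitive holomorphic eta quotient of weight 1/2 and level N is one of the fourteen eta quotients of Zagier's list. Then for every positive integer N, every primitive holomorphic eta quotient of weight 1/2 and level N is one of the fourteen eta quotients of Zagier's list. -/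
open Finset

/-- The eta quotient `η^X` is primitive: `gcd {d ∣ N : X_d ≠ 0} = 1`. -/
def IsPrimitiveEta (N : ℕ) (X : ℕ → ℤ) : Prop :=
  (N.divisors.filter fun d => X d ≠ 0).gcd id = 1

/-- Builds an exponent vector supported on the divisors `1, 2, 3, 4, 6, 12` of `12`. -/
def zvec (a b c d e f : ℤ) : ℕ → ℤ := fun n =>
  if n = 1 then a else if n = 2 then b else if n = 3 then c else
  if n = 4 then d else if n = 6 then e else if n = 12 then f else 0

/-- Zagier's list of fourteen eta quotients, given by their exponent vectors. -/
def zagierList : List (ℕ → ℤ) :=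
  [zvec 1 0 0 0 0 0,
   zvec 2 (-1) 0 0 0 0,
   zvec (-1) 2 0 0 0 0,
   zvec (-1) 3 0 (-1) 0 0,
   zvec (-2) 5 0 (-2) 0 0,
   zvec 1 (-1) 0 1 0 0,
   zvec 1 (-1) (-1) 0 2 0,
   zvec 2 (-1) (-1) 0 1 0,
   zvec (-1) 2 1 0 (-1) 0,
   zvec (-1) 1 2 0 (-1) 0,
   zvec (-1) 2 1 (-1) (-1) 1,
   zvec (-2) 5 1 (-2) (-2) 1,
   zvec 1 (-1) (-1) 1 2 (-1),
   zvec 1 (-2) (-2) 1 5 (-2)]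

/-- The eta quotient `η^X` is one of the fourteen eta quotients of Zagier's list. -/
def IsOnZagierList (X : ℕ → ℤ) : Prop :=
  ∃ Y ∈ zagierList, ∀ d : ℕ, X d = Y d

/-- The `p`-part of the order matrix: `gcd (p ^ j) (p ^ i) ^ 2 / p ^ j`. -/
def powKernel (p : ℚ) (i j : ℕ) : ℚ := p ^ (2 * min i j) / p ^ j

/-- The inverse of the order matrix at a prime power is tridiagonal. -/
lemma powKernel_second_difference {p : ℚ} (hp : p ≠ 0) (i j : ℕ) :
    (p ^ 2 + 1) * (powKernel p (i + 1) j / p ^ (i + 1)) - p * (powKernel p i j / p ^ i)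
      - p * (powKernel p (i + 2) j / p ^ (i + 2)) = if i + 1 = j then p ^ 2 - 1 else 0 := by
  unfold powKernel
  rcases lt_trichotomy (i + 1) j with h | h | h
  · rw [if_neg h.ne, min_eq_left h.le, min_eq_left (by lia), min_eq_left (by lia)]
    field_simp
    ring
  · subst h
    rw [if_pos rfl, min_self, min_eq_left (by lia), min_eq_right (by lia)]
    field_simp
    ring
  · rw [if_neg h.ne', min_eq_right h.le, min_eq_right (by lia), min_eq_right (by lia)]
    field_simp
    ring

lemma powKernel_first_difference {p : ℚ} (hp : p ≠ 0) (j : ℕ) :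
    p ^ 2 * powKernel p 0 j - p * (powKernel p 1 j / p) = if 0 = j then p ^ 2 - 1 else 0 := by
  unfold powKernel
  rcases j with _ | j
  · simp
    field_simp
  · rw [if_neg (by lia), min_eq_left (by lia), min_eq_left (by lia)]
    field_simp
    ring

/-- If a vector has nonnegative orders at all cusps of a prime power level `p ^ n`, then its sum is
nonnegative, and for `5 ≤ p` no entry is less than `-5/16` times the sum. -/
lemma sum_nonneg_of_powKernel_nonneg {p : ℚ} (hp : 1 < p) (n : ℕ) (G : ℕ → ℚ)
    (hG : ∀ i, 0 ≤ ∑ j ∈ range (n + 1), powKernel p i j * G j) :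
    0 ≤ ∑ j ∈ range (n + 1), G j ∧
      (5 ≤ p → ∀ j ∈ range (n + 1), 0 ≤ 16 * G j + 5 * ∑ k ∈ range (n + 1), G k) := by
  have hp0 : p ≠ 0 := by positivity
  have hp1 : 0 < p ^ 2 - 1 := by nlinarith
  obtain ⟨z, hz⟩ : ∃ z : ℕ → ℚ, ∀ i,
      z i = (∑ j ∈ range (n + 1), powKernel p i j * G j) / p ^ i / (p ^ 2 - 1) := ⟨_, fun _ => rfl⟩
  have hz0 (i : ℕ) : 0 ≤ z i := by
    rw [hz]
    have := hG i
    positivity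
  have hzero : G 0 = p ^ 2 * z 0 - p * z 1 := by
    have key : ∑ j ∈ range (n + 1),
        (p ^ 2 * powKernel p 0 j - p * (powKernel p 1 j / p)) * G j = (p ^ 2 - 1) * G 0 := by
      simp [powKernel_first_difference hp0]
    have : (p ^ 2 - 1) * (p ^ 2 * z 0 - p * z 1) = (p ^ 2 - 1) * G 0 := by
      rw [← key, hz, hz]
      simp only [sub_mul, Finset.sum_sub_distrib, mul_assoc, ← Finset.mul_sum, div_mul_eq_mul_div,
        ← Finset.sum_div]
      field_simp
    exact (mul_left_cancel₀ hp1.ne' this).symm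
  have hsucc (i : ℕ) (hi : i + 1 < n + 1) :
      G (i + 1) = (p ^ 2 + 1) * z (i + 1) - p * z i - p * z (i + 2) := by
    have key : ∑ j ∈ range (n + 1), ((p ^ 2 + 1) * (powKernel p (i + 1) j / p ^ (i + 1))
        - p * (powKernel p i j / p ^ i) - p * (powKernel p (i + 2) j / p ^ (i + 2))) * G j
        = (p ^ 2 - 1) * G (i + 1) := by
      simp [powKernel_second_difference hp0, show i < n by lia]
    have : (p ^ 2 - 1) * ((p ^ 2 + 1) * z (i + 1) - p * z i - p * z (i + 2))
        = (p ^ 2 - 1) * G (i + 1) := by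
      rw [← key, hz, hz, hz]
      simp only [sub_mul, Finset.sum_sub_distrib, mul_assoc, ← Finset.mul_sum, div_mul_eq_mul_div,
        ← Finset.sum_div]
      field_simp
    exact (mul_left_cancel₀ hp1.ne' this).symm
  have hlast : p * z (n + 1) = z n := by
    have : ∑ j ∈ range (n + 1), powKernel p (n + 1) j * G j
        = ∑ j ∈ range (n + 1), powKernel p n j * G j := by
      refine Finset.sum_congr rfl fun j hj => ?_
      have := Finset.mem_range.1 hj
      rw [powKernel, powKernel, min_eq_right (by lia), min_eq_right (by lia)]
    rw [hz, hz, this]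
    field_simp
    ring
  have hsum (k : ℕ) (hk : k < n + 1) : ∑ j ∈ range (k + 1), G j
      = (p - 1) ^ 2 * ∑ j ∈ range (k + 1), z j + (p - 1) * z 0 + p * z k - p * z (k + 1) := by
    induction k with
    | zero =>
      simp [hzero]
      ring
    | succ k ih =>
      rw [Finset.sum_range_succ, ih (by lia), hsucc k hk, Finset.sum_range_succ z (k + 1)]
      ring
  have hT : (p - 1) ^ 2 * ∑ j ∈ range (n + 1), z j ≤ ∑ j ∈ range (n + 1), G j := by
    rw [hsum n (by lia), hlast]
    nlinarith [mul_nonneg (sub_pos.2 hp).le (hz0 0), mul_nonneg (sub_pos.2 hp).le (hz0 n)]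
  refine ⟨le_trans (mul_nonneg (sq_nonneg _) (Finset.sum_nonneg fun j _ => hz0 j)) hT,
    fun hp5 j hj => ?_⟩
  have hcoef : 16 * p ≤ 5 * (p - 1) ^ 2 := by nlinarith
  suffices h : -(p * ∑ k ∈ range (n + 1), z k) ≤ G j by
    have := mul_le_mul_of_nonneg_right hcoef
      (Finset.sum_nonneg fun k (_ : k ∈ range (n + 1)) => hz0 k)
    linarith
  have hle (s : Finset ℕ) (hs : s ⊆ range (n + 1)) :
      p * ∑ k ∈ s, z k ≤ p * ∑ k ∈ range (n + 1), z k :=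
    mul_le_mul_of_nonneg_left
      (Finset.sum_le_sum_of_subset_of_nonneg hs fun k _ _ => hz0 k) (by positivity)
  have hj' := Finset.mem_range.1 hj
  rcases j with _ | i
  · rw [hzero]
    have h0 := mul_nonneg (sq_nonneg p) (hz0 0)
    rcases Nat.eq_zero_or_pos n with rfl | hn
    · have := hle {0} (by simp)
      simp only [Finset.sum_singleton] at this
      nlinarith [hz0 0]
    · have := hle {1} (by simp; lia)
      simp only [Finset.sum_singleton] at this
      linarith
  · rw [hsucc i hj']
    have h0 := mul_nonneg (sq_nonneg p) (hz0 (i + 1))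
    rcases Nat.eq_or_lt_of_le (Nat.lt_succ_iff.1 hj') with hn | hn
    · have := hle {i} (by simp; lia)
      rw [Finset.sum_singleton] at this
      rw [← hn] at hlast
      linarith
    · have := hle {i, i + 2} (by intro x; simp; lia)
      rw [Finset.sum_pair (by lia)] at this
      linarith [hz0 (i + 1)]

/-- `etaOrd` without the positive factor `N / gcd (t ^ 2) N`. -/
def ordSum (N : ℕ) (X : ℕ → ℤ) (t : ℕ) : ℚ :=
  ∑ d ∈ N.divisors, (Nat.gcd d t : ℚ) ^ 2 / d * X d

lemma etaOrd_eq_mul_ordSum (N : ℕ) (X : ℕ → ℤ) (t : ℕ) :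
    etaOrd N X t = N / (Nat.gcd (t ^ 2) N : ℚ) * ordSum N X t := by
  rw [etaOrd, ordSum, Finset.mul_sum]
  refine Finset.sum_congr rfl fun d _ => ?_
  rw [← mul_assoc, div_mul_div_comm, mul_comm (d : ℚ)]

lemma ordSum_gcd_right (N : ℕ) (X : ℕ → ℤ) (t : ℕ) :
    ordSum N X (Nat.gcd t N) = ordSum N X t := by
  refine Finset.sum_congr rfl fun d hd => ?_
  rw [Nat.gcd_comm t, ← Nat.gcd_assoc, Nat.gcd_eq_left (Nat.dvd_of_mem_divisors hd)]

lemma isHolEta_iff_ordSum_nonneg {N : ℕ} (hN : 0 < N) (X : ℕ → ℤ) :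
    IsHolEta N X ↔ ∀ t, 0 ≤ ordSum N X t := by
  have hpos (t : ℕ) : (0 : ℚ) < N / (Nat.gcd (t ^ 2) N : ℚ) := by
    have := Nat.gcd_pos_of_pos_right (t ^ 2) hN
    positivity
  refine ⟨fun h t => ?_, fun h t _ => ?_⟩
  · have := h (Nat.gcd t N) (Nat.mem_divisors.2 ⟨Nat.gcd_dvd_right t N, hN.ne'⟩)
    rw [etaOrd_eq_mul_ordSum, ordSum_gcd_right] at this
    exact nonneg_of_mul_nonneg_right this (hpos _)
  · rw [etaOrd_eq_mul_ordSum]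
    exact mul_nonneg (hpos t).le (h t)

lemma ordSum_linear (N : ℕ) (a b : ℤ) (X Y : ℕ → ℤ) (t : ℕ) :
    ordSum N (fun d => a * X d + b * Y d) t = a * ordSum N X t + b * ordSum N Y t := by
  simp only [ordSum, Finset.mul_sum, ← Finset.sum_add_distrib]
  refine Finset.sum_congr rfl fun d _ => ?_
  push_cast
  ring

lemma ordSum_sum (N : ℕ) {ι : Type*} (s : Finset ι) (X : ι → ℕ → ℤ) (t : ℕ) :
    ordSum N (fun d => ∑ j ∈ s, X j d) t = ∑ j ∈ s, ordSum N (X j) t := by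
  simp only [ordSum]
  rw [Finset.sum_comm]
  refine Finset.sum_congr rfl fun d _ => ?_
  rw [← Finset.mul_sum]
  push_cast
  rfl

/-- The divisors of `p ^ n * M` are the products `p ^ j * m` with `j ≤ n` and `m ∣ M`. -/
lemma sum_divisors_prime_pow_mul {A : Type*} [AddCommMonoid A] {p M : ℕ} (hp : p.Prime)
    (hM : 0 < M) (hpM : p.Coprime M) (n : ℕ) (f : ℕ → A) :
    ∑ d ∈ (p ^ n * M).divisors, f d = ∑ j ∈ range (n + 1), ∑ m ∈ M.divisors, f (p ^ j * m) := by
  rw [← Finset.sum_product']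
  symm
  refine Finset.sum_nbij (fun x => p ^ x.1 * x.2) ?_ ?_ ?_ fun _ _ => rfl
  · rintro ⟨j, m⟩ h
    simp only [Finset.mem_product, Finset.mem_range, Nat.mem_divisors] at h
    exact Nat.mem_divisors.2 ⟨mul_dvd_mul (pow_dvd_pow p (by lia)) h.2.1,
      mul_ne_zero (pow_ne_zero _ hp.ne_zero) hM.ne'⟩
  · rintro ⟨j, m⟩ h ⟨j', m'⟩ h' heq
    simp only [Finset.coe_product, Set.mem_prod, Finset.mem_coe, Nat.mem_divisors] at h h'
    have hcop {k : ℕ} (hk : k ∣ M) : ¬ p ∣ k :=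
      (hp.coprime_iff_not_dvd).1 (hpM.coprime_dvd_right hk)
    have hv {i k : ℕ} (hk : k ∣ M) : padicValNat p (p ^ i * k) = i := by
      have := Fact.mk hp
      rw [padicValNat.mul (pow_ne_zero _ hp.ne_zero) (Nat.pos_of_dvd_of_pos hk hM).ne',
        padicValNat.prime_pow, padicValNat.eq_zero_of_not_dvd (hcop hk), add_zero]
    have hj : j = j' := by
      rw [← hv (i := j) h.2.1, ← hv (i := j') h'.2.1]
      exact congrArg (padicValNat p) heq
    subst hj
    exact Prod.ext rfl (Nat.eq_of_mul_eq_mul_left (pow_pos hp.pos j) heq)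
  · intro d hd
    obtain ⟨a, m, ha, hm, rfl⟩ := exists_dvd_and_dvd_of_dvd_mul
      (Nat.dvd_of_mem_divisors (Finset.mem_coe.1 hd))
    obtain ⟨j, hj, rfl⟩ := (Nat.dvd_prime_pow hp).1 ha
    refine ⟨(j, m), ?_, rfl⟩
    simp only [Finset.coe_product, Set.mem_prod, Finset.mem_coe, Finset.mem_range,
      Nat.mem_divisors]
    exact ⟨by lia, hm, hM.ne'⟩

/-- The part of the exponent vector `X` supported on `p ^ j * D_M`, moved to `D_M`. -/
def powSlice (p M : ℕ) (X : ℕ → ℤ) (j : ℕ) : ℕ → ℤ :=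
  fun m => if m ∣ M then X (p ^ j * m) else 0

lemma suppIn_powSlice (p M : ℕ) (X : ℕ → ℤ) (j : ℕ) : SuppIn M (powSlice p M X j) :=
  fun _ hd => if_neg hd

lemma sum_sum_powSlice {p M : ℕ} (hp : p.Prime) (hM : 0 < M) (hpM : p.Coprime M) (n : ℕ)
    (X : ℕ → ℤ) :
    ∑ j ∈ range (n + 1), ∑ m ∈ M.divisors, powSlice p M X j m
      = ∑ d ∈ (p ^ n * M).divisors, X d := by
  rw [sum_divisors_prime_pow_mul hp hM hpM]
  refine Finset.sum_congr rfl fun j _ => Finset.sum_congr rfl fun m hm => ?_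
  exact if_pos (Nat.dvd_of_mem_divisors hm)

lemma ordSum_prime_pow_mul {p M s : ℕ} (hp : p.Prime) (hM : 0 < M) (hpM : p.Coprime M)
    (hps : p.Coprime s) (n i : ℕ) (X : ℕ → ℤ) :
    ordSum (p ^ n * M) X (p ^ i * s)
      = ∑ j ∈ range (n + 1), powKernel p i j * ordSum M (powSlice p M X j) s := by
  rw [ordSum, sum_divisors_prime_pow_mul hp hM hpM]
  refine Finset.sum_congr rfl fun j _ => ?_
  rw [ordSum, Finset.mul_sum]
  refine Finset.sum_congr rfl fun m hm => ?_
  have hm' := Nat.dvd_of_mem_divisors hm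
  have hgcd : Nat.gcd (p ^ j * m) (p ^ i * s) = p ^ min i j * Nat.gcd m s := by
    have hmp : Nat.Coprime m (p ^ i) := ((hpM.coprime_dvd_right hm').symm).pow_right i
    rw [Nat.Coprime.gcd_mul _ (hps.pow_left i), Nat.Coprime.gcd_mul_right_cancel _ hmp,
      Nat.Coprime.gcd_mul_left_cancel _ (hps.pow_left j), min_comm]
    congr 1
    rcases le_total j i with h | h
    · rw [Nat.gcd_eq_left (pow_dvd_pow p h), min_eq_left h]
    · rw [Nat.gcd_eq_right (pow_dvd_pow p h), min_eq_right h]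
  rw [hgcd, powKernel, powSlice, if_pos hm']
  push_cast
  rw [mul_pow, ← pow_mul, mul_comm 2, mul_div_mul_comm]
  ring

/-- Passing from level `p ^ n * M` to the slices of level `M` at the prime `p`. -/
lemma ordSum_powSlice_bounds {p M n : ℕ} (hp : p.Prime) (hM : 0 < M) (hpM : p.Coprime M)
    {X : ℕ → ℤ} (hX : ∀ t, 0 ≤ ordSum (p ^ n * M) X t) (t : ℕ) :
    0 ≤ ∑ j ∈ range (n + 1), ordSum M (powSlice p M X j) t ∧
      (5 ≤ p → ∀ j ∈ range (n + 1), 0 ≤ 16 * ordSum M (powSlice p M X j) t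
        + 5 * ∑ k ∈ range (n + 1), ordSum M (powSlice p M X k) t) := by
  have h := sum_nonneg_of_powKernel_nonneg (p := p) (by exact_mod_cast hp.one_lt) n
    (fun j => ordSum M (powSlice p M X j) (Nat.gcd t M)) fun i => by
      rw [← ordSum_prime_pow_mul hp hM hpM (hpM.coprime_dvd_right (Nat.gcd_dvd_right t M))]
      exact hX _
  simp only [ordSum_gcd_right] at h
  exact ⟨h.1, fun hp5 => h.2 (by exact_mod_cast hp5)⟩

/-- Splitting off the full power of a prime divisor. -/
lemma exists_eq_prime_pow_mul_lt {N p : ℕ} (hN : 0 < N) (hp : p.Prime) (hpN : p ∣ N) :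
    ∃ n M, 0 < M ∧ p.Coprime M ∧ M < N ∧ N = p ^ n * M := by
  obtain ⟨n, M, hpM, rfl⟩ := Nat.exists_eq_pow_mul_and_not_dvd hN.ne' p hp.ne_one
  have hM : 0 < M := Nat.pos_of_mul_pos_left hN
  have hn : n ≠ 0 := by
    rintro rfl
    simp_all
  exact ⟨n, M, hM, hp.coprime_iff_not_dvd.2 hpM,
    (Nat.lt_mul_iff_one_lt_left hM).2 (Nat.one_lt_pow hn hp.one_lt), rfl⟩

/-- A holomorphic eta quotient has nonnegative weight. -/
lemma sum_nonneg_of_ordSum_nonneg {N : ℕ} (hN : 0 < N) {X : ℕ → ℤ}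
    (hX : ∀ t, 0 ≤ ordSum N X t) : 0 ≤ ∑ d ∈ N.divisors, X d := by
  induction N using Nat.strong_induction_on generalizing X with
  | _ N ih =>
    rcases Nat.eq_or_lt_of_le (Nat.succ_le_of_lt hN) with rfl | hN1
    · have := hX 1
      simp only [ordSum, Nat.divisors_one, Finset.sum_singleton] at this ⊢
      simpa using this
    · obtain ⟨p, hp, hpN⟩ := Nat.exists_prime_and_dvd hN1.ne'
      obtain ⟨n, M, hM, hcop, hlt, rfl⟩ := exists_eq_prime_pow_mul_lt hN hp hpN
      rw [← sum_sum_powSlice hp hM hcop, Finset.sum_comm]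
      refine ih M hlt hM (X := fun m => ∑ j ∈ range (n + 1), powSlice p M X j m) fun t => ?_
      rw [ordSum_sum]
      exact (ordSum_powSlice_bounds hp hM hcop hX t).1

/-- The eta quotient `η^X` is `z ↦ f (r * z)` for some `f` of Zagier's list. -/
def IsScaledZagier (r : ℕ) (X : ℕ → ℤ) : Prop :=
  (∃ Y ∈ zagierList, ∀ d, X (r * d) = Y d) ∧ ∀ d, ¬ r ∣ d → X d = 0

lemma suppIn_twelve_of_mem_zagierList {Y : ℕ → ℤ} (hY : Y ∈ zagierList) : SuppIn 12 Y := by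
  intro d hd
  have h (e : ℕ) (he : e ∣ 12) : d ≠ e := fun h => hd (h ▸ he)
  simp only [zagierList, List.mem_cons, List.not_mem_nil, or_false] at hY
  rcases hY with rfl | rfl | rfl | rfl | rfl | rfl | rfl | rfl | rfl | rfl | rfl | rfl | rfl | rfl <;>
    simp [zvec, h 1 (by decide), h 2 (by decide), h 3 (by decide), h 4 (by decide),
      h 6 (by decide), h 12 (by decide)]

lemma not_three_dvd_apply_one_of_mem_zagierList : ∀ Y ∈ zagierList, ¬ (3 : ℤ) ∣ Y 1 := by
  decide

/-- Congruent members of Zagier's list are equal, unless extrapolating the line through them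
beyond the second one leads out of the cone of holomorphic eta quotients. -/
lemma eq_of_mem_zagierList_of_modEq_three : ∀ Y ∈ zagierList, ∀ Z ∈ zagierList,
    (∀ d ∈ Nat.divisors 12, Y d % 3 = Z d % 3) →
    0 ≤ 12 * (16 * Z 1 - Y 1) + 6 * (16 * Z 2 - Y 2) + 4 * (16 * Z 3 - Y 3)
      + 3 * (16 * Z 4 - Y 4) + 2 * (16 * Z 6 - Y 6) + (16 * Z 12 - Y 12) →
    0 ≤ 12 * (16 * Z 1 - Y 1) + 24 * (16 * Z 2 - Y 2) + 4 * (16 * Z 3 - Y 3)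
      + 12 * (16 * Z 4 - Y 4) + 8 * (16 * Z 6 - Y 6) + 4 * (16 * Z 12 - Y 12) →
    ∀ d ∈ Nat.divisors 12, Y d = Z d := by
  decide

lemma ordSum_scale {M r K : ℕ} (hM : 0 < M) (hr : 0 < r) (hK : 0 < K) {V : ℕ → ℤ}
    (hV : SuppIn M V) (hVr : ∀ d, ¬ r ∣ d → V d = 0) (hVK : SuppIn K fun e => V (r * e)) (t : ℕ) :
    ordSum M V (r * t) = r * ordSum K (fun e => V (r * e)) t := by
  have hinj : Set.InjOn (fun e => r * e) (K.divisors : Set ℕ) :=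
    fun a _ b _ h => Nat.eq_of_mul_eq_mul_left hr h
  have hsub (f : ℕ → ℚ) : ∑ d ∈ M.divisors, f d * V d
      = ∑ d ∈ K.divisors.image (fun e => r * e), f d * V d := by
    rw [← finsum_eq_sum_of_support_subset, ← finsum_eq_sum_of_support_subset]
    · intro d hd
      have hd' : V d ≠ 0 := by
        rintro h
        simp [h] at hd
      obtain ⟨e, rfl⟩ := not_imp_comm.1 (hVr d) hd'
      exact Finset.mem_coe.2 (Finset.mem_image.2
        ⟨e, Nat.mem_divisors.2 ⟨not_imp_comm.1 (hVK e) hd', hK.ne'⟩, rfl⟩)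
    · intro d hd
      have hd' : V d ≠ 0 := by
        rintro h
        simp [h] at hd
      exact Finset.mem_coe.2 (Nat.mem_divisors.2 ⟨not_imp_comm.1 (hV d) hd', hM.ne'⟩)
  rw [ordSum, hsub fun d => (Nat.gcd d (r * t) : ℚ) ^ 2 / d, Finset.sum_image hinj, ordSum,
    Finset.mul_sum]
  refine Finset.sum_congr rfl fun e _ => ?_
  rw [Nat.gcd_mul_left]
  push_cast
  field_simp

/-- If `η^T` and `η^(T + 3 W)` are rescaled members of Zagier's list and the orders of `η^W` are at
least `-5/16` times those of `η^T`, then `W = 0`. -/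
lemma eq_zero_of_isScaledZagier {M r s : ℕ} (hM : 0 < M) (hr : 0 < r) (hs : 0 < s)
    {T W : ℕ → ℤ} (hTM : SuppIn M T) (hWM : SuppIn M W) (hT : IsScaledZagier r T)
    (hTW : IsScaledZagier s fun d => 1 * T d + 3 * W d)
    (hol : ∀ t, 0 ≤ 16 * ordSum M W t + 5 * ordSum M T t) (d : ℕ) : W d = 0 := by
  obtain ⟨⟨Y, hY, hTY⟩, hTr⟩ := hT
  obtain ⟨⟨Z, hZ, hTZ⟩, hTs⟩ := hTW
  have hsr : s ∣ r := by
    by_contra h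
    have h1 := hTs r h
    have h2 := hTY 1
    rw [mul_one] at h2
    exact not_three_dvd_apply_one_of_mem_zagierList Y hY ⟨-W r, by lia⟩
  have hrs : r ∣ s := by
    by_contra h
    have h1 := hTr s h
    have h2 := hTZ 1
    simp only [mul_one] at h2
    exact not_three_dvd_apply_one_of_mem_zagierList Z hZ ⟨W s, by lia⟩
  obtain rfl := Nat.dvd_antisymm hsr hrs
  have hWr (e : ℕ) (he : ¬ s ∣ e) : W e = 0 := by
    have h1 := hTs e he
    have h2 := hTr e he
    lia
  have hV (t : ℕ) : 0 ≤ ordSum 12 (fun e => 16 * Z e + (-1) * Y e) t := by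
    have heq : (fun e => 15 * T (s * e) + 48 * W (s * e)) = fun e => 16 * Z e + (-1) * Y e := by
      funext e
      have h1 := hTY e
      have h2 := hTZ e
      simp only at h2
      lia
    have hscale := ordSum_scale (V := fun d => 15 * T d + 48 * W d) (K := 12) hM hs (by norm_num)
      (fun d hd => by simp [hTM d hd, hWM d hd]) (fun d hd => by simp [hTr d hd, hWr d hd])
      (by
        rw [heq]
        intro e he
        simp [suppIn_twelve_of_mem_zagierList hY e he, suppIn_twelve_of_mem_zagierList hZ e he]) t
    rw [heq, ordSum_linear M] at hscale
    have := hol (s * t)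
    refine nonneg_of_mul_nonneg_right (a := (s : ℚ)) ?_ (by exact_mod_cast hs)
    rw [← hscale]
    push_cast
    linarith
  have hdiv : Nat.divisors 12 = {1, 2, 3, 4, 6, 12} := by decide
  have hYZ : ∀ e ∈ Nat.divisors 12, Y e = Z e := by
    refine eq_of_mem_zagierList_of_modEq_three Y hY Z hZ (fun e _ => ?_) ?_ ?_
    · have h1 := hTY e
      have h2 := hTZ e
      simp only at h2
      lia
    · have := hV 1
      simp only [ordSum, hdiv] at this
      simp at this
      qify
      linarith
    · have := hV 2
      simp only [ordSum, hdiv] at this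
      simp [show Nat.gcd 4 2 = 2 by rfl, show Nat.gcd 6 2 = 2 by rfl,
        show Nat.gcd 12 2 = 2 by rfl, show Nat.gcd 3 2 = 1 by rfl] at this
      qify
      linarith
  by_cases hd : s ∣ d
  · obtain ⟨e, rfl⟩ := hd
    have h1 := hTY e
    have h2 := hTZ e
    have h3 : Y e = Z e := by
      by_cases he : e ∣ 12
      · exact hYZ e (Nat.mem_divisors.2 ⟨he, by norm_num⟩)
      · rw [suppIn_twelve_of_mem_zagierList hY e he, suppIn_twelve_of_mem_zagierList hZ e he]
    simp only at h2
    lia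
  · exact hWr d hd

/-- If every holomorphic eta quotient of weight `1/2` on `Γ₀(M)` is a rescaled member of Zagier's
list, then the same holds on `Γ₀(p ^ n * M)` for primes `5 ≤ p`. -/
lemma isScaledZagier_prime_pow_mul {p M n : ℕ} (hp : p.Prime) (hp5 : 5 ≤ p) (hM : 0 < M)
    (hpM : p.Coprime M)
    (hlist : ∀ X : ℕ → ℤ, SuppIn M X → ∑ d ∈ M.divisors, X d = 1 → (∀ t, 0 ≤ ordSum M X t) →
      ∃ r, 0 < r ∧ IsScaledZagier r X)
    {X : ℕ → ℤ} (hXs : SuppIn (p ^ n * M) X) (hX1 : ∑ d ∈ (p ^ n * M).divisors, X d = 1)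
    (hX : ∀ t, 0 ≤ ordSum (p ^ n * M) X t) : ∃ r, 0 < r ∧ IsScaledZagier r X := by
  set U := powSlice p M X with hU
  set T : ℕ → ℤ := fun m => ∑ j ∈ range (n + 1), U j m with hT
  have hUM (j : ℕ) : SuppIn M (U j) := suppIn_powSlice p M X j
  have hTM : SuppIn M T := fun d hd => Finset.sum_eq_zero fun j _ => hUM j d hd
  have hbounds (t : ℕ) := ordSum_powSlice_bounds hp hM hpM hX t
  simp only [← hU, ← ordSum_sum] at hbounds
  have hT0 (t : ℕ) : 0 ≤ ordSum M T t := (hbounds t).1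
  have hUT (j : ℕ) (hj : j ∈ range (n + 1)) (t : ℕ) :
      0 ≤ 16 * ordSum M (U j) t + 5 * ordSum M T t := (hbounds t).2 hp5 j hj
  have hsumU : ∑ j ∈ range (n + 1), ∑ m ∈ M.divisors, U j m = 1 := by
    rw [hU, sum_sum_powSlice hp hM hpM, hX1]
  have hT1 : ∑ m ∈ M.divisors, T m = 1 := by rw [← hsumU, Finset.sum_comm]
  have hU0 (j : ℕ) (hj : j ∈ range (n + 1)) : 0 ≤ ∑ m ∈ M.divisors, U j m := by
    have := sum_nonneg_of_ordSum_nonneg hM (X := fun m => 16 * U j m + 5 * T m) fun t => by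
      rw [ordSum_linear]
      exact_mod_cast hUT j hj t
    rw [Finset.sum_add_distrib, ← Finset.mul_sum, ← Finset.mul_sum, hT1] at this
    lia
  obtain ⟨r, hr, hTr⟩ := hlist T hTM hT1 hT0
  have hvanish (j : ℕ) (hj : j ∈ range (n + 1)) (hj0 : ∑ m ∈ M.divisors, U j m = 0) (m : ℕ) :
      U j m = 0 := by
    obtain ⟨s, hs, hTs⟩ := hlist (fun m => 1 * T m + 3 * U j m)
      (fun d hd => by simp [hTM d hd, hUM j d hd])
      (by rw [Finset.sum_add_distrib, ← Finset.mul_sum, ← Finset.mul_sum, hT1, hj0]; rfl)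
      (fun t => by
        rw [ordSum_linear]
        have h1 := hUT j hj t
        have h2 := hT0 t
        push_cast
        linarith)
    exact eq_zero_of_isScaledZagier hM hr hs hTM (hUM j) hTr hTs (hUT j hj) m
  obtain ⟨k, hk, hk0⟩ : ∃ k ∈ range (n + 1), ∑ m ∈ M.divisors, U k m ≠ 0 :=
    Finset.exists_ne_zero_of_sum_ne_zero (hsumU ▸ one_ne_zero)
  have hothers (j : ℕ) (hj : j ∈ range (n + 1)) (hjk : j ≠ k) (m : ℕ) : U j m = 0 := by
    refine hvanish j hj ?_ m
    have hle : ∑ i ∈ {j, k}, ∑ m ∈ M.divisors, U i m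
        ≤ ∑ i ∈ range (n + 1), ∑ m ∈ M.divisors, U i m :=
      Finset.sum_le_sum_of_subset_of_nonneg (by simp [Finset.insert_subset_iff, hj, hk, -mem_range])
        fun i hi _ => hU0 i hi
    rw [Finset.sum_pair hjk, hsumU] at hle
    have h1 := hU0 j hj
    have h2 := hU0 k hk
    lia
  have hTk (m : ℕ) : T m = U k m :=
    Finset.sum_eq_single_of_mem k hk fun j hj hjk => hothers j hj hjk m
  have hXsupp (d : ℕ) (hd : X d ≠ 0) : ∃ m, m ∣ M ∧ d = p ^ k * m := by
    obtain ⟨a, m, ha, hm, rfl⟩ := exists_dvd_and_dvd_of_dvd_mul (not_imp_comm.1 (hXs d) hd)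
    obtain ⟨j, hj, rfl⟩ := (Nat.dvd_prime_pow hp).1 ha
    rcases eq_or_ne j k with rfl | hjk
    · exact ⟨m, hm, rfl⟩
    · have := hothers j (Finset.mem_range.2 (by lia)) hjk m
      rw [hU, powSlice, if_pos hm] at this
      exact absurd this hd
  have hXT (m : ℕ) : X (p ^ k * m) = T m := by
    rw [hTk, hU, powSlice]
    split_ifs with hm
    · rfl
    · by_contra h
      obtain ⟨m', hm', heq⟩ := hXsupp _ h
      exact hm (Nat.eq_of_mul_eq_mul_left (pow_pos hp.pos k) heq ▸ hm')
  obtain ⟨⟨Y, hY, hTY⟩, hTr⟩ := hTr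
  refine ⟨p ^ k * r, Nat.mul_pos (pow_pos hp.pos k) hr, ⟨Y, hY, fun d => ?_⟩, fun d hd => ?_⟩
  · rw [mul_assoc, hXT, hTY]
  · by_contra h
    obtain ⟨m, hm, rfl⟩ := hXsupp d h
    rw [hXT] at h
    exact hd (mul_dvd_mul_left _ (not_imp_comm.1 (hTr m) h))

/-- The classification of primitive eta quotients of exact level `L` for `L ∣ N` yields the one of
all eta quotients on `Γ₀(N)`. -/
lemma isScaledZagier_of_primitive {N : ℕ} (hN : 0 < N)
    (hprim : ∀ L, L ∣ N → ∀ X : ℕ → ℤ, SuppIn L X → (∑ d ∈ L.divisors, X d = 1) →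
      etaLevel L X = L → IsPrimitiveEta L X → IsHolEta L X → IsOnZagierList X)
    {X : ℕ → ℤ} (hXs : SuppIn N X) (hX1 : ∑ d ∈ N.divisors, X d = 1)
    (hX : ∀ t, 0 ≤ ordSum N X t) : ∃ r, 0 < r ∧ IsScaledZagier r X := by
  set S := N.divisors.filter fun d => X d ≠ 0 with hS
  have hmemS (d : ℕ) : d ∈ S ↔ X d ≠ 0 := by
    rw [hS, Finset.mem_filter, Nat.mem_divisors]
    exact ⟨fun h => h.2, fun h => ⟨⟨not_imp_comm.1 (hXs d) h, hN.ne'⟩, h⟩⟩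
  obtain ⟨a, haN, ha⟩ : ∃ a ∈ N.divisors, X a ≠ 0 :=
    Finset.exists_ne_zero_of_sum_ne_zero (hX1 ▸ one_ne_zero)
  set r := S.gcd id with hr
  have hrdvd (d : ℕ) (hd : X d ≠ 0) : r ∣ d := Finset.gcd_dvd ((hmemS d).2 hd)
  have hr0 : 0 < r := Nat.pos_of_dvd_of_pos (hrdvd a ha) (Nat.pos_of_mem_divisors haN)
  set Z : ℕ → ℤ := fun e => X (r * e) with hZ
  set R := N.divisors.filter fun e => Z e ≠ 0 with hR
  have hmemR (e : ℕ) : e ∈ R ↔ Z e ≠ 0 := by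
    rw [hR, Finset.mem_filter, Nat.mem_divisors]
    exact ⟨fun h => h.2, fun h =>
      ⟨⟨dvd_trans (dvd_mul_left e r) (not_imp_comm.1 (hXs _) h), hN.ne'⟩, h⟩⟩
  set L := R.lcm id with hL
  have hLN : L ∣ N := Finset.lcm_dvd fun e he =>
    Nat.dvd_of_mem_divisors (Finset.mem_of_mem_filter e he)
  have hL0 : 0 < L := Nat.pos_of_dvd_of_pos hLN hN
  have hZL : SuppIn L Z := fun d hd => by
    by_contra h
    exact hd (Finset.dvd_lcm ((hmemR d).2 h))
  have hfilter : (L.divisors.filter fun e => Z e ≠ 0) = R := by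
    ext e
    rw [hmemR, Finset.mem_filter, Nat.mem_divisors]
    exact ⟨fun h => h.2, fun h => ⟨⟨not_imp_comm.1 (hZL e) h, hL0.ne'⟩, h⟩⟩
  have himage : S = R.image fun e => r * e := by
    ext d
    rw [hmemS, Finset.mem_image]
    constructor
    · intro h
      obtain ⟨e, rfl⟩ := hrdvd d h
      exact ⟨e, (hmemR e).2 h, rfl⟩
    · rintro ⟨e, he, rfl⟩
      exact (hmemR e).1 he
  have hinj : Set.InjOn (fun e => r * e) (R : Set ℕ) :=
    fun a _ b _ h => Nat.eq_of_mul_eq_mul_left hr0 h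
  have hsum : ∑ d ∈ L.divisors, Z d = 1 := by
    rw [← Finset.sum_filter_ne_zero, hfilter, ← hX1, ← Finset.sum_filter_ne_zero N.divisors, ← hS,
      himage, Finset.sum_image hinj]
  have hgcd : R.gcd id = 1 := by
    have h : r = r * R.gcd id := by
      conv_lhs => rw [hr, himage, Finset.gcd_image]
      exact (Finset.gcd_mul_left (f := id)).trans (by rw [normalize_eq])
    exact Nat.eq_of_mul_eq_mul_left hr0 (by rw [← h, mul_one])
  have hhol : IsHolEta L Z := by
    rw [isHolEta_iff_ordSum_nonneg hL0]
    intro t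
    have h := ordSum_scale hN hr0 hL0 hXs (fun d hd => not_imp_comm.1 (hrdvd d) hd) hZL t
    refine nonneg_of_mul_nonneg_right (a := (r : ℚ)) ?_ (by exact_mod_cast hr0)
    exact h ▸ hX _
  obtain ⟨Y, hY, hZY⟩ := hprim L hLN Z hZL hsum (by rw [etaLevel, hfilter])
    (by rw [IsPrimitiveEta, hfilter, hgcd]) hhol
  exact ⟨r, hr0, ⟨Y, hY, hZY⟩, fun d hd => not_imp_comm.1 (hrdvd d) hd⟩

/-- Reduction to 3-smooth levels: if for every 3-smooth `N` the only primitive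
holomorphic eta quotients of weight `1/2` and level `N` are those of Zagier's list,
then the same is true for all levels `N`. -/
theorem zagier_list_reduction_to_three_smooth
    (hsmooth : ∀ N : ℕ, 0 < N → (∀ p : ℕ, p.Prime → p ∣ N → p ≤ 3) →
      ∀ X : ℕ → ℤ, SuppIn N X → (∑ d ∈ N.divisors, X d = 1) → etaLevel N X = N →
        IsPrimitiveEta N X → IsHolEta N X → IsOnZagierList X) :
    ∀ N : ℕ, 0 < N →
      ∀ X : ℕ → ℤ, SuppIn N X → (∑ d ∈ N.divisors, X d = 1) → etaLevel N X = N →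
        IsPrimitiveEta N X → IsHolEta N X → IsOnZagierList X := by
  have hscaled (N : ℕ) (hN : 0 < N) : ∀ X : ℕ → ℤ, SuppIn N X → ∑ d ∈ N.divisors, X d = 1 →
      (∀ t, 0 ≤ ordSum N X t) → ∃ r, 0 < r ∧ IsScaledZagier r X := by
    induction N using Nat.strong_induction_on with
    | _ N ih =>
      by_cases hsm : ∀ p : ℕ, p.Prime → p ∣ N → p ≤ 3
      · exact fun X => isScaledZagier_of_primitive hN fun L hL =>
          hsmooth L (Nat.pos_of_dvd_of_pos hL hN) fun p hp hpL => hsm p hp (hpL.trans hL)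
      · push Not at hsm
        obtain ⟨p, hp, hpN, hp3⟩ := hsm
        have hp5 : 5 ≤ p := by
          by_contra h
          obtain rfl : p = 4 := by lia
          exact absurd hp (by decide)
        obtain ⟨n, M, hM, hpM, hlt, rfl⟩ := exists_eq_prime_pow_mul_lt hN hp hpN
        exact fun X => isScaledZagier_prime_pow_mul hp hp5 hM hpM (ih M hlt hM)
  intro N hN X hXs hX1 _ hprim hhol
  obtain ⟨r, -, ⟨Y, hY, hXY⟩, hXr⟩ :=
    hscaled N hN X hXs hX1 ((isHolEta_iff_ordSum_nonneg hN X).1 hhol)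
  have hr : r ∣ 1 := by
    rw [← show _ = 1 from hprim]
    exact Finset.dvd_gcd fun d hd => not_imp_comm.1 (hXr d) (Finset.mem_filter.1 hd).2
  obtain rfl := Nat.dvd_one.1 hr
  exact ⟨Y, hY, fun d => by rw [← hXY d, one_mul]⟩
end

section
/- Let N be an odd positive integer and suppose there exists a simple holomorphic eta quotient of level N. Then there exist at least two distinct simple holomorphic eta quotients of level 2N and at least three distinct simple holomorphic eta quotients of level 4N. Moreover, if additionally 3 ∤ N, then there exist at least four distinct simple holomorphic eta quotients of level 6N and at least four distinct simple holomorphic eta quotients of level 12N, all of the same weight as the given one. -/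
open Finset

/-- The eta quotient `η^X` is factorizable on `Γ₀(M)`: it is the product of two
nonconstant holomorphic eta quotients on `Γ₀(M)`. -/
def FactorizableOn (M : ℕ) (X : ℕ → ℤ) : Prop :=
  ∃ G H : ℕ → ℤ, SuppIn M G ∧ SuppIn M H ∧
    (∃ d ∈ M.divisors, G d ≠ 0) ∧ (∃ d ∈ M.divisors, H d ≠ 0) ∧
    IsHolEta M G ∧ IsHolEta M H ∧ (∀ d : ℕ, X d = G d + H d)

/-- `η^X` is a simple holomorphic eta quotient of level `N`: it is holomorphic of
level exactly `N`, primitive, and quasi-irreducible (not factorizable on `Γ₀(N)`). -/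
def SimpleEta (N : ℕ) (X : ℕ → ℤ) : Prop :=
  SuppIn N X ∧ IsHolEta N X ∧ etaLevel N X = N ∧
    IsPrimitiveEta N X ∧ ¬ FactorizableOn N X

/-- The form `∑_{d ∣ N} gcd(d,t)² / d · X_d`, a positive multiple of the order at `1/t`. -/
def gcdForm (N : ℕ) (X : ℕ → ℤ) (t : ℕ) : ℚ :=
  ∑ d ∈ N.divisors, (Nat.gcd d t : ℚ) ^ 2 / d * X d

theorem gcdForm_gcd_right (N : ℕ) (X : ℕ → ℤ) (t : ℕ) :
    gcdForm N X (t.gcd N) = gcdForm N X t := by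
  refine Finset.sum_congr rfl fun d hd => ?_
  rw [Nat.gcd_comm t, ← Nat.gcd_assoc, Nat.gcd_eq_left (Nat.dvd_of_mem_divisors hd)]

theorem etaOrd_eq_gcdForm (N : ℕ) (X : ℕ → ℤ) (t : ℕ) :
    etaOrd N X t = (N : ℚ) / Nat.gcd (t ^ 2) N * gcdForm N X t := by
  rw [etaOrd, gcdForm, Finset.mul_sum]
  refine Finset.sum_congr rfl fun d _ => ?_
  rw [← mul_assoc, div_mul_div_comm, mul_comm (d : ℚ)]

theorem isHolEta_iff {N : ℕ} (hN : 0 < N) (X : ℕ → ℤ) :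
    IsHolEta N X ↔ ∀ t, 0 ≤ gcdForm N X t := by
  have key (t : ℕ) : 0 < (N : ℚ) / Nat.gcd (t ^ 2) N := by
    have := Nat.gcd_pos_of_pos_right (t ^ 2) hN
    positivity
  constructor
  · intro h t
    have ht := h (t.gcd N) (Nat.mem_divisors.2 ⟨Nat.gcd_dvd_right _ _, hN.ne'⟩)
    rw [etaOrd_eq_gcdForm, gcdForm_gcd_right] at ht
    exact nonneg_of_mul_nonneg_right ht (key _)
  · intro h t _
    rw [etaOrd_eq_gcdForm]
    exact mul_nonneg (key t).le (h t)

theorem gcdForm_add (N : ℕ) (X Y : ℕ → ℤ) (t : ℕ) :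
    gcdForm N (X + Y) t = gcdForm N X t + gcdForm N Y t := by
  simp only [gcdForm, Pi.add_apply, Int.cast_add, mul_add, Finset.sum_add_distrib]

theorem gcdForm_smul (N : ℕ) (k : ℤ) (X : ℕ → ℤ) (t : ℕ) :
    gcdForm N (k • X) t = k * gcdForm N X t := by
  simp only [gcdForm, Finset.mul_sum, Pi.smul_apply, smul_eq_mul, Int.cast_mul]
  exact Finset.sum_congr rfl fun d _ => by ring

theorem gcdForm_sum {ι : Type*} (N : ℕ) (s : Finset ι) (X : ι → ℕ → ℤ) (t : ℕ) :
    gcdForm N (∑ i ∈ s, X i) t = ∑ i ∈ s, gcdForm N (X i) t := by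
  simp only [gcdForm, Finset.sum_apply, Int.cast_sum, Finset.mul_sum]
  exact Finset.sum_comm

/-- The matrix `gcd(d,t)²` on the divisors of `N` has trivial kernel: its quadratic form is
`∑_{e,f} φ(e) φ(f) (∑_{e,f ∣ d} x_d)²`. -/
theorem eq_zero_of_sum_gcd_sq_eq_zero {N : ℕ} (x : ℕ → ℚ)
    (h : ∀ t ∈ N.divisors, ∑ d ∈ N.divisors, (Nat.gcd d t : ℚ) ^ 2 * x d = 0) :
    ∀ d ∈ N.divisors, x d = 0 := by
  rcases Nat.eq_zero_or_pos N with rfl | hN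
  · simp
  let P : ℕ → ℕ → ℚ := fun e d => if e ∣ d then 1 else 0
  have hgcd : ∀ d ∈ N.divisors, ∀ t, (Nat.gcd d t : ℚ)
      = ∑ e ∈ N.divisors, (e.totient : ℚ) * (P e d * P e t) := by
    intro d hd t
    rw [← Nat.sum_totient (Nat.gcd d t), Nat.cast_sum,
      ← Finset.sum_subset (Nat.divisors_subset_of_dvd hN.ne'
        ((Nat.gcd_dvd_left d t).trans (Nat.dvd_of_mem_divisors hd)))]
    · refine Finset.sum_congr rfl fun e he => ?_
      have := Nat.dvd_gcd_iff.1 (Nat.dvd_of_mem_divisors he)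
      simp [P, this.1, this.2]
    · intro e _ he
      have hg : Nat.gcd d t ≠ 0 :=
        (Nat.gcd_pos_of_pos_left t (Nat.pos_of_mem_divisors hd)).ne'
      have : ¬ (e ∣ d ∧ e ∣ t) := fun h => he (Nat.mem_divisors.2 ⟨Nat.dvd_gcd h.1 h.2, hg⟩)
      by_cases h1 : e ∣ d
      · have h2 : ¬ e ∣ t := fun h2 => this ⟨h1, h2⟩
        simp [P, h2]
      · simp [P, h1]
  have hquad : ∑ e ∈ N.divisors, ∑ f ∈ N.divisors, (e.totient : ℚ) * f.totient *
      (∑ d ∈ N.divisors, P e d * P f d * x d) ^ 2 = 0 := by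
    have h0 : ∑ t ∈ N.divisors, x t * ∑ d ∈ N.divisors, (Nat.gcd d t : ℚ) ^ 2 * x d = 0 :=
      Finset.sum_eq_zero fun t ht => by rw [h t ht, mul_zero]
    rw [← h0]
    symm
    have h1 : ∀ t ∈ N.divisors, x t * ∑ d ∈ N.divisors, (Nat.gcd d t : ℚ) ^ 2 * x d =
        ∑ e ∈ N.divisors, ∑ f ∈ N.divisors, ∑ d ∈ N.divisors, (e.totient : ℚ) * f.totient *
          ((P e d * P f d * x d) * (P e t * P f t * x t)) := by
      intro t _
      rw [Finset.mul_sum]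
      have h2 : ∀ d ∈ N.divisors, x t * ((Nat.gcd d t : ℚ) ^ 2 * x d) =
          ∑ e ∈ N.divisors, ∑ f ∈ N.divisors, (e.totient : ℚ) * f.totient *
          ((P e d * P f d * x d) * (P e t * P f t * x t)) := by
        intro d hd
        rw [hgcd d hd t, sq, Finset.sum_mul_sum, Finset.sum_mul, Finset.mul_sum]
        refine Finset.sum_congr rfl fun e _ => ?_
        rw [Finset.sum_mul, Finset.mul_sum]
        exact Finset.sum_congr rfl fun f _ => by ring
      rw [Finset.sum_congr rfl h2, Finset.sum_comm]
      exact Finset.sum_congr rfl fun e _ => Finset.sum_comm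
    rw [Finset.sum_congr rfl h1, Finset.sum_comm]
    refine Finset.sum_congr rfl fun e _ => ?_
    rw [Finset.sum_comm]
    refine Finset.sum_congr rfl fun f _ => ?_
    rw [Finset.sum_comm, sq, Finset.sum_mul_sum, Finset.mul_sum]
    exact Finset.sum_congr rfl fun d _ => (Finset.mul_sum _ _ _).symm
  have hzero : ∀ e ∈ N.divisors, ∑ d ∈ N.divisors, P e d * x d = 0 := by
    intro e he
    have h1 := (Finset.sum_eq_zero_iff_of_nonneg fun e _ =>
      Finset.sum_nonneg fun f _ => by positivity).1 hquad e he
    have h2 := (Finset.sum_eq_zero_iff_of_nonneg fun f _ => by positivity).1 h1 e he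
    have h3 : (e.totient : ℚ) ≠ 0 :=
      Nat.cast_ne_zero.2 (Nat.totient_pos.2 (Nat.pos_of_mem_divisors he)).ne'
    have h4 : ∑ d ∈ N.divisors, P e d * P e d * x d = 0 := by simpa [h3] using h2
    rw [← h4]
    refine Finset.sum_congr rfl fun d _ => ?_
    by_cases hed : e ∣ d <;> simp [P, hed]
  have hind : ∀ k d, d ∈ N.divisors → N - d ≤ k → x d = 0 := by
    intro k
    induction k with
    | zero =>
      intro d hd hk
      have hdN : d = N := le_antisymm (Nat.divisor_le hd) (by omega)
      subst hdN
      rw [← hzero d hd, Finset.sum_eq_single d]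
      · simp [P]
      · intro b hb hbd
        have : ¬ d ∣ b := fun hdb => hbd (Nat.dvd_antisymm (Nat.dvd_of_mem_divisors hb) hdb)
        simp [P, this]
      · exact fun hd' => absurd hd hd'
    | succ k ih =>
      intro d hd hk
      rw [← hzero d hd, Finset.sum_eq_single d]
      · simp [P]
      · intro b hb hbd
        by_cases hdb : d ∣ b
        · have hlt : d < b :=
            lt_of_le_of_ne (Nat.le_of_dvd (Nat.pos_of_mem_divisors hb) hdb) (Ne.symm hbd)
          have hbN := Nat.divisor_le hb
          rw [ih b hb (by omega), mul_zero]
        · simp [P, hdb]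
      · exact fun hd' => absurd hd hd'
  exact fun d hd => hind _ d hd le_rfl

theorem eq_zero_of_gcdForm_eq_zero {N : ℕ} (hN : 0 < N) {X : ℕ → ℤ} (hs : SuppIn N X)
    (h : ∀ t, gcdForm N X t = 0) : X = 0 := by
  funext d
  by_cases hd : d ∣ N
  · have hd' := Nat.mem_divisors.2 ⟨hd, hN.ne'⟩
    have hx := eq_zero_of_sum_gcd_sq_eq_zero (N := N) (fun d => (X d : ℚ) / d)
      (fun t _ => by
        rw [← h t, gcdForm]
        exact Finset.sum_congr rfl fun d _ => by ring) d hd'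
    have hd0 : (d : ℚ) ≠ 0 := Nat.cast_ne_zero.2 (Nat.pos_of_mem_divisors hd').ne'
    simpa [hd0] using hx
  · exact hs d hd

/-- The holomorphic eta quotients on `Γ₀(N)`, as a monoid of exponent vectors. -/
def etaCone (N : ℕ) : AddSubmonoid (ℕ → ℤ) where
  carrier := {X | SuppIn N X ∧ ∀ t, 0 ≤ gcdForm N X t}
  zero_mem' := ⟨fun _ _ => rfl, fun t => by simp [gcdForm]⟩
  add_mem' := by
    rintro X Y ⟨hX, hX'⟩ ⟨hY, hY'⟩
    refine ⟨fun d hd => by simp [hX d hd, hY d hd], fun t => ?_⟩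
    rw [gcdForm_add]
    exact add_nonneg (hX' t) (hY' t)

theorem mem_etaCone {N : ℕ} (hN : 0 < N) {X : ℕ → ℤ} :
    X ∈ etaCone N ↔ SuppIn N X ∧ IsHolEta N X := by
  rw [isHolEta_iff hN]
  rfl

/-- A monoid of integer vectors that contains no line and is closed under exact division by
positive integers. -/
structure IsSaturatedPointed {ι : Type*} (C : AddSubmonoid (ι → ℤ)) : Prop where
  mem_of_smul_mem : ∀ (k : ℤ) (v : ι → ℤ), 0 < k → k • v ∈ C → v ∈ C
  eq_zero_of_neg_mem : ∀ v ∈ C, -v ∈ C → v = 0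

/-- A nonzero element of `C` which is not the sum of two nonzero elements of `C`. -/
structure IsIndecomposable {ι : Type*} (C : AddSubmonoid (ι → ℤ)) (x : ι → ℤ) : Prop where
  mem : x ∈ C
  ne_zero : x ≠ 0
  eq_zero_or : ∀ u ∈ C, ∀ v ∈ C, u + v = x → u = 0 ∨ v = 0

theorem isSaturatedPointed_etaCone {N : ℕ} (hN : 0 < N) : IsSaturatedPointed (etaCone N) where
  mem_of_smul_mem := by
    rintro k v hk ⟨hs, hp⟩
    refine ⟨fun d hd => ?_, fun t => ?_⟩
    · have := hs d hd
      simpa [hk.ne'] using this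
    · have := hp t
      rw [gcdForm_smul] at this
      exact nonneg_of_mul_nonneg_right this (Int.cast_pos.2 hk)
  eq_zero_of_neg_mem := by
    rintro v ⟨hs, hp⟩ ⟨_, hn⟩
    refine eq_zero_of_gcdForm_eq_zero hN hs fun t => le_antisymm ?_ (hp t)
    have := hn t
    rw [← neg_one_smul ℤ v, gcdForm_smul] at this
    push_cast at this
    linarith

theorem exists_ne_zero_of_ne_zero {N : ℕ} (hN : 0 < N) {X : ℕ → ℤ} (hs : SuppIn N X)
    (hX : X ≠ 0) : ∃ d ∈ N.divisors, X d ≠ 0 := by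
  obtain ⟨d, hd⟩ := Function.ne_iff.1 hX
  exact ⟨d, Nat.mem_divisors.2 ⟨not_not.1 fun h => hd (hs d h), hN.ne'⟩, hd⟩

theorem SimpleEta.isIndecomposable {N : ℕ} (hN : 0 < N) {X : ℕ → ℤ} (hX : SimpleEta N X) :
    IsIndecomposable (etaCone N) X where
  mem := (mem_etaCone hN).2 ⟨hX.1, hX.2.1⟩
  ne_zero := by
    rintro rfl
    have h := hX.2.2.2.1
    simp [IsPrimitiveEta] at h
  eq_zero_or := by
    intro u hu v hv huv
    by_contra! h
    rw [mem_etaCone hN] at hu hv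
    exact hX.2.2.2.2 ⟨u, v, hu.1, hv.1, exists_ne_zero_of_ne_zero hN hu.1 h.1,
      exists_ne_zero_of_ne_zero hN hv.1 h.2, hu.2, hv.2, fun d => (congrFun huv d).symm⟩

/-- The restriction of an exponent vector on `Γ₀(M N)` to the divisors `m e` with `e ∣ N`. -/
def etaSlice (N : ℕ) (G : ℕ → ℤ) (m e : ℕ) : ℤ :=
  if e ∣ N then G (m * e) else 0

/-- The exponent vector `m e ↦ Y_m X_e` on `Γ₀(M N)`, for `m ∣ M` and `e ∣ N`. -/
def etaTensor (M N : ℕ) (Y X : ℕ → ℤ) (d : ℕ) : ℤ :=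
  if d ∣ M * N then Y (d.gcd M) * X (d.gcd N) else 0

theorem etaTensor_mul {M N : ℕ} (hMN : M.Coprime N) (Y X : ℕ → ℤ) {m e : ℕ} (hm : m ∣ M)
    (he : e ∣ N) : etaTensor M N Y X (m * e) = Y m * X e := by
  have h1 : (m * e).gcd M = m := by
    rw [Nat.gcd_comm, Nat.Coprime.gcd_mul_right_cancel_right m (hMN.coprime_dvd_right he).symm,
      Nat.gcd_comm, Nat.gcd_eq_left hm]
  have h2 : (m * e).gcd N = e := by
    rw [Nat.gcd_comm, Nat.Coprime.gcd_mul_left_cancel_right e (hMN.coprime_dvd_left hm),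
      Nat.gcd_comm, Nat.gcd_eq_left he]
  rw [etaTensor, if_pos (Nat.mul_dvd_mul hm he), h1, h2]

theorem sum_divisors_mul_of_coprime_s11 {A : Type*} [AddCommMonoid A] {M N : ℕ} (hMN : M.Coprime N)
    (f : ℕ → A) :
    ∑ d ∈ (M * N).divisors, f d = ∑ m ∈ M.divisors, ∑ e ∈ N.divisors, f (m * e) := by
  rw [← Finset.sum_product', Nat.divisors_mul, Finset.mul_def, Finset.sum_image]
  intro p hp q hq hpq
  simp only [Finset.coe_product, Set.mem_prod, Finset.mem_coe, Nat.mem_divisors] at hp hq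
  replace hpq : p.1 * p.2 = q.1 * q.2 := hpq
  have h1 : p.1 = q.1 := Nat.dvd_antisymm
    (((hMN.coprime_dvd_left hp.1.1).coprime_dvd_right hq.2.1).dvd_of_dvd_mul_right
      (hpq ▸ Dvd.intro _ rfl : p.1 ∣ q.1 * q.2))
    (((hMN.coprime_dvd_left hq.1.1).coprime_dvd_right hp.2.1).dvd_of_dvd_mul_right
      (hpq ▸ Dvd.intro _ rfl : q.1 ∣ p.1 * p.2))
  have h2 : p.2 = q.2 := by
    have h0 : 0 < q.1 := Nat.pos_of_dvd_of_pos hq.1.1 (Nat.pos_of_ne_zero hq.1.2)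
    simp only [h1] at hpq
    exact Nat.eq_of_mul_eq_mul_left h0 hpq
  exact Prod.ext h1 h2

theorem sum_etaTensor {M N : ℕ} (hMN : M.Coprime N) (Y X : ℕ → ℤ) :
    ∑ d ∈ (M * N).divisors, etaTensor M N Y X d =
      (∑ m ∈ M.divisors, Y m) * ∑ e ∈ N.divisors, X e := by
  rw [sum_divisors_mul_of_coprime_s11 hMN, Finset.sum_mul_sum]
  exact Finset.sum_congr rfl fun m hm => Finset.sum_congr rfl fun e he =>
    etaTensor_mul hMN Y X (Nat.dvd_of_mem_divisors hm) (Nat.dvd_of_mem_divisors he)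

theorem gcdForm_mul {M N : ℕ} (hMN : M.Coprime N) (G : ℕ → ℤ) (t : ℕ) :
    gcdForm (M * N) G t =
      ∑ m ∈ M.divisors, (Nat.gcd m t : ℚ) ^ 2 / m * gcdForm N (etaSlice N G m) t := by
  rw [gcdForm, sum_divisors_mul_of_coprime_s11 hMN]
  refine Finset.sum_congr rfl fun m hm => ?_
  rw [gcdForm, Finset.mul_sum]
  refine Finset.sum_congr rfl fun e he => ?_
  have hm' := Nat.dvd_of_mem_divisors hm
  have he' := Nat.dvd_of_mem_divisors he
  have hg : (m * e).gcd t = m.gcd t * e.gcd t := by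
    rw [Nat.gcd_comm, Nat.Coprime.gcd_mul t ((hMN.coprime_dvd_left hm').coprime_dvd_right he'),
      Nat.gcd_comm t, Nat.gcd_comm t]
  rw [hg, etaSlice, if_pos he']
  push_cast
  rw [mul_pow, mul_div_mul_comm, mul_assoc]

theorem etaSlice_etaTensor {M N : ℕ} (hMN : M.Coprime N) (Y : ℕ → ℤ) {X : ℕ → ℤ}
    (hX : SuppIn N X) {m : ℕ} (hm : m ∣ M) :
    etaSlice N (etaTensor M N Y X) m = Y m • X := by
  funext e
  by_cases he : e ∣ N
  · simp [etaSlice, he, etaTensor_mul hMN Y X hm he]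
  · simp [etaSlice, he, hX e he]

theorem gcdForm_etaTensor {M N : ℕ} (hMN : M.Coprime N) (Y : ℕ → ℤ) {X : ℕ → ℤ}
    (hX : SuppIn N X) (t : ℕ) :
    gcdForm (M * N) (etaTensor M N Y X) t = gcdForm M Y t * gcdForm N X t := by
  rw [gcdForm_mul hMN, gcdForm, Finset.sum_mul]
  refine Finset.sum_congr rfl fun m hm => ?_
  rw [etaSlice_etaTensor hMN Y hX (Nat.dvd_of_mem_divisors hm), gcdForm_smul]
  ring

/-- The coefficients `M · gcd(m,s)² / m` of the cusp orders on `Γ₀(M)`, up to a positive scalar. -/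
def cuspCoeff (M s m : ℕ) : ℤ := ((M / m * m.gcd s ^ 2 : ℕ) : ℤ)

theorem cast_cuspCoeff {M m : ℕ} (hm : m ∈ M.divisors) (s : ℕ) :
    (cuspCoeff M s m : ℚ) = M * ((Nat.gcd m s : ℚ) ^ 2 / m) := by
  have hm0 : (m : ℚ) ≠ 0 := Nat.cast_ne_zero.2 (Nat.pos_of_mem_divisors hm).ne'
  rw [cuspCoeff, Int.cast_natCast, Nat.cast_mul, Nat.cast_div (Nat.dvd_of_mem_divisors hm) hm0]
  push_cast
  ring

theorem gcdForm_nonneg_of_cuspCoeff {M : ℕ} (hM : 0 < M) {Y : ℕ → ℤ}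
    (h : ∀ s ∈ M.divisors, 0 ≤ ∑ m ∈ M.divisors, cuspCoeff M s m * Y m) (t : ℕ) :
    0 ≤ gcdForm M Y t := by
  rw [← gcdForm_gcd_right]
  have h1 := h (t.gcd M) (Nat.mem_divisors.2 ⟨Nat.gcd_dvd_right _ _, hM.ne'⟩)
  have h2 : ((∑ m ∈ M.divisors, cuspCoeff M (t.gcd M) m * Y m : ℤ) : ℚ)
      = M * gcdForm M Y (t.gcd M) := by
    rw [gcdForm, Finset.mul_sum, Int.cast_sum]
    refine Finset.sum_congr rfl fun m hm => ?_
    rw [Int.cast_mul, cast_cuspCoeff hm, mul_assoc]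
  refine nonneg_of_mul_nonneg_right (a := (M : ℚ)) ?_ (by exact_mod_cast hM)
  rw [← h2]
  exact_mod_cast h1

theorem sum_cuspCoeff_smul_etaSlice_mem {M N : ℕ} (hMN : M.Coprime N) {G : ℕ → ℤ}
    (hG : G ∈ etaCone (M * N)) {s : ℕ} (hs : s ∣ M) :
    ∑ m ∈ M.divisors, cuspCoeff M s m • etaSlice N G m ∈ etaCone N := by
  refine ⟨fun d hd => ?_, fun t => ?_⟩
  · rw [Finset.sum_apply]
    exact Finset.sum_eq_zero fun m _ => by simp [etaSlice, hd]
  · rw [← gcdForm_gcd_right, gcdForm_sum]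
    have h := hG.2 (s * t.gcd N)
    rw [gcdForm_mul hMN] at h
    have h' := mul_nonneg (Nat.cast_nonneg M : (0 : ℚ) ≤ M) h
    rw [Finset.mul_sum] at h'
    refine h'.trans_eq (Finset.sum_congr rfl fun m hm => ?_)
    have hm' := Nat.dvd_of_mem_divisors hm
    have h1 : m.gcd (s * t.gcd N) = m.gcd s :=
      Nat.Coprime.gcd_mul_right_cancel_right s
        ((hMN.coprime_dvd_left hm').coprime_dvd_right (Nat.gcd_dvd_right _ _)).symm
    have h2 : gcdForm N (etaSlice N G m) (s * t.gcd N) =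
        gcdForm N (etaSlice N G m) (t.gcd N) := by
      refine Finset.sum_congr rfl fun e he => ?_
      rw [Nat.Coprime.gcd_mul_left_cancel_right (t.gcd N)
        ((hMN.coprime_dvd_left hs).coprime_dvd_right (Nat.dvd_of_mem_divisors he))]
    rw [h1, h2, gcdForm_smul, cast_cuspCoeff hm, mul_assoc]

/-- `Y` on `Γ₀(M)` is rigid if `Y ⊗ x` is indecomposable for the cusp conditions of `Γ₀(M)`
whenever `x` is indecomposable, over an arbitrary saturated pointed monoid `C`. -/
def IsRigidEta (M : ℕ) (Y : ℕ → ℤ) : Prop :=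
  ∀ (C : AddSubmonoid (ℕ → ℤ)) (x : ℕ → ℤ), IsSaturatedPointed C → IsIndecomposable C x →
    ∀ G H : ℕ → ℕ → ℤ,
      (∀ s ∈ M.divisors, ∑ m ∈ M.divisors, cuspCoeff M s m • G m ∈ C) →
      (∀ s ∈ M.divisors, ∑ m ∈ M.divisors, cuspCoeff M s m • H m ∈ C) →
      (∀ m ∈ M.divisors, G m + H m = Y m • x) →
      (∀ m ∈ M.divisors, G m = 0) ∨ (∀ m ∈ M.divisors, H m = 0)

theorem eq_zero_of_etaSlice_eq_zero {M N : ℕ} {G : ℕ → ℤ}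
    (h : ∀ m ∈ M.divisors, etaSlice N G m = 0) : ∀ d ∈ (M * N).divisors, G d = 0 := by
  intro d hd
  obtain ⟨m, hm, e, he, rfl⟩ := Finset.mem_mul.1 (Nat.divisors_mul M N ▸ hd)
  simpa [etaSlice, Nat.dvd_of_mem_divisors he] using congrFun (h m hm) e

theorem IsRigidEta.not_factorizableOn {M N : ℕ} {Y X : ℕ → ℤ} (hY : IsRigidEta M Y) (hM : 0 < M)
    (hN : 0 < N) (hMN : M.Coprime N) (hX : SimpleEta N X) :
    ¬ FactorizableOn (M * N) (etaTensor M N Y X) := by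
  rintro ⟨G, H, hGs, hHs, ⟨d, hd, hGd⟩, ⟨f, hf, hHf⟩, hG, hH, hGH⟩
  have hpos : 0 < M * N := Nat.mul_pos hM hN
  rcases hY (etaCone N) X (isSaturatedPointed_etaCone hN) (hX.isIndecomposable hN)
      (etaSlice N G) (etaSlice N H)
      (fun s hs => sum_cuspCoeff_smul_etaSlice_mem hMN ((mem_etaCone hpos).2 ⟨hGs, hG⟩)
        (Nat.dvd_of_mem_divisors hs))
      (fun s hs => sum_cuspCoeff_smul_etaSlice_mem hMN ((mem_etaCone hpos).2 ⟨hHs, hH⟩)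
        (Nat.dvd_of_mem_divisors hs))
      (fun m hm => by
        rw [← etaSlice_etaTensor hMN Y hX.1 (Nat.dvd_of_mem_divisors hm)]
        funext e
        by_cases he : e ∣ N <;> simp [etaSlice, he, hGH]) with h | h
  · exact hGd (eq_zero_of_etaSlice_eq_zero h d hd)
  · exact hHf (eq_zero_of_etaSlice_eq_zero h f hf)

/-- Tensoring with a rigid vector of full support at `1` and `M` preserves simplicity. -/
theorem SimpleEta.etaTensor {M N : ℕ} {Y X : ℕ → ℤ} (hX : SimpleEta N X) (hM : 0 < M)
    (hN : 0 < N) (hMN : M.Coprime N) (hY : IsRigidEta M Y) (hY1 : Y 1 ≠ 0) (hYM : Y M ≠ 0)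
    (hhol : ∀ s ∈ M.divisors, 0 ≤ ∑ m ∈ M.divisors, cuspCoeff M s m * Y m) :
    SimpleEta (M * N) (etaTensor M N Y X) := by
  have hpos : 0 < M * N := Nat.mul_pos hM hN
  have hXh := (isHolEta_iff hN X).1 hX.2.1
  have hmem : ∀ m e, m ∣ M → e ∣ N → Y m ≠ 0 → X e ≠ 0 →
      m * e ∈ (M * N).divisors.filter fun d => _root_.etaTensor M N Y X d ≠ 0 := by
    intro m e hm he hYm hXe
    rw [Finset.mem_filter, etaTensor_mul hMN Y X hm he]
    exact ⟨Nat.mem_divisors.2 ⟨Nat.mul_dvd_mul hm he, hpos.ne'⟩, mul_ne_zero hYm hXe⟩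
  refine ⟨fun d hd => if_neg hd, ?_, ?_, ?_, hY.not_factorizableOn hM hN hMN hX⟩
  · rw [isHolEta_iff hpos]
    intro t
    rw [gcdForm_etaTensor hMN Y hX.1]
    exact mul_nonneg (gcdForm_nonneg_of_cuspCoeff hM hhol t) (hXh t)
  · refine Nat.dvd_antisymm ?_ ?_
    · exact Finset.lcm_dvd fun d hd => Nat.dvd_of_mem_divisors (Finset.mem_filter.1 hd).1
    · have hdvd : ∀ e ∈ N.divisors.filter fun d => X d ≠ 0,
          M * e ∣ etaLevel (M * N) (_root_.etaTensor M N Y X) := fun e he =>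
        Finset.dvd_lcm (f := id) (hmem M e dvd_rfl
          (Nat.dvd_of_mem_divisors (Finset.mem_filter.1 he).1) hYM (Finset.mem_filter.1 he).2)
      refine hMN.mul_dvd_of_dvd_of_dvd ?_ ?_
      · obtain ⟨e, he, hXe⟩ :=
          exists_ne_zero_of_ne_zero hN hX.1 (hX.isIndecomposable hN).ne_zero
        exact (Dvd.intro _ rfl).trans (hdvd e (Finset.mem_filter.2 ⟨he, hXe⟩))
      · conv_lhs => rw [← hX.2.2.1]
        exact Finset.lcm_dvd fun e he => (Dvd.intro_left _ rfl).trans (hdvd e he)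
  · refine Nat.dvd_one.1 ?_
    conv_rhs => rw [← hX.2.2.2.1]
    refine Finset.dvd_gcd fun e he => ?_
    have h := Finset.gcd_dvd (f := id) (hmem 1 e (one_dvd _)
      (Nat.dvd_of_mem_divisors (Finset.mem_filter.1 he).1) hY1 (Finset.mem_filter.1 he).2)
    simpa using h

theorem etaTensor_ne {M N : ℕ} {Y Y' X : ℕ → ℤ} (hN : 0 < N) (hMN : M.Coprime N)
    (hX : SimpleEta N X) {m : ℕ} (hm : m ∣ M) (h : Y m ≠ Y' m) :
    etaTensor M N Y X ≠ etaTensor M N Y' X := by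
  obtain ⟨e, he, hXe⟩ := exists_ne_zero_of_ne_zero hN hX.1 (hX.isIndecomposable hN).ne_zero
  intro heq
  have := congrFun heq (m * e)
  rw [etaTensor_mul hMN Y X hm (Nat.dvd_of_mem_divisors he),
    etaTensor_mul hMN Y' X hm (Nat.dvd_of_mem_divisors he)] at this
  exact h (mul_right_cancel₀ hXe this)

section Indecomposable

variable {ι : Type*} {C : AddSubmonoid (ι → ℤ)} {x : ι → ℤ}

theorem IsSaturatedPointed.mem_of_eq_mul (hC : IsSaturatedPointed C) {u v : ι → ℤ} (hu : u ∈ C)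
    (k : ℤ) (hk : 0 < k) (h : u = (k : ι → ℤ) * v) : v ∈ C :=
  hC.mem_of_smul_mem k v hk (by rwa [zsmul_eq_mul, ← h])

theorem IsSaturatedPointed.eq_zero_of_add_eq_zero (hC : IsSaturatedPointed C) {u v : ι → ℤ}
    (hu : u ∈ C) (hv : v ∈ C) (h : u + v = 0) : u = 0 :=
  hC.eq_zero_of_neg_mem u hu (by rwa [neg_eq_of_add_eq_zero_right h])

theorem IsIndecomposable.eq_zero_or_eq (hx : IsIndecomposable C x) {u v : ι → ℤ}
    (hu : u ∈ C) (hv : v ∈ C) (h : u + v = x) : u = 0 ∨ u = x := by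
  rcases hx.eq_zero_or u hu v hv h with h0 | h0
  · exact Or.inl h0
  · exact Or.inr (by rw [← h, h0, add_zero])

theorem intCast_mul_mem {u : ι → ℤ} (hu : u ∈ C) {k : ℤ} (hk : 0 ≤ k) :
    (k : ι → ℤ) * u ∈ C := by
  lift k to ℕ using hk
  simpa [nsmul_eq_mul] using C.nsmul_mem hu k

/-- If `l u ≤ k x` with `l > k > 0` then `u = 0`. -/
theorem IsIndecomposable.eq_zero_of_lt (hx : IsIndecomposable C x) (hC : IsSaturatedPointed C)
    {u v : ι → ℤ} (hu : u ∈ C) (hv : v ∈ C) (l k : ℤ) (hk : 0 < k) (hkl : k < l)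
    (h : (l : ι → ℤ) * u + v = (k : ι → ℤ) * x) : u = 0 := by
  have hxu : x - u ∈ C := by
    refine hC.mem_of_eq_mul (C.add_mem hv (intCast_mul_mem hu (k := l - k) (by omega))) k hk ?_
    push_cast
    linear_combination h
  refine (hx.eq_zero_or_eq hu hxu (by ring)).resolve_right ?_
  rintro rfl
  refine hx.ne_zero (hC.eq_zero_of_neg_mem u hu ?_)
  refine hC.mem_of_eq_mul hv (l - k) (by omega) ?_
  push_cast
  linear_combination h

theorem IsIndecomposable.ne_mul (hx : IsIndecomposable C x) (hC : IsSaturatedPointed C)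
    (k : ℤ) (hk : 2 ≤ k) (w : ι → ℤ) : x ≠ (k : ι → ℤ) * w := by
  intro h
  have hw : w ∈ C := hC.mem_of_eq_mul hx.mem k (by omega) h
  have h0 : w = 0 := hx.eq_zero_of_lt hC hw C.zero_mem k 1 one_pos (by omega) (by simp [h])
  exact hx.ne_zero (by rw [h, h0, mul_zero])

theorem pi_eq_of_mul_eq (k : ℤ) (hk : k ≠ 0) {u v : ι → ℤ}
    (h : (k : ι → ℤ) * u = (k : ι → ℤ) * v) : u = v := by
  funext i
  exact mul_left_cancel₀ hk (by simpa using congrFun h i)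

/-- The cusp conditions of `Γ₀(12)` on the components at `1, 2, 4` and `3, 6, 12`. -/
structure CuspCondTwelve (C : AddSubmonoid (ι → ℤ)) (a b c a' b' c' : ι → ℤ) : Prop where
  one : 3 * (4 * a + 2 * b + c) + (4 * a' + 2 * b' + c') ∈ C
  two : 3 * (a + 2 * b + c) + (a' + 2 * b' + c') ∈ C
  four : 3 * (a + 2 * b + 4 * c) + (a' + 2 * b' + 4 * c') ∈ C
  three : (4 * a + 2 * b + c) + 3 * (4 * a' + 2 * b' + c') ∈ C
  six : (a + 2 * b + c) + 3 * (a' + 2 * b' + c') ∈ C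
  twelve : (a + 2 * b + 4 * c) + 3 * (a' + 2 * b' + 4 * c') ∈ C

variable {a b c a' b' c' p q r p' q' r' : ι → ℤ}

/-- The Atkin–Lehner involution at `3`. -/
theorem CuspCondTwelve.swap (h : CuspCondTwelve C a b c a' b' c') :
    CuspCondTwelve C a' b' c' a b c := by
  obtain ⟨h1, h2, h4, h3, h6, h12⟩ := h
  constructor <;> rw [add_comm] <;> assumption

/-- The involution induced by `z ↦ z + 1/2`, which exchanges two cusps. -/
theorem CuspCondTwelve.twist (h : CuspCondTwelve C a b c a' b' c') :
    CuspCondTwelve C (-a) (3 * a + b) (c - a) (-a') (3 * a' + b') (c' - a') := by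
  obtain ⟨h1, h2, h4, h3, h6, h12⟩ := h
  constructor
  · convert h2 using 1; ring
  · convert h1 using 1; ring
  · convert h4 using 1; ring
  · convert h6 using 1; ring
  · convert h3 using 1; ring
  · convert h12 using 1; ring

theorem IsIndecomposable.cuspCondTwelve_eq_zero_of_six (hx : IsIndecomposable C x)
    (hC : IsSaturatedPointed C)
    (hG : CuspCondTwelve C a b c a' b' c') (hH : CuspCondTwelve C p q r p' q' r')
    (ha : a + p = -x) (hb : b + q = 2 * x) (hc : c + r = 0)
    (ha' : a' + p' = x) (hb' : b' + q' = -x) (hc' : c' + r' = 0)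
    (h0 : a' + 2 * b' + c' = 0) :
    a = 0 ∧ b = 0 ∧ c = 0 ∧ a' = 0 ∧ b' = 0 ∧ c' = 0 := by
  have e6 := hC.eq_zero_of_add_eq_zero hG.six hH.six
    (by linear_combination ha + 2 * hb + hc + 3 * ha' + 6 * hb' + 3 * hc')
  have e12 := hC.eq_zero_of_add_eq_zero hG.twelve hH.twelve
    (by linear_combination ha + 2 * hb + 4 * hc + 3 * ha' + 6 * hb' + 12 * hc')
  have hcc : c = -3 * c' := pi_eq_of_mul_eq 3 (by norm_num) (by
    push_cast; linear_combination e12 - e6)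
  have hneg : -c' = 0 := hx.eq_zero_of_lt hC (v := x + 3 * c')
    (hC.mem_of_eq_mul hG.four 24 (by norm_num) (by
      push_cast; linear_combination 3 * e6 - 8 * h0 + 9 * hcc))
    (hC.mem_of_eq_mul hH.four 8 (by norm_num) (by
      push_cast
      linear_combination 3 * ha + 6 * hb + 12 * hc + ha' + 2 * hb' + 4 * hc'
        - 3 * e6 + 8 * h0 - 9 * hcc)) 3 1 one_pos (by norm_num) (by push_cast; ring)
  have hc'0 : c' = 0 := neg_eq_zero.1 hneg
  have hc0 : c = 0 := by rw [hcc, hc'0, mul_zero]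
  subst hc'0 hc0
  have ea' : a' = -2 * b' := by linear_combination h0
  have ea : a = -2 * b := by linear_combination e6 - 3 * h0
  subst ea' ea
  have hp : -b - 3 * b' ∈ C := hC.mem_of_eq_mul hG.three 6 (by norm_num) (by push_cast; ring)
  have hp' : x - (-b - 3 * b') ∈ C := hC.mem_of_eq_mul hH.three 6 (by norm_num) (by
    push_cast; linear_combination 4 * ha + 2 * hb + hc + 12 * ha' + 6 * hb' + 3 * hc')
  have hw : -9 * b - 3 * b' ∈ C := hC.mem_of_eq_mul hG.one 2 (by norm_num) (by push_cast; ring)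
  have hw' : x - (-9 * b - 3 * b') ∈ C := hC.mem_of_eq_mul hH.one 2 (by norm_num) (by
    push_cast; linear_combination 12 * ha + 6 * hb + 3 * hc + 4 * ha' + 2 * hb' + hc')
  rcases hx.eq_zero_or_eq hp hp' (by ring) with h1 | h1 <;>
    rcases hx.eq_zero_or_eq hw hw' (by ring) with h2 | h2
  · have hb'0 : b' = 0 := pi_eq_of_mul_eq 24 (by norm_num) (by
      push_cast; linear_combination h2 - 9 * h1)
    have hb0 : b = 0 := by linear_combination -h1 - 3 * hb'0
    simp [hb'0, hb0]
  · exact absurd (by push_cast; linear_combination 9 * h1 - h2) (hx.ne_mul hC 24 (by norm_num) b')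
  · exact absurd (by push_cast; linear_combination -9 * h1 + h2)
      (hx.ne_mul hC 8 (by norm_num) (-3 * b' - x))
  · exact absurd (pi_eq_of_mul_eq 8 (by norm_num) (by push_cast; linear_combination h2 - 9 * h1))
      (hx.ne_mul hC 3 (by norm_num) (-b'))

theorem IsIndecomposable.cuspCondTwelve_eq_zero_of_two (hx : IsIndecomposable C x)
    (hC : IsSaturatedPointed C)
    (hG : CuspCondTwelve C a b c a' b' c') (hH : CuspCondTwelve C p q r p' q' r')
    (ha : a + p = 2 * x) (hb : b + q = -x) (hc : c + r = 0)
    (ha' : a' + p' = -x) (hb' : b' + q' = x) (hc' : c' + r' = 0)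
    (h0 : 3 * (a + 2 * b + c) + (a' + 2 * b' + c') = 0) :
    a = 0 ∧ b = 0 ∧ c = 0 ∧ a' = 0 ∧ b' = 0 ∧ c' = 0 := by
  have e3 := hC.eq_zero_of_add_eq_zero hG.three hH.three
    (by linear_combination 4 * ha + 2 * hb + hc + 12 * ha' + 6 * hb' + 3 * hc')
  have hcc : 3 * c + c' = 0 := hx.eq_zero_of_lt hC
    (hC.mem_of_eq_mul hG.four 3 (by norm_num) (by push_cast; linear_combination h0))
    hH.four 3 1 one_pos (by norm_num) (by
      push_cast
      linear_combination 3 * ha + 6 * hb + 12 * hc + ha' + 2 * hb' + 4 * hc' - h0)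
  have hm : -(a + 2 * b + c) ∈ C :=
    hC.mem_of_eq_mul hG.six 8 (by norm_num) (by push_cast; linear_combination 3 * h0)
  have hm3 : -3 * (a + 2 * b + c) + a + 3 * a' = 0 := hx.eq_zero_of_lt hC
    (hC.mem_of_eq_mul hm 3 (by norm_num) (by push_cast; linear_combination 3 * h0 - e3))
    hH.six 24 3 (by norm_num) (by norm_num) (by
      push_cast
      linear_combination ha + 2 * hb + hc + 3 * ha' + 6 * hb' + 3 * hc' + 8 * e3 - 27 * h0)
  have hR : a + 2 * b + c = 0 := by linear_combination -3 * h0 + e3 - 3 * hm3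
  have hneg : -c = 0 := hx.eq_zero_of_lt hC
    (hC.mem_of_eq_mul hG.twelve 24 (by norm_num) (by
      push_cast; linear_combination 3 * h0 - 8 * hR + 9 * hcc))
    hH.twelve 24 3 (by norm_num) (by norm_num) (by
      push_cast
      linear_combination ha + 2 * hb + 4 * hc + 3 * ha' + 6 * hb' + 12 * hc'
        - (3 * h0 - 8 * hR + 9 * hcc))
  have hc0 : c = 0 := neg_eq_zero.1 hneg
  have hc'0 : c' = 0 := by linear_combination hcc - 3 * hc0
  subst hc0 hc'0
  have ea : a = -2 * b := by linear_combination hR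
  have ea' : a' = -2 * b' := by linear_combination h0 - 3 * hR
  subst ea ea'
  have hbb : b = -3 * b' := pi_eq_of_mul_eq 2 (by norm_num) (by
    push_cast; linear_combination 3 * hR - hm3)
  subst hbb
  have hb'0 : b' = 0 := hx.eq_zero_of_lt hC
    (hC.mem_of_eq_mul hG.one 48 (by norm_num) (by push_cast; ring))
    hH.one 48 16 (by norm_num) (by norm_num) (by
      push_cast
      linear_combination 12 * ha + 6 * hb + 3 * hc + 4 * ha' + 2 * hb' + hc')
  simp [hb'0]

end Indecomposable

/-- Rigidity on `Γ₀(12)` of the vector with entries `u, v, w` at `1, 2, 4` and `u', v', w'` at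
`3, 6, 12`. -/
def IsRigidTwelve (u v w u' v' w' : ℤ) : Prop :=
  ∀ (C : AddSubmonoid (ℕ → ℤ)) (x : ℕ → ℤ), IsSaturatedPointed C → IsIndecomposable C x →
    ∀ a b c a' b' c' p q r p' q' r' : ℕ → ℤ,
      CuspCondTwelve C a b c a' b' c' → CuspCondTwelve C p q r p' q' r' →
      a + p = (u : ℕ → ℤ) * x → b + q = (v : ℕ → ℤ) * x → c + r = (w : ℕ → ℤ) * x →
      a' + p' = (u' : ℕ → ℤ) * x → b' + q' = (v' : ℕ → ℤ) * x → c' + r' = (w' : ℕ → ℤ) * x →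
      (a = 0 ∧ b = 0 ∧ c = 0 ∧ a' = 0 ∧ b' = 0 ∧ c' = 0) ∨
        (p = 0 ∧ q = 0 ∧ r = 0 ∧ p' = 0 ∧ q' = 0 ∧ r' = 0)

theorem IsRigidTwelve.swap {u v w u' v' w' : ℤ} (h : IsRigidTwelve u v w u' v' w') :
    IsRigidTwelve u' v' w' u v w := by
  intro C x hC hx a b c a' b' c' p q r p' q' r' hG hH h1 h2 h3 h4 h5 h6
  have := h C x hC hx a' b' c' a b c p' q' r' p q r hG.swap hH.swap h4 h5 h6 h1 h2 h3
  tauto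

theorem IsRigidTwelve.twist {u v w u' v' w' : ℤ} (h : IsRigidTwelve u v w u' v' w') :
    IsRigidTwelve (-u) (3 * u + v) (w - u) (-u') (3 * u' + v') (w' - u') := by
  intro C x hC hx a b c a' b' c' p q r p' q' r' hG hH h1 h2 h3 h4 h5 h6
  push_cast at h1 h2 h3 h4 h5 h6
  have key := h C x hC hx _ _ _ _ _ _ _ _ _ _ _ _ hG.twist hH.twist
    (by linear_combination -h1) (by linear_combination 3 * h1 + h2)
    (by linear_combination h3 - h1) (by linear_combination -h4)
    (by linear_combination 3 * h4 + h5) (by linear_combination h6 - h4)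
  simp only [neg_eq_zero] at key
  rcases key with ⟨rfl, hb, hc, rfl, hb', hc'⟩ | ⟨rfl, hb, hc, rfl, hb', hc'⟩
  · exact Or.inl ⟨rfl, by simpa using hb, by simpa using hc, rfl, by simpa using hb',
      by simpa using hc'⟩
  · exact Or.inr ⟨rfl, by simpa using hb, by simpa using hc, rfl, by simpa using hb',
      by simpa using hc'⟩

theorem isRigidTwelve_neg_one_two : IsRigidTwelve (-1) 2 0 1 (-1) 0 := by
  intro C x hC hx a b c a' b' c' p q r p' q' r' hG hH h1 h2 h3 h4 h5 h6
  push_cast at h1 h2 h3 h4 h5 h6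
  simp only [neg_mul, one_mul, zero_mul] at h1 h2 h3 h4 h5 h6
  have e6 := hC.eq_zero_of_add_eq_zero hG.six hH.six
    (by linear_combination h1 + 2 * h2 + h3 + 3 * h4 + 6 * h5 + 3 * h6)
  have e6' : (p + 2 * q + r) + 3 * (p' + 2 * q' + r') = 0 := by
    linear_combination h1 + 2 * h2 + h3 + 3 * h4 + 6 * h5 + 3 * h6 - e6
  rcases hx.eq_zero_or (-(a' + 2 * b' + c'))
      (hC.mem_of_eq_mul hG.two 8 (by norm_num) (by push_cast; linear_combination 3 * e6))
      (-(p' + 2 * q' + r'))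
      (hC.mem_of_eq_mul hH.two 8 (by norm_num) (by push_cast; linear_combination 3 * e6'))
      (by linear_combination -h4 - 2 * h5 - h6) with h0 | h0
  · exact Or.inl (hx.cuspCondTwelve_eq_zero_of_six hC hG hH h1 h2 h3 h4 h5 h6 (neg_eq_zero.1 h0))
  · rw [add_comm] at h1 h2 h3 h4 h5 h6
    exact Or.inr (hx.cuspCondTwelve_eq_zero_of_six hC hH hG h1 h2 h3 h4 h5 h6 (neg_eq_zero.1 h0))

theorem isRigidTwelve_two_neg_one : IsRigidTwelve 2 (-1) 0 (-1) 1 0 := by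
  intro C x hC hx a b c a' b' c' p q r p' q' r' hG hH h1 h2 h3 h4 h5 h6
  push_cast at h1 h2 h3 h4 h5 h6
  simp only [neg_mul, one_mul, zero_mul] at h1 h2 h3 h4 h5 h6
  rcases hx.eq_zero_or _ hG.two _ hH.two
      (by linear_combination 3 * h1 + 6 * h2 + 3 * h3 + h4 + 2 * h5 + h6) with h0 | h0
  · exact Or.inl (hx.cuspCondTwelve_eq_zero_of_two hC hG hH h1 h2 h3 h4 h5 h6 h0)
  · rw [add_comm] at h1 h2 h3 h4 h5 h6
    exact Or.inr (hx.cuspCondTwelve_eq_zero_of_two hC hH hG h1 h2 h3 h4 h5 h6 h0)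

/-- The exponent vector with entries `u, v, w` at `1, 2, 4` and `u', v', w'` at `3, 6, 12`. -/
def etaVec (u v w u' v' w' : ℤ) : ℕ → ℤ
  | 1 => u
  | 2 => v
  | 4 => w
  | 3 => u'
  | 6 => v'
  | 12 => w'
  | _ => 0

theorem divisors_two_eq : Nat.divisors 2 = {1, 2} := by decide

theorem divisors_four_eq : Nat.divisors 4 = {1, 2, 4} := by decide

theorem divisors_six_eq : Nat.divisors 6 = {1, 2, 3, 6} := by decide

theorem divisors_twelve_eq : Nat.divisors 12 = {1, 2, 3, 4, 6, 12} := by decide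

theorem IsRigidTwelve.isRigidEta_twelve {u v w u' v' w' : ℤ} (h : IsRigidTwelve u v w u' v' w') :
    IsRigidEta 12 (etaVec u v w u' v' w') := by
  intro C x hC hx G H hG hH hGH
  have cusp (F : ℕ → ℕ → ℤ)
      (hF : ∀ s ∈ Nat.divisors 12, ∑ m ∈ Nat.divisors 12, cuspCoeff 12 s m • F m ∈ C) :
      CuspCondTwelve C (F 1) (F 2) (F 4) (F 3) (F 6) (F 12) := by
    rw [divisors_twelve_eq] at hF
    constructor
    · refine hC.mem_of_eq_mul (hF 1 (by simp)) 1 (by norm_num) ?_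
      simp [cuspCoeff]; ring
    · refine hC.mem_of_eq_mul (hF 2 (by simp)) 4 (by norm_num) ?_
      simp [cuspCoeff]; ring
    · refine hC.mem_of_eq_mul (hF 4 (by simp)) 4 (by norm_num) ?_
      simp [cuspCoeff]; ring
    · refine hC.mem_of_eq_mul (hF 3 (by simp)) 3 (by norm_num) ?_
      simp [cuspCoeff]; ring
    · refine hC.mem_of_eq_mul (hF 6 (by simp)) 12 (by norm_num) ?_
      simp [cuspCoeff]; ring
    · refine hC.mem_of_eq_mul (hF 12 (by simp)) 12 (by norm_num) ?_
      simp [cuspCoeff]; ring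
  rw [divisors_twelve_eq] at hGH ⊢
  simp only [zsmul_eq_mul] at hGH
  have key := h C x hC hx _ _ _ _ _ _ _ _ _ _ _ _ (cusp G hG) (cusp H hH)
    (hGH 1 (by simp)) (hGH 2 (by simp)) (hGH 4 (by simp)) (hGH 3 (by simp)) (hGH 6 (by simp))
    (hGH 12 (by simp))
  simp only [Finset.forall_mem_insert, Finset.mem_singleton, forall_eq]
  tauto

theorem IsRigidTwelve.isRigidEta_six {u v u' v' : ℤ} (h : IsRigidTwelve u v 0 u' v' 0) :
    IsRigidEta 6 (etaVec u v 0 u' v' 0) := by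
  intro C x hC hx G H hG hH hGH
  have cusp (F : ℕ → ℕ → ℤ)
      (hF : ∀ s ∈ Nat.divisors 6, ∑ m ∈ Nat.divisors 6, cuspCoeff 6 s m • F m ∈ C) :
      CuspCondTwelve C (F 1) (F 2) 0 (F 3) (F 6) 0 := by
    rw [divisors_six_eq] at hF
    have h2 : 3 * (F 1 + 2 * F 2) + (F 3 + 2 * F 6) ∈ C := by
      refine hC.mem_of_eq_mul (hF 2 (by simp)) 2 (by norm_num) ?_
      simp [cuspCoeff]; ring
    have h6 : (F 1 + 2 * F 2) + 3 * (F 3 + 2 * F 6) ∈ C := by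
      refine hC.mem_of_eq_mul (hF 6 (by simp)) 6 (by norm_num) ?_
      simp [cuspCoeff]; ring
    constructor
    · convert C.add_mem (hF 1 (by simp)) (hF 1 (by simp)) using 1
      simp [cuspCoeff]; ring
    · simpa using h2
    · simpa using h2
    · refine hC.mem_of_eq_mul (C.add_mem (hF 3 (by simp)) (hF 3 (by simp))) 3 (by norm_num) ?_
      simp [cuspCoeff]; ring
    · simpa using h6
    · simpa using h6
  rw [divisors_six_eq] at hGH ⊢
  simp only [zsmul_eq_mul] at hGH
  have key := h C x hC hx _ _ _ _ _ _ _ _ _ _ _ _ (cusp G hG) (cusp H hH)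
    (hGH 1 (by simp)) (hGH 2 (by simp)) (by simp) (hGH 3 (by simp)) (hGH 6 (by simp)) (by simp)
  simp only [Finset.forall_mem_insert, Finset.mem_singleton, forall_eq]
  tauto

theorem cuspCond_two {C : AddSubmonoid (ℕ → ℤ)} (hC : IsSaturatedPointed C) {F : ℕ → ℕ → ℤ}
    (hF : ∀ s ∈ Nat.divisors 2, ∑ m ∈ Nat.divisors 2, cuspCoeff 2 s m • F m ∈ C) :
    2 * F 1 + F 2 ∈ C ∧ F 1 + 2 * F 2 ∈ C := by
  rw [divisors_two_eq] at hF
  constructor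
  · refine hC.mem_of_eq_mul (hF 1 (by simp)) 1 (by norm_num) ?_
    simp [cuspCoeff]
  · refine hC.mem_of_eq_mul (hF 2 (by simp)) 2 (by norm_num) ?_
    simp [cuspCoeff]; ring

theorem cuspCond_four {C : AddSubmonoid (ℕ → ℤ)} (hC : IsSaturatedPointed C) {F : ℕ → ℕ → ℤ}
    (hF : ∀ s ∈ Nat.divisors 4, ∑ m ∈ Nat.divisors 4, cuspCoeff 4 s m • F m ∈ C) :
    4 * F 1 + 2 * F 2 + F 4 ∈ C ∧ F 1 + 2 * F 2 + F 4 ∈ C ∧ F 1 + 2 * F 2 + 4 * F 4 ∈ C := by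
  rw [divisors_four_eq] at hF
  refine ⟨?_, ?_, ?_⟩
  · refine hC.mem_of_eq_mul (hF 1 (by simp)) 1 (by norm_num) ?_
    simp [cuspCoeff]; ring
  · refine hC.mem_of_eq_mul (hF 2 (by simp)) 4 (by norm_num) ?_
    simp [cuspCoeff]; ring
  · refine hC.mem_of_eq_mul (hF 4 (by simp)) 4 (by norm_num) ?_
    simp [cuspCoeff]; ring

theorem isRigidEta_two_neg_one : IsRigidEta 2 (etaVec 2 (-1) 0 0 0 0) := by
  intro C x hC hx G H hG hH hGH
  obtain ⟨g1, g2⟩ := cuspCond_two hC hG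
  obtain ⟨h1, h2⟩ := cuspCond_two hC hH
  rw [divisors_two_eq] at hGH ⊢
  have e1 : G 1 + H 1 = 2 * x := by simpa [etaVec] using hGH 1 (by simp)
  have e2 : G 2 + H 2 = -x := by simpa [etaVec] using hGH 2 (by simp)
  simp only [Finset.forall_mem_insert, Finset.mem_singleton, forall_eq]
  have z := hC.eq_zero_of_add_eq_zero g2 h2 (by linear_combination e1 + 2 * e2)
  rcases hx.eq_zero_or (-G 2)
      (hC.mem_of_eq_mul g1 3 (by norm_num) (by push_cast; linear_combination 2 * z)) (-H 2)
      (hC.mem_of_eq_mul h1 3 (by norm_num) (by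
        push_cast; linear_combination 2 * e1 + 4 * e2 - 2 * z))
      (by linear_combination -e2) with h | h
  · exact Or.inl ⟨by linear_combination z + 2 * h, neg_eq_zero.1 h⟩
  · exact Or.inr ⟨by linear_combination e1 + 2 * e2 - z + 2 * h, neg_eq_zero.1 h⟩

theorem isRigidEta_neg_one_two : IsRigidEta 2 (etaVec (-1) 2 0 0 0 0) := by
  intro C x hC hx G H hG hH hGH
  obtain ⟨g1, g2⟩ := cuspCond_two hC hG
  obtain ⟨h1, h2⟩ := cuspCond_two hC hH
  rw [divisors_two_eq] at hGH ⊢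
  have e1 : G 1 + H 1 = -x := by simpa [etaVec] using hGH 1 (by simp)
  have e2 : G 2 + H 2 = 2 * x := by simpa [etaVec] using hGH 2 (by simp)
  simp only [Finset.forall_mem_insert, Finset.mem_singleton, forall_eq]
  have z := hC.eq_zero_of_add_eq_zero g1 h1 (by linear_combination 2 * e1 + e2)
  rcases hx.eq_zero_or (-G 1)
      (hC.mem_of_eq_mul g2 3 (by norm_num) (by push_cast; linear_combination 2 * z)) (-H 1)
      (hC.mem_of_eq_mul h2 3 (by norm_num) (by
        push_cast; linear_combination 4 * e1 + 2 * e2 - 2 * z))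
      (by linear_combination -e1) with h | h
  · exact Or.inl ⟨neg_eq_zero.1 h, by linear_combination z + 2 * h⟩
  · exact Or.inr ⟨neg_eq_zero.1 h, by linear_combination 2 * e1 + e2 - z + 2 * h⟩

theorem isRigidEta_one_neg_one_one : IsRigidEta 4 (etaVec 1 (-1) 1 0 0 0) := by
  intro C x hC hx G H hG hH hGH
  obtain ⟨g1, g2, g4⟩ := cuspCond_four hC hG
  obtain ⟨h1, h2, h4⟩ := cuspCond_four hC hH
  rw [divisors_four_eq] at hGH ⊢
  have e1 : G 1 + H 1 = x := by simpa [etaVec] using hGH 1 (by simp)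
  have e2 : G 2 + H 2 = -x := by simpa [etaVec] using hGH 2 (by simp)
  have e4 : G 4 + H 4 = x := by simpa [etaVec] using hGH 4 (by simp)
  simp only [Finset.forall_mem_insert, Finset.mem_singleton, forall_eq]
  have z := hC.eq_zero_of_add_eq_zero g2 h2 (by linear_combination e1 + 2 * e2 + e4)
  have z' : H 1 + 2 * H 2 + H 4 = 0 := by linear_combination e1 + 2 * e2 + e4 - z
  rcases hx.eq_zero_or (G 1)
      (hC.mem_of_eq_mul g1 3 (by norm_num) (by push_cast; linear_combination z)) (H 1)
      (hC.mem_of_eq_mul h1 3 (by norm_num) (by push_cast; linear_combination z')) e1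
    with k1 | k1 <;>
  rcases hx.eq_zero_or (G 4)
      (hC.mem_of_eq_mul g4 3 (by norm_num) (by push_cast; linear_combination z)) (H 4)
      (hC.mem_of_eq_mul h4 3 (by norm_num) (by push_cast; linear_combination z')) e4
    with k4 | k4
  · exact Or.inl ⟨k1, pi_eq_of_mul_eq 2 (by norm_num) (by
      push_cast; linear_combination z - k1 - k4), k4⟩
  · exact absurd (by push_cast; linear_combination z - e4 - k1 + k4)
      (hx.ne_mul hC 2 le_rfl (-G 2))
  · exact absurd (by push_cast; linear_combination z - e1 - k4 + k1)
      (hx.ne_mul hC 2 le_rfl (-G 2))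
  · exact Or.inr ⟨k1, pi_eq_of_mul_eq 2 (by norm_num) (by
      push_cast; linear_combination z' - k1 - k4), k4⟩

theorem isRigidEta_neg_one_three_neg_one : IsRigidEta 4 (etaVec (-1) 3 (-1) 0 0 0) := by
  intro C x hC hx G H hG hH hGH
  obtain ⟨g1, g2, g4⟩ := cuspCond_four hC hG
  obtain ⟨h1, h2, h4⟩ := cuspCond_four hC hH
  rw [divisors_four_eq] at hGH ⊢
  have e1 : G 1 + H 1 = -x := by simpa [etaVec] using hGH 1 (by simp)
  have e2 : G 2 + H 2 = 3 * x := by simpa [etaVec] using hGH 2 (by simp)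
  have e4 : G 4 + H 4 = -x := by simpa [etaVec] using hGH 4 (by simp)
  simp only [Finset.forall_mem_insert, Finset.mem_singleton, forall_eq]
  have vanish {a b c v : ℕ → ℤ} (k1 : 4 * a + 2 * b + c = 0) (k4 : a + 2 * b + 4 * c = 0)
      (k2 : a + 2 * b + c ∈ C) (hv : v ∈ C) (h : a + 2 * b + c + v = 4 * x) :
      a = 0 ∧ b = 0 ∧ c = 0 := by
    have hac : a = c := pi_eq_of_mul_eq 3 (by norm_num) (by push_cast; linear_combination k1 - k4)
    subst hac
    have hw : b + 2 * a = 0 := hx.eq_zero_of_lt hC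
      (hC.mem_of_eq_mul k2 6 (by norm_num) (by push_cast; linear_combination -2 * k1)) hv 6 4
      (by norm_num) (by norm_num) (by push_cast; linear_combination 2 * k1 + h)
    have ha : a = 0 := by linear_combination k1 - 2 * hw
    exact ⟨ha, by linear_combination hw - 2 * ha, ha⟩
  rcases hx.eq_zero_or _ g1 _ h1 (by linear_combination 4 * e1 + 2 * e2 + e4) with k1 | k1 <;>
  rcases hx.eq_zero_or _ g4 _ h4 (by linear_combination e1 + 2 * e2 + 4 * e4) with k4 | k4
  · exact Or.inl (vanish k1 k4 g2 h2 (by linear_combination e1 + 2 * e2 + e4))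
  · exact absurd (by push_cast; linear_combination k4 - e1 - 2 * e2 - 4 * e4 + k1)
      (hx.ne_mul hC 3 (by norm_num) (G 4 - G 1))
  · exact absurd (by push_cast; linear_combination k1 - 4 * e1 - 2 * e2 - e4 + k4)
      (hx.ne_mul hC 3 (by norm_num) (G 1 - G 4))
  · exact Or.inr (vanish k1 k4 h2 g2 (by linear_combination e1 + 2 * e2 + e4))

theorem isRigidEta_neg_two_five_neg_two : IsRigidEta 4 (etaVec (-2) 5 (-2) 0 0 0) := by
  intro C x hC hx G H hG hH hGH
  obtain ⟨g1, g2, g4⟩ := cuspCond_four hC hG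
  obtain ⟨h1, h2, h4⟩ := cuspCond_four hC hH
  rw [divisors_four_eq] at hGH ⊢
  have e1 : G 1 + H 1 = -2 * x := by simpa [etaVec] using hGH 1 (by simp)
  have e2 : G 2 + H 2 = 5 * x := by simpa [etaVec] using hGH 2 (by simp)
  have e4 : G 4 + H 4 = -2 * x := by simpa [etaVec] using hGH 4 (by simp)
  simp only [Finset.forall_mem_insert, Finset.mem_singleton, forall_eq]
  have z1 := hC.eq_zero_of_add_eq_zero g1 h1 (by linear_combination 4 * e1 + 2 * e2 + e4)
  have z4 := hC.eq_zero_of_add_eq_zero g4 h4 (by linear_combination e1 + 2 * e2 + 4 * e4)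
  have y1 : 4 * H 1 + 2 * H 2 + H 4 = 0 := by linear_combination 4 * e1 + 2 * e2 + e4 - z1
  have y4 : H 1 + 2 * H 2 + 4 * H 4 = 0 := by linear_combination e1 + 2 * e2 + 4 * e4 - z4
  have diag {a b c : ℕ → ℤ} (k1 : 4 * a + 2 * b + c = 0) (k4 : a + 2 * b + 4 * c = 0) : c = a :=
    pi_eq_of_mul_eq 3 (by norm_num) (by push_cast; linear_combination k4 - k1)
  have dG := diag z1 z4
  have dH := diag y1 y4
  rcases hx.eq_zero_or (G 2 + 2 * G 1)
      (hC.mem_of_eq_mul g2 6 (by norm_num) (by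
        push_cast; linear_combination -2 * z1 + 3 * dG)) (H 2 + 2 * H 1)
      (hC.mem_of_eq_mul h2 6 (by norm_num) (by
        push_cast; linear_combination -2 * y1 + 3 * dH))
      (by linear_combination e2 + 2 * e1) with h | h
  · have ha : G 1 = 0 := by linear_combination z1 - dG - 2 * h
    exact Or.inl ⟨ha, by linear_combination h - 2 * ha, dG.trans ha⟩
  · have ha : H 1 = 0 := by linear_combination y1 - dH - 2 * h
    exact Or.inr ⟨ha, by linear_combination h - 2 * ha, dH.trans ha⟩

/-- A rigid vector of weight one on `Γ₀(M)`, nonvanishing at `1` and `M`, extends the level of a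
simple eta quotient and keeps its weight. -/
theorem SimpleEta.etaTensor_and_sum {M N : ℕ} {Y X : ℕ → ℤ} (hX : SimpleEta N X) (hM : 0 < M)
    (hN : 0 < N) (hMN : M.Coprime N) (hY : IsRigidEta M Y)
    (h : Y 1 ≠ 0 ∧ Y M ≠ 0 ∧ (∀ s ∈ M.divisors, 0 ≤ ∑ m ∈ M.divisors, cuspCoeff M s m * Y m) ∧
      ∑ m ∈ M.divisors, Y m = 1) :
    SimpleEta (M * N) (_root_.etaTensor M N Y X) ∧
      ∑ d ∈ (M * N).divisors, _root_.etaTensor M N Y X d = ∑ d ∈ N.divisors, X d :=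
  ⟨hX.etaTensor hM hN hMN hY h.1 h.2.1 h.2.2.1, by rw [sum_etaTensor hMN, h.2.2.2, one_mul]⟩

/-- Extending the levels of simple holomorphic eta quotients: if a simple holomorphic
eta quotient of odd level `N` exists, then there are at least two simple holomorphic
eta quotients of level `2N` and at least three of level `4N`; if moreover `3 ∤ N`,
there are at least four of level `6N` and at least four of level `12N` — all of the
same weight as the given one. -/
theorem simple_eta_extend_levels (N : ℕ) (hpos : 0 < N) (hodd : Odd N)
    (X : ℕ → ℤ) (hX : SimpleEta N X) :
    (∃ X₁ X₂ : ℕ → ℤ, X₁ ≠ X₂ ∧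
      SimpleEta (2 * N) X₁ ∧ SimpleEta (2 * N) X₂ ∧
      (∑ d ∈ (2 * N).divisors, X₁ d) = (∑ d ∈ N.divisors, X d) ∧
      (∑ d ∈ (2 * N).divisors, X₂ d) = (∑ d ∈ N.divisors, X d)) ∧
    (∃ Y₁ Y₂ Y₃ : ℕ → ℤ, Y₁ ≠ Y₂ ∧ Y₁ ≠ Y₃ ∧ Y₂ ≠ Y₃ ∧
      SimpleEta (4 * N) Y₁ ∧ SimpleEta (4 * N) Y₂ ∧ SimpleEta (4 * N) Y₃ ∧
      (∑ d ∈ (4 * N).divisors, Y₁ d) = (∑ d ∈ N.divisors, X d) ∧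
      (∑ d ∈ (4 * N).divisors, Y₂ d) = (∑ d ∈ N.divisors, X d) ∧
      (∑ d ∈ (4 * N).divisors, Y₃ d) = (∑ d ∈ N.divisors, X d)) ∧
    (¬ 3 ∣ N →
      (∃ Z₁ Z₂ Z₃ Z₄ : ℕ → ℤ,
        Z₁ ≠ Z₂ ∧ Z₁ ≠ Z₃ ∧ Z₁ ≠ Z₄ ∧ Z₂ ≠ Z₃ ∧ Z₂ ≠ Z₄ ∧ Z₃ ≠ Z₄ ∧
        SimpleEta (6 * N) Z₁ ∧ SimpleEta (6 * N) Z₂ ∧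
        SimpleEta (6 * N) Z₃ ∧ SimpleEta (6 * N) Z₄ ∧
        (∑ d ∈ (6 * N).divisors, Z₁ d) = (∑ d ∈ N.divisors, X d) ∧
        (∑ d ∈ (6 * N).divisors, Z₂ d) = (∑ d ∈ N.divisors, X d) ∧
        (∑ d ∈ (6 * N).divisors, Z₃ d) = (∑ d ∈ N.divisors, X d) ∧
        (∑ d ∈ (6 * N).divisors, Z₄ d) = (∑ d ∈ N.divisors, X d)) ∧
      (∃ W₁ W₂ W₃ W₄ : ℕ → ℤ,
        W₁ ≠ W₂ ∧ W₁ ≠ W₃ ∧ W₁ ≠ W₄ ∧ W₂ ≠ W₃ ∧ W₂ ≠ W₄ ∧ W₃ ≠ W₄ ∧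
        SimpleEta (12 * N) W₁ ∧ SimpleEta (12 * N) W₂ ∧
        SimpleEta (12 * N) W₃ ∧ SimpleEta (12 * N) W₄ ∧
        (∑ d ∈ (12 * N).divisors, W₁ d) = (∑ d ∈ N.divisors, X d) ∧
        (∑ d ∈ (12 * N).divisors, W₂ d) = (∑ d ∈ N.divisors, X d) ∧
        (∑ d ∈ (12 * N).divisors, W₃ d) = (∑ d ∈ N.divisors, X d) ∧
        (∑ d ∈ (12 * N).divisors, W₄ d) = (∑ d ∈ N.divisors, X d))) := by
  have h2 : Nat.Coprime 2 N := Nat.coprime_two_left.2 hodd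
  have h4 : Nat.Coprime 4 N := by simpa using h2.pow_left 2
  refine ⟨?_, ?_, fun h3 => ?_⟩
  · have hc := h2
    obtain ⟨h1, wh1⟩ := hX.etaTensor_and_sum (by norm_num) hpos hc
      isRigidEta_two_neg_one (by decide)
    obtain ⟨h2, wh2⟩ := hX.etaTensor_and_sum (by norm_num) hpos hc
      isRigidEta_neg_one_two (by decide)
    exact ⟨_, _, etaTensor_ne hpos hc hX (m := 1) (by norm_num) (by decide), h1, h2, wh1, wh2⟩
  · have hc := h4
    obtain ⟨h1, wh1⟩ := hX.etaTensor_and_sum (by norm_num) hpos hc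
      isRigidEta_one_neg_one_one (by decide)
    obtain ⟨h2, wh2⟩ := hX.etaTensor_and_sum (by norm_num) hpos hc
      isRigidEta_neg_one_three_neg_one (by decide)
    obtain ⟨h3, wh3⟩ := hX.etaTensor_and_sum (by norm_num) hpos hc
      isRigidEta_neg_two_five_neg_two (by decide)
    exact ⟨_, _, _, etaTensor_ne hpos hc hX (m := 1) (by norm_num) (by decide),
      etaTensor_ne hpos hc hX (m := 1) (by norm_num) (by decide),
      etaTensor_ne hpos hc hX (m := 1) (by norm_num) (by decide), h1, h2, h3, wh1, wh2, wh3⟩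
  · have h3 : Nat.Coprime 3 N := (Nat.Prime.coprime_iff_not_dvd Nat.prime_three).2 h3
    constructor
    · have hc : Nat.Coprime 6 N := Nat.Coprime.mul_left h2 h3
      obtain ⟨h1, wh1⟩ := hX.etaTensor_and_sum (by norm_num) hpos hc
        isRigidTwelve_neg_one_two.isRigidEta_six (by decide)
      obtain ⟨h2, wh2⟩ := hX.etaTensor_and_sum (by norm_num) hpos hc
        isRigidTwelve_neg_one_two.swap.isRigidEta_six (by decide)
      obtain ⟨h3, wh3⟩ := hX.etaTensor_and_sum (by norm_num) hpos hc
        isRigidTwelve_two_neg_one.isRigidEta_six (by decide)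
      obtain ⟨h4, wh4⟩ := hX.etaTensor_and_sum (by norm_num) hpos hc
        isRigidTwelve_two_neg_one.swap.isRigidEta_six (by decide)
      exact ⟨_, _, _, _, etaTensor_ne hpos hc hX (m := 1) (by norm_num) (by decide),
        etaTensor_ne hpos hc hX (m := 1) (by norm_num) (by decide),
        etaTensor_ne hpos hc hX (m := 2) (by norm_num) (by decide),
        etaTensor_ne hpos hc hX (m := 1) (by norm_num) (by decide),
        etaTensor_ne hpos hc hX (m := 1) (by norm_num) (by decide),
        etaTensor_ne hpos hc hX (m := 1) (by norm_num) (by decide), h1, h2, h3, h4, wh1, wh2,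
        wh3, wh4⟩
    · have hc : Nat.Coprime 12 N := Nat.Coprime.mul_left h4 h3
      obtain ⟨h1, wh1⟩ := hX.etaTensor_and_sum (by norm_num) hpos hc
        isRigidTwelve_neg_one_two.twist.isRigidEta_twelve (by decide)
      obtain ⟨h2, wh2⟩ := hX.etaTensor_and_sum (by norm_num) hpos hc
        isRigidTwelve_neg_one_two.swap.twist.isRigidEta_twelve (by decide)
      obtain ⟨h3, wh3⟩ := hX.etaTensor_and_sum (by norm_num) hpos hc
        isRigidTwelve_two_neg_one.twist.isRigidEta_twelve (by decide)
      obtain ⟨h4, wh4⟩ := hX.etaTensor_and_sum (by norm_num) hpos hc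
        isRigidTwelve_two_neg_one.swap.twist.isRigidEta_twelve (by decide)
      exact ⟨_, _, _, _, etaTensor_ne hpos hc hX (m := 1) (by norm_num) (by decide),
        etaTensor_ne hpos hc hX (m := 1) (by norm_num) (by decide),
        etaTensor_ne hpos hc hX (m := 2) (by norm_num) (by decide),
        etaTensor_ne hpos hc hX (m := 1) (by norm_num) (by decide),
        etaTensor_ne hpos hc hX (m := 1) (by norm_num) (by decide),
        etaTensor_ne hpos hc hX (m := 1) (by norm_num) (by decide), h1, h2, h3, h4, wh1, wh2,
        wh3, wh4⟩
end

section
/- For every N ∈ ℕ and all divisors d, t of N, the rational number N·gcd(d,t)²/(d·gcd(t²,N)) is a positive integer; that is, d·gcd(t²,N) divides N·gcd(d,t)². Consequently, the order of η_d at any cusp of Γ₀(N) lies in (1/24)·ℕ. -/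
/-- If `d ∣ N`, then `d * gcd (t ^ 2) N` divides both `N * d ^ 2` and `N * t ^ 2`, hence
`N * gcd d t ^ 2`. -/
theorem mul_gcd_sq_dvd_mul_sq_gcd {N d : ℕ} (t : ℕ) (hd : d ∣ N) :
    d * Nat.gcd (t ^ 2) N ∣ N * Nat.gcd d t ^ 2 := by
  rw [← Nat.pow_gcd_pow, ← Nat.gcd_mul_left N]
  refine Nat.dvd_gcd ?_ (mul_dvd_mul hd (Nat.gcd_dvd_left _ _))
  rw [mul_comm N]
  exact mul_dvd_mul (dvd_pow_self d two_ne_zero) (Nat.gcd_dvd_right _ _)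

/-- For all divisors `d, t` of `N`, the rational number `N·gcd(d,t)²/(d·gcd(t²,N))`
is a positive integer, i.e. `d·gcd(t²,N)` divides `N·gcd(d,t)²`; consequently the
order `N·gcd(d,t)²/(24·d·gcd(t²,N))` of `η_d` at any cusp `a/t` of `Γ₀(N)` lies in
`(1/24)·ℕ`. -/
theorem eta_order_is_integral_over_24 (N : ℕ) (hN : 0 < N) (d t : ℕ)
    (hd : d ∣ N) (ht : t ∣ N) :
    d * Nat.gcd (t ^ 2) N ∣ N * Nat.gcd d t ^ 2 ∧
    ∃ k : ℕ, 0 < k ∧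
      ((N : ℚ) * (Nat.gcd d t : ℚ) ^ 2) / ((d : ℚ) * (Nat.gcd (t ^ 2) N : ℚ)) = (k : ℚ) ∧
      ((N : ℚ) * (Nat.gcd d t : ℚ) ^ 2) / (24 * (d : ℚ) * (Nat.gcd (t ^ 2) N : ℚ)) =
        (k : ℚ) / 24 := by
  have hdvd := mul_gcd_sq_dvd_mul_sq_gcd t hd
  have hd0 : 0 < d := Nat.pos_of_dvd_of_pos hd hN
  have hg : 0 < Nat.gcd (t ^ 2) N := Nat.gcd_pos_of_pos_right _ hN
  have hdt : 0 < Nat.gcd d t := Nat.gcd_pos_of_pos_left _ hd0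
  refine ⟨hdvd, ?_⟩
  obtain ⟨k, hk⟩ := hdvd
  have hk0 : 0 < k := by
    have hpos : 0 < N * Nat.gcd d t ^ 2 := by positivity
    exact Nat.pos_of_mul_pos_left (hk ▸ hpos)
  have hkQ : (N : ℚ) * (Nat.gcd d t : ℚ) ^ 2 = d * (Nat.gcd (t ^ 2) N : ℚ) * k := by
    exact_mod_cast hk
  have hdQ : (d : ℚ) ≠ 0 := by exact_mod_cast hd0.ne'
  have hgQ : (Nat.gcd (t ^ 2) N : ℚ) ≠ 0 := by exact_mod_cast hg.ne'
  refine ⟨k, hk0, ?_, ?_⟩ <;> rw [hkQ] <;> field_simp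
end

section
/- Let p be a prime and n ∈ ℕ. The (n+1)×(n+1) matrix Â_{pⁿ} with entries Â_{pⁿ}(i,j) = p^{n−|i−j|} for 0 ≤ i, j ≤ n is invertible over ℚ, and its inverse is the tridiagonal matrix B with B(i,j) = (1/(pⁿ(1−p^{-2})))·c_{ij}, where c_{00} = c_{nn} = 1, c_{ii} = 1 + p^{-2} for 0 < i < n, c_{ij} = −1/p if |i−j| = 1, and c_{ij} = 0 if |i−j| > 1; that is, Â_{pⁿ}·B = I. -/
/-- The symmetrized order matrix `Â_{pⁿ}` of a prime power level, as an
`(n+1)×(n+1)` matrix: `Â_{pⁿ}(i,j) = p^{n−|i−j|}`. -/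
def Apow (p n : ℕ) : Matrix (Fin (n + 1)) (Fin (n + 1)) ℚ :=
  fun i j => (p : ℚ) ^ (n - ((i : ℤ) - (j : ℤ)).natAbs)

/-- The claimed tridiagonal inverse of `Â_{pⁿ}`:
`B(i,j) = (1/(pⁿ(1−p⁻²)))·c_{ij}` with `c₀₀ = c_{nn} = 1`, `c_{ii} = 1 + p⁻²` for
`0 < i < n`, `c_{ij} = −1/p` for `|i−j| = 1` and `c_{ij} = 0` for `|i−j| > 1`. -/
def Binv (p n : ℕ) : Matrix (Fin (n + 1)) (Fin (n + 1)) ℚ :=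
  fun i j =>
    (1 / ((p : ℚ) ^ n * (1 - 1 / (p : ℚ) ^ 2))) *
      (if i = j then (if (i : ℕ) = 0 ∨ (i : ℕ) = n then 1 else 1 + 1 / (p : ℚ) ^ 2)
       else if ((i : ℤ) - (j : ℤ)).natAbs = 1 then -1 / (p : ℚ) else 0)

/-- Summing against a tridiagonal column keeps only the three terms around the diagonal. -/
theorem Finset.sum_range_mul_tridiagonal {R : Type*} [Ring R] (f : ℕ → R) (d x : R) {n j : ℕ}
    (hj : j ≤ n) :
    ∑ k ∈ Finset.range (n + 1),
        f k * (if k = j then d else if ((k : ℤ) - (j : ℤ)).natAbs = 1 then x else 0) =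
      f j * d + (if j = 0 then 0 else f (j - 1) * x) + (if j = n then 0 else f (j + 1) * x) := by
  have h_split : ∀ k ∈ Finset.range (n + 1),
      f k * (if k = j then d else if ((k : ℤ) - (j : ℤ)).natAbs = 1 then x else 0) =
        (if k = j then f k * d else 0) +
          (if k = j - 1 then (if j = 0 then 0 else f k * x) else 0) +
          (if k = j + 1 then f k * x else 0) := by
    intro k _
    split_ifs <;> first | omega | simp
  rw [Finset.sum_congr rfl h_split]
  simp only [Finset.sum_add_distrib, Finset.sum_ite_eq', Finset.mem_range]
  congr 1
  · rw [if_pos (by omega), if_pos (by omega)]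
  · split_ifs <;> first | omega | rfl

theorem Apow_apply {p n : ℕ} (hp : p ≠ 0) (i j : Fin (n + 1)) :
    Apow p n i j = (p : ℚ) ^ n * (p : ℚ)⁻¹ ^ ((i : ℤ) - (j : ℤ)).natAbs := by
  have hp' : (p : ℚ) ≠ 0 := by exact_mod_cast hp
  rw [Apow, pow_sub₀ _ hp' (by omega), inv_pow]

/-- The tridiagonal matrix annihilates `k ↦ x ^ |i - k|` away from the index `i`. -/
theorem tridiagonal_pow_natAbs_sub {R : Type*} [CommRing R] (x : R) {n i j : ℕ} (hn : 0 < n)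
    (hi : i ≤ n) (hj : j ≤ n) :
    x ^ ((i : ℤ) - (j : ℤ)).natAbs * (if j = 0 ∨ j = n then 1 else 1 + x ^ 2) +
        (if j = 0 then 0 else x ^ ((i : ℤ) - ((j - 1 : ℕ) : ℤ)).natAbs * -x) +
        (if j = n then 0 else x ^ ((i : ℤ) - ((j + 1 : ℕ) : ℤ)).natAbs * -x) =
      if i = j then 1 - x ^ 2 else 0 := by
  rcases lt_trichotomy i j with h | rfl | h
  · obtain ⟨d, rfl⟩ := Nat.exists_eq_add_of_lt h
    rw [show ((i : ℤ) - ((i + d + 1 : ℕ) : ℤ)).natAbs = d + 1 by omega,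
      show ((i : ℤ) - ((i + d + 1 - 1 : ℕ) : ℤ)).natAbs = d by omega,
      show ((i : ℤ) - ((i + d + 1 + 1 : ℕ) : ℤ)).natAbs = d + 2 by omega]
    simp only [Nat.add_one_ne_zero, false_or, if_false]
    split_ifs <;> first | omega | ring
  · rw [show ((i : ℤ) - ((i + 1 : ℕ) : ℤ)).natAbs = 1 by omega, sub_self]
    rcases Nat.eq_zero_or_pos i with rfl | h
    · simp [hn.ne]
      ring
    · rw [show ((i : ℤ) - ((i - 1 : ℕ) : ℤ)).natAbs = 1 by omega, Int.natAbs_zero]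
      split_ifs <;> first | omega | ring
  · obtain ⟨d, rfl⟩ := Nat.exists_eq_add_of_lt h
    rw [show (((j + d + 1 : ℕ) : ℤ) - (j : ℤ)).natAbs = d + 1 by omega,
      show (((j + d + 1 : ℕ) : ℤ) - ((j + 1 : ℕ) : ℤ)).natAbs = d by omega]
    rcases Nat.eq_zero_or_pos j with rfl | hj0
    · simp [hn.ne]
      ring
    · rw [show (((j + d + 1 : ℕ) : ℤ) - ((j - 1 : ℕ) : ℤ)).natAbs = d + 2 by omega]
      split_ifs <;> first | omega | ring

/-- For a prime `p` and `n ≥ 1`, the matrix `Â_{pⁿ}` is invertible over `ℚ` with the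
tridiagonal inverse `Binv p n`: `Â_{pⁿ}·B = I = B·Â_{pⁿ}`. -/
theorem Apow_mul_Binv_eq_one (p : ℕ) (hp : p.Prime) (n : ℕ) (hn : 0 < n) :
    Apow p n * Binv p n = 1 ∧ Binv p n * Apow p n = 1 := by
  have h_right : Apow p n * Binv p n = 1 := by
    have hp0 : (p : ℚ) ≠ 0 := by exact_mod_cast hp.ne_zero
    have hp1 : (1 : ℚ) < p := by exact_mod_cast hp.one_lt
    have hx : 1 - (p : ℚ)⁻¹ ^ 2 ≠ 0 :=
      (sub_pos.2 (pow_lt_one₀ (by positivity) (inv_lt_one_of_one_lt₀ hp1) two_ne_zero)).ne'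
    ext i j
    have h_entry : ∀ k : Fin (n + 1), Apow p n i k * Binv p n k j =
        (1 - (p : ℚ)⁻¹ ^ 2)⁻¹ * ((p : ℚ)⁻¹ ^ ((i : ℤ) - ((k : ℕ) : ℤ)).natAbs *
          (if (k : ℕ) = j then (if (j : ℕ) = 0 ∨ (j : ℕ) = n then 1 else 1 + (p : ℚ)⁻¹ ^ 2)
            else if (((k : ℕ) : ℤ) - ((j : ℕ) : ℤ)).natAbs = 1 then -(p : ℚ)⁻¹ else 0)) := by
      intro k
      rw [Apow_apply hp.ne_zero, Binv]
      have h_scalar : 1 / ((p : ℚ) ^ n * (1 - 1 / (p : ℚ) ^ 2)) =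
          ((p : ℚ) ^ n)⁻¹ * (1 - (p : ℚ)⁻¹ ^ 2)⁻¹ := by
        rw [one_div, mul_inv, one_div, inv_pow]
      have h_coeff : (if k = j then (if (k : ℕ) = 0 ∨ (k : ℕ) = n then 1 else 1 + 1 / (p : ℚ) ^ 2)
          else if ((k : ℤ) - (j : ℤ)).natAbs = 1 then -1 / (p : ℚ) else 0) =
          (if (k : ℕ) = j then (if (j : ℕ) = 0 ∨ (j : ℕ) = n then 1 else 1 + (p : ℚ)⁻¹ ^ 2)
            else if (((k : ℕ) : ℤ) - ((j : ℕ) : ℤ)).natAbs = 1 then -(p : ℚ)⁻¹ else 0) := by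
        rw [one_div, inv_pow, neg_div, one_div]
        by_cases h : k = j
        · subst h
          simp
        · simp [h, Fin.val_inj]
      rw [h_scalar, h_coeff]
      field_simp
    rw [Matrix.mul_apply, Finset.sum_congr rfl fun k _ => h_entry k, ← Finset.mul_sum,
      Fin.sum_univ_eq_sum_range (fun k : ℕ => (p : ℚ)⁻¹ ^ ((i : ℤ) - (k : ℤ)).natAbs *
          (if k = j then (if (j : ℕ) = 0 ∨ (j : ℕ) = n then 1 else 1 + (p : ℚ)⁻¹ ^ 2)
            else if ((k : ℤ) - ((j : ℕ) : ℤ)).natAbs = 1 then -(p : ℚ)⁻¹ else 0)) (n + 1),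
      Finset.sum_range_mul_tridiagonal (fun k : ℕ => (p : ℚ)⁻¹ ^ ((i : ℤ) - (k : ℤ)).natAbs) _ _
        j.is_le, tridiagonal_pow_natAbs_sub _ hn i.is_le j.is_le, Matrix.one_apply]
    simp only [Fin.val_inj]
    split_ifs
    · exact inv_mul_cancel₀ hx
    · exact mul_zero _
  exact ⟨h_right, mul_eq_one_comm.1 h_right⟩
end
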